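/- A recurrent orientation-reversing homeomorphism of the closed disc D² is an involution. -/

import Mathlib

open Filter Topology Metric

/-- `f` is recurrent with respect to the metric `m`: some sequence of iterates
`f^[n k]` with `n k → ∞` converges uniformly to the identity. -/
def RecurrentWith {X : Type*} (m : MetricSpace X) (f : X → X) : Prop :=
  ∃ n : ℕ → ℕ, Filter.Tendsto n Filter.atTop Filter.atTop ∧
    ∀ ε > 0, ∀ᶠ k in Filter.atTop, ∀ x, @dist X m.toDist (f^[n k] x) x < ε

/-- `f` is a recurrent map of the metric space `X`. -/
def IsRecurrent {X : Type*} [m : MetricSpace X] (f : X → X) : Prop :=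
  RecurrentWith m f

/-- The closed unit disc in the plane. -/
abbrev Disc2 : Set (EuclideanSpace ℝ (Fin 2)) := Metric.closedBall 0 1

/-- The standard parametrization of the boundary circle of the disc. -/
noncomputable def circlePt (t : ℝ) : EuclideanSpace ℝ (Fin 2) :=
  (EuclideanSpace.equiv (Fin 2) ℝ).symm ![Real.cos (2 * Real.pi * t), Real.sin (2 * Real.pi * t)]

/-- A homeomorphism of the closed disc is orientation-preserving iff its
restriction to the boundary circle is an orientation-preserving circle
homeomorphism, i.e. admits a strictly increasing lift commuting with `t ↦ t+1`. -/
def DiscOrientationPreserving (f : Disc2 ≃ₜ Disc2) : Prop :=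
  ∃ F : ℝ → ℝ, StrictMono F ∧ (∀ t, F (t + 1) = F t + 1) ∧
    ∀ (t : ℝ) (h : circlePt t ∈ Disc2),
      ((f ⟨circlePt t, h⟩ : Disc2) : EuclideanSpace ℝ (Fin 2)) = circlePt (F t)

/-- A homeomorphism of the closed disc is orientation-reversing iff its
restriction to the boundary circle admits a strictly decreasing lift with
period relation `F (t+1) = F t - 1`. -/
def DiscOrientationReversing (f : Disc2 ≃ₜ Disc2) : Prop :=
  ∃ F : ℝ → ℝ, StrictAnti F ∧ (∀ t, F (t + 1) = F t - 1) ∧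
    ∀ (t : ℝ) (h : circlePt t ∈ Disc2),
      ((f ⟨circlePt t, h⟩ : Disc2) : EuclideanSpace ℝ (Fin 2)) = circlePt (F t)

theorem exists_clog {A : Type*} [TopologicalSpace A] [SimplyConnectedSpace A]
    [LocallyPathConnectedSpace A] (f : A → ℂ) (hf : Continuous f) (h0 : ∀ a, f a ≠ 0) :
    ∃ g : A → ℂ, Continuous g ∧ ∀ a, Complex.exp (g a) = f a := by
  obtain ⟨a₀⟩ : Nonempty A := inferInstance
  obtain ⟨F, ⟨-, hF⟩, -⟩ := Complex.isCoveringMapOn_exp.existsUnique_continuousMap_lifts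
    (⟨f, hf⟩ : C(A, ℂ)) (a₀ := a₀) (e₀ := Complex.log (f a₀)) (Complex.exp_log (h0 a₀))
    (fun a => by simpa using h0 a)
  exact ⟨F, F.continuous, fun a => congrFun hF a⟩

/-- a continuous function with values in `2πiℤ` on a preconnected set is constant -/
theorem exp_one_const {X : Type*} [TopologicalSpace X] {S : Set X} (hS : IsPreconnected S)
    {g : X → ℂ} (hg : ContinuousOn g S) (h1 : ∀ x ∈ S, Complex.exp (g x) = 1)
    {x y : X} (hx : x ∈ S) (hy : y ∈ S) : g x = g y := by
  have hd : DiscreteTopology (AddSubgroup.zmultiples (2 * Real.pi * Complex.I)) :=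
    NormedSpace.discreteTopology_zmultiples _
  refine hS.constant_of_mapsTo (T := (AddSubgroup.zmultiples (2 * Real.pi * Complex.I) : Set ℂ))
    (isDiscrete_iff_discreteTopology.2 hd) hg ?_ hx hy
  intro z hz
  obtain ⟨n, hn⟩ := Complex.exp_eq_one_iff.1 (h1 z hz)
  exact ⟨n, by simp [hn]⟩

theorem log_diff_const {X : Type*} [TopologicalSpace X] {S : Set X} (hS : IsPreconnected S)
    {g g' : X → ℂ} (hg : ContinuousOn g S) (hg' : ContinuousOn g' S)
    (h1 : ∀ x ∈ S, Complex.exp (g x) = Complex.exp (g' x))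
    {x y : X} (hx : x ∈ S) (hy : y ∈ S) : g x - g' x = g y - g' y := by
  refine exp_one_const (g := fun x => g x - g' x) hS (hg.sub hg') ?_ hx hy
  intro z hz
  rw [Complex.exp_sub, h1 z hz, div_self (Complex.exp_ne_zero _)]

theorem log_eq_of_eq {X : Type*} [TopologicalSpace X] {S : Set X} (hS : IsPreconnected S)
    {g g' : X → ℂ} (hg : ContinuousOn g S) (hg' : ContinuousOn g' S)
    (h1 : ∀ x ∈ S, Complex.exp (g x) = Complex.exp (g' x))
    {x y : X} (hx : x ∈ S) (hy : y ∈ S) (he : g x = g' x) : g y = g' y := by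
  have := log_diff_const hS hg hg' h1 hx hy
  rw [he, sub_self] at this
  exact (sub_eq_zero.1 this.symm)

theorem slit_of_lt {z : ℂ} (h : ‖z - 1‖ < 1) : z ∈ Complex.slitPlane := by
  have : z = 1 + (z - 1) := by ring
  rw [this]
  exact Complex.mem_slitPlane_of_norm_lt_one h

theorem winding_line {G g : ℂ → ℂ} (hg : Continuous g)
    (hG : ∀ ξ, Complex.exp (g ξ) = G (Complex.exp ξ))
    {a : ℂ} (ha : a ≠ 0) {m : ℕ} {r : ℝ} (hr : 0 < r)
    (h : ∀ ζ : ℂ, ‖ζ‖ = r → ‖G ζ - a * ζ ^ m‖ < ‖a * ζ ^ m‖) :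
    g (Real.log r + 2 * Real.pi * Complex.I) - g (Real.log r) = m * (2 * Real.pi * Complex.I) := by
  have hn : ∀ t : ℝ, ‖Complex.exp (Real.log r + t * Complex.I)‖ = r := by
    intro t
    rw [Complex.norm_exp]; simp [Real.exp_log hr]
  let q : ℝ → ℂ := fun t => Complex.exp (g (Real.log r + t * Complex.I)) /
      (a * Complex.exp (Real.log r + t * Complex.I) ^ m)
  have hne : ∀ t : ℝ, a * Complex.exp (Real.log r + t * Complex.I) ^ m ≠ 0 := fun t =>
    mul_ne_zero ha (pow_ne_zero _ (Complex.exp_ne_zero _))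
  have hq : ∀ t, q t ∈ Complex.slitPlane := by
    intro t
    apply slit_of_lt
    have := h _ (hn t)
    have h2 : q t - 1 = (Complex.exp (g (Real.log r + t * Complex.I)) -
      a * Complex.exp (Real.log r + t * Complex.I) ^ m) /
      (a * Complex.exp (Real.log r + t * Complex.I) ^ m) := by
      simp only [q]; rw [sub_div, div_self (hne t)]
    rw [h2, norm_div, div_lt_one (norm_pos_iff.2 (hne t)), hG]
    exact this
  have hqc : Continuous q := by
    refine Continuous.div ?_ ?_ hne <;> fun_prop
  have key := log_diff_const (X := ℝ) (S := Set.univ) isPreconnected_univ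
    (g := fun t => g (Real.log r + t * Complex.I))
    (g' := fun t => Complex.log (q t) + m * (Real.log r + t * Complex.I) + Complex.log a)
    (by fun_prop)
    (by
      apply Continuous.continuousOn
      have : Continuous fun t => Complex.log (q t) := hqc.clog hq
      fun_prop)
    (by
      intro t _
      rw [Complex.exp_add, Complex.exp_add, Complex.exp_log ha, Complex.exp_nat_mul,
        Complex.exp_log (Complex.slitPlane_ne_zero (hq t))]
      simp only [q]
      have := hne t
      field_simp
      )
    (Set.mem_univ (2 * Real.pi)) (Set.mem_univ 0)
  have hq0 : q (2 * Real.pi) = q 0 := by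
    have e1 : Complex.exp (Real.log r + (2 * Real.pi : ℝ) * Complex.I) =
        Complex.exp (Real.log r + (0 : ℝ) * Complex.I) := by
      rw [Complex.exp_add]; push_cast; rw [Complex.exp_two_pi_mul_I]; simp
    simp only [q, hG, e1]
  simp only [hq0] at key
  push_cast at key
  rw [zero_mul, add_zero] at key
  linear_combination key

/-- two different winding numbers are impossible for a nonvanishing function on the annulus -/
theorem winding_contra {G : ℂ → ℂ} (hGc : ContinuousOn G {0}ᶜ) (hG0 : ∀ ζ, ζ ≠ 0 → G ζ ≠ 0)
    {a b : ℂ} {m n : ℕ} (hmn : m ≠ n) {r s : ℝ} (hr : 0 < r) (hs : 0 < s)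
    (ha : a ≠ 0) (hb : b ≠ 0)
    (h1 : ∀ ζ : ℂ, ‖ζ‖ = r → ‖G ζ - a * ζ ^ m‖ < ‖a * ζ ^ m‖)
    (h2 : ∀ ζ : ℂ, ‖ζ‖ = s → ‖G ζ - b * ζ ^ n‖ < ‖b * ζ ^ n‖) : False := by
  obtain ⟨g, hg, hgG⟩ := exists_clog (fun ξ => G (Complex.exp ξ))
    (hGc.comp_continuous Complex.continuous_exp (fun x => by simp))
    (fun ξ => hG0 _ (Complex.exp_ne_zero _))
  have e1 := winding_line hg hgG ha hr h1
  have e2 := winding_line hg hgG hb hs h2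
  have e3 := exp_one_const (S := Set.univ) isPreconnected_univ
    (g := fun ξ => g (ξ + 2 * Real.pi * Complex.I) - g ξ) (by fun_prop)
    (by intro ξ _; rw [Complex.exp_sub, hgG, hgG, Complex.exp_add, Complex.exp_two_pi_mul_I,
          mul_one, div_self (hG0 _ (Complex.exp_ne_zero _))])
    (Set.mem_univ (Real.log r : ℂ)) (Set.mem_univ (Real.log s : ℂ))
  simp only [e1, e2] at e3
  have := mul_right_cancel₀ Complex.two_pi_I_ne_zero e3
  exact hmn (by exact_mod_cast this)

/-- the identity outside the open unit disc -/
def IdOut (h : ℂ ≃ₜ ℂ) : Prop := ∀ x : ℂ, 1 ≤ ‖x‖ → h x = x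

/-- recurrence -/
def Recu (h : ℂ ≃ₜ ℂ) : Prop := ∀ ε > 0, ∀ N : ℕ, ∃ n ≥ N, ∀ x, ‖(h ^ n) x - x‖ < ε

theorem pow_succ_app (h : ℂ ≃ₜ ℂ) (n : ℕ) (x : ℂ) : (h ^ (n + 1)) x = h ((h ^ n) x) := by
  rw [pow_succ']; rfl

theorem pow_succ_app' (h : ℂ ≃ₜ ℂ) (n : ℕ) (x : ℂ) : (h ^ (n + 1)) x = (h ^ n) (h x) := by
  rw [pow_succ]; rfl

theorem pow_add_app (h : ℂ ≃ₜ ℂ) (m n : ℕ) (x : ℂ) : (h ^ (m + n)) x = (h ^ m) ((h ^ n) x) := by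
  rw [pow_add]; rfl

theorem inv_mul_app (h : ℂ ≃ₜ ℂ) (x : ℂ) : h⁻¹ (h x) = x := h.symm_apply_apply x
theorem mul_inv_app (h : ℂ ≃ₜ ℂ) (x : ℂ) : h (h⁻¹ x) = x := h.apply_symm_apply x

theorem pow_fix {h : ℂ ≃ₜ ℂ} {x : ℂ} (hx : h x = x) (n : ℕ) : (h ^ n) x = x := by
  induction n with
  | zero => simp
  | succ n ih => rw [pow_succ_app, ih, hx]

theorem inv_fix {h : ℂ ≃ₜ ℂ} {x : ℂ} (hx : h x = x) : h⁻¹ x = x := by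
  conv_lhs => rw [← hx]
  exact inv_mul_app h x

namespace IdOut
variable {h g : ℂ ≃ₜ ℂ}

theorem one : IdOut 1 := fun _ _ => rfl
theorem mul (hg : IdOut g) (hh : IdOut h) : IdOut (g * h) := by
  intro x hx
  rw [Homeomorph.mul_apply, hh x hx, hg x hx]
theorem inv (hh : IdOut h) : IdOut h⁻¹ := fun x hx => inv_fix (hh x hx)
theorem pow (hh : IdOut h) (n : ℕ) : IdOut (h ^ n) := fun x hx => pow_fix (hh x hx) n
theorem zpow (hh : IdOut h) (n : ℤ) : IdOut (h ^ n) := by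
  cases n with
  | ofNat n => simpa using hh.pow n
  | negSucc n => rw [zpow_negSucc]; exact (hh.pow _).inv

theorem lt_of_lt (hh : IdOut h) {x : ℂ} (hx : ‖x‖ < 1) : ‖h x‖ < 1 := by
  by_contra hc
  have := hh.inv (h x) (not_lt.1 hc)
  rw [inv_mul_app] at this
  rw [← this] at hc
  exact hc hx

theorem disp (hh : IdOut h) (x : ℂ) : ‖h x - x‖ ≤ 2 := by
  by_cases hx : ‖x‖ < 1
  · have := hh.lt_of_lt hx
    calc ‖h x - x‖ ≤ ‖h x‖ + ‖x‖ := norm_sub_le _ _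
      _ ≤ 2 := by linarith
  · rw [hh x (not_lt.1 hx)]; simp

end IdOut

theorem pow_disp {h : ℂ ≃ₜ ℂ} {η : ℝ} (hη : ∀ x, ‖h x - x‖ ≤ η) (n : ℕ) (x : ℂ) :
    ‖(h ^ n) x - x‖ ≤ n * η := by
  induction n with
  | zero => simp
  | succ n ih =>
    rw [pow_succ_app]
    calc ‖h ((h ^ n) x) - x‖ = ‖(h ((h ^ n) x) - (h ^ n) x) + ((h ^ n) x - x)‖ := by ring_nf
      _ ≤ _ := norm_add_le _ _
      _ ≤ η + n * η := add_le_add (hη _) ih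
      _ = _ := by push_cast; ring

namespace Recu
variable {h : ℂ ≃ₜ ℂ}

theorem pow (hr : Recu h) {i : ℕ} (hi : 0 < i) : Recu (h ^ i) := by
  intro ε hε N
  have hi' : (0:ℝ) < i := by exact_mod_cast hi
  obtain ⟨n, hn, hx⟩ := hr (ε / (2 * i)) (by positivity) N
  refine ⟨n, hn, fun x => ?_⟩
  rw [← pow_mul, mul_comm, pow_mul]
  refine lt_of_le_of_lt (pow_disp (fun x => (hx x).le) i x) ?_
  have : i * (ε / (2 * i)) = ε / 2 := by field_simp
  rw [this]; linarith

theorem inv (hr : Recu h) : Recu h⁻¹ := by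
  intro ε hε N
  obtain ⟨n, hn, hx⟩ := hr ε hε N
  refine ⟨n, hn, fun x => ?_⟩
  rw [inv_pow]
  have := hx ((h ^ n)⁻¹ x)
  rw [mul_inv_app] at this
  rwa [norm_sub_rev]

theorem conj (hr : Recu h) {ψ : ℂ ≃ₜ ℂ} (hψ : IdOut ψ) : Recu (ψ * h * ψ⁻¹) := by
  have huc : UniformContinuous ψ := by
    have hcs : HasCompactSupport (fun x => ψ x - x) := by
      refine HasCompactSupport.intro (isCompact_closedBall (0:ℂ) 1) ?_
      intro x hx
      rw [hψ x, sub_self]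
      simp at hx; exact hx.le
    have h1 : UniformContinuous (fun x => ψ x - x) :=
      hcs.uniformContinuous_of_continuous (ψ.continuous.sub continuous_id)
    simpa using h1.add uniformContinuous_id
  intro ε hε N
  obtain ⟨δ, hδ, hd⟩ := Metric.uniformContinuous_iff.1 huc ε hε
  obtain ⟨n, hn, hx⟩ := hr δ hδ N
  refine ⟨n, hn, fun x => ?_⟩
  have e : (ψ * h * ψ⁻¹) ^ n = ψ * h ^ n * ψ⁻¹ := conj_pow
  rw [e, Homeomorph.mul_apply, Homeomorph.mul_apply]
  have := hd (a := (h ^ n) (ψ⁻¹ x)) (b := ψ⁻¹ x) (by rw [dist_eq_norm]; exact hx _)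
  rwa [mul_inv_app, dist_eq_norm] at this

theorem ne_zero (hr : Recu h) {ε : ℝ} (hε : 0 < ε) : ∃ n > 0, ∀ x, ‖(h ^ n) x - x‖ < ε :=
  hr ε hε 1

end Recu

structure IsLam (h : ℂ ≃ₜ ℂ) (Λ : ℂ → ℂ → ℂ) : Prop where
  cont : ContinuousOn (fun p : ℂ × ℂ => Λ p.1 p.2) {p | p.1 ≠ p.2}
  exp : ∀ x y, x ≠ y → Complex.exp (Λ x y) = (h x - h y) / (x - y)
  norm : Λ 3 (-3) = 0

theorem slit_or_neg {z : ℂ} (hz : z ≠ 0) : z ∈ Complex.slitPlane ∨ -z ∈ Complex.slitPlane := by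
  by_contra hc
  push Not at hc
  rw [Complex.mem_slitPlane_iff, Complex.mem_slitPlane_iff] at hc
  simp at hc
  exact hz (Complex.ext (by simp; linarith [hc.1.1, hc.2.1]) (by simp [hc.1.2]))

theorem exists_isLam {h : ℂ ≃ₜ ℂ} (hh : IdOut h) : ∃ Λ, IsLam h Λ := by
  have hne : ∀ p : ℂ × ℂ, p.1 + Complex.exp p.2 ≠ p.1 - Complex.exp p.2 := by
    intro p he
    have : Complex.exp p.2 = 0 := by linear_combination he / 2
    exact Complex.exp_ne_zero _ this
  let R : ℂ × ℂ → ℂ := fun p =>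
    (h (p.1 + Complex.exp p.2) - h (p.1 - Complex.exp p.2)) / (2 * Complex.exp p.2)
  have hRc : Continuous R := by
    refine Continuous.div ?_ ?_ ?_
    · exact (h.continuous.comp (by fun_prop)).sub (h.continuous.comp (by fun_prop))
    · fun_prop
    · intro p; simp
  have hR0 : ∀ p, R p ≠ 0 := by
    intro p
    refine div_ne_zero (sub_ne_zero.2 fun he => hne p (h.injective he)) (by simp)
  have hR3 : ∀ ξ, ‖Complex.exp ξ‖ = 3 → R (0, ξ) = 1 := by
    intro ξ hξ
    simp only [R]
    rw [hh _ (by simp [hξ]), hh _ (by simp [hξ])]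
    have := Complex.exp_ne_zero ξ
    field_simp
    ring
  obtain ⟨g0, hg0, hgR0⟩ := exists_clog R hRc hR0
  let L3 : ℂ := Real.log 3
  have h3 : ∀ t : ℝ, ‖Complex.exp (L3 + t * Complex.I)‖ = 3 := by
    intro t; rw [Complex.norm_exp]
    have : (L3 + t * Complex.I).re = Real.log 3 := by
      simp only [L3, Complex.add_re, Complex.ofReal_re]; simp
    rw [this, Real.exp_log (by norm_num)]
  have h3' : ‖Complex.exp L3‖ = 3 := by simpa using h3 0
  obtain ⟨g, hg, hgR, hg3⟩ : ∃ g : ℂ × ℂ → ℂ, Continuous g ∧ (∀ a, Complex.exp (g a) = R a) ∧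
      g (0, L3) = 0 := by
    refine ⟨fun a => g0 a - g0 (0, L3), by fun_prop, ?_, by simp⟩
    intro a
    rw [Complex.exp_sub, hgR0, hgR0, hR3 _ h3', div_one]
  have hper : ∀ c ξ, g (c, ξ + 2 * Real.pi * Complex.I) = g (c, ξ) := by
    have e1 := fun p : ℂ × ℂ => exp_one_const (S := Set.univ) isPreconnected_univ
      (g := fun p : ℂ × ℂ => g (p.1, p.2 + 2 * Real.pi * Complex.I) - g p) (by fun_prop)
      (by
        intro p _
        rw [Complex.exp_sub, hgR, hgR]
        have : R (p.1, p.2 + 2 * Real.pi * Complex.I) = R p := by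
          simp only [R, Complex.exp_add, Complex.exp_two_pi_mul_I, mul_one]
        rw [this, div_self (hR0 p)])
      (Set.mem_univ p) (Set.mem_univ ((0 : ℂ), L3))
    have e2 := exp_one_const (S := Set.univ) isPreconnected_univ
      (g := fun t : ℝ => g (0, L3 + t * Complex.I)) (by fun_prop)
      (by intro t _; rw [hgR, hR3 _ (h3 t)])
      (Set.mem_univ (2 * Real.pi)) (Set.mem_univ 0)
    push_cast at e2
    rw [zero_mul, add_zero] at e2
    intro c ξ
    have := e1 (c, ξ)
    simp only [e2, sub_self] at this
    exact sub_eq_zero.1 this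
  have hper' : ∀ (n : ℕ) c ξ, g (c, ξ + n * (2 * Real.pi * Complex.I)) = g (c, ξ) := by
    intro n
    induction n with
    | zero => simp
    | succ n ih =>
      intro c ξ
      push_cast
      rw [add_mul, one_mul, ← add_assoc, hper, ih]
  have hdep : ∀ c ξ ξ', Complex.exp ξ = Complex.exp ξ' → g (c, ξ) = g (c, ξ') := by
    intro c ξ ξ' he
    obtain ⟨n, hn⟩ := Complex.exp_eq_exp_iff_exists_int.1 he
    rcases Int.eq_nat_or_neg n with ⟨m, rfl | rfl⟩
    · rw [hn]; exact_mod_cast hper' m c ξ'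
    · have : ξ' = ξ + m * (2 * Real.pi * Complex.I) := by rw [hn]; push_cast; ring
      rw [this, hper']
  refine ⟨fun x y => g ((x + y) / 2, Complex.log ((x - y) / 2)), ?_, ?_, ?_⟩
  · rintro ⟨x, y⟩ hxy
    have hxy' : (x - y) / 2 ≠ 0 := div_ne_zero (sub_ne_zero.2 hxy) two_ne_zero
    apply ContinuousAt.continuousWithinAt
    rcases slit_or_neg hxy' with hs | hs
    · have : ContinuousAt (fun p : ℂ × ℂ => Complex.log ((p.1 - p.2) / 2)) (x, y) :=
        ContinuousAt.clog (by fun_prop) hs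
      exact hg.continuousAt.comp (f := fun p : ℂ × ℂ => ((p.1 + p.2) / 2,
        Complex.log ((p.1 - p.2) / 2))) (by fun_prop)
    · have : ContinuousAt (fun p : ℂ × ℂ => Complex.log (-((p.1 - p.2) / 2))) (x, y) :=
        ContinuousAt.clog (by fun_prop) hs
      have h2 : ContinuousAt (fun p : ℂ × ℂ => g ((p.1 + p.2) / 2,
        Complex.log (-((p.1 - p.2) / 2)) + Real.pi * Complex.I)) (x, y) :=
        hg.continuousAt.comp (f := fun p : ℂ × ℂ => ((p.1 + p.2) / 2,
        Complex.log (-((p.1 - p.2) / 2)) + Real.pi * Complex.I)) (by fun_prop)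
      refine h2.congr ?_
      have hev : ∀ᶠ p : ℂ × ℂ in 𝓝 (x, y), (p.1 - p.2) / 2 ≠ 0 :=
        ContinuousAt.eventually_ne (by fun_prop) hxy'
      filter_upwards [hev] with p hp
      apply hdep
      rw [Complex.exp_add, Complex.exp_pi_mul_I, Complex.exp_log hp,
        Complex.exp_log (neg_ne_zero.2 hp)]
      ring
  · intro x y hxy
    have hxy' : (x - y) / 2 ≠ 0 := div_ne_zero (sub_ne_zero.2 hxy) two_ne_zero
    rw [hgR]
    simp only [R]
    rw [Complex.exp_log hxy']
    congr 3 <;> ring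
  · have : Complex.log ((3 - -3) / 2) = L3 := by
      norm_num [L3]
    rw [this]
    norm_num [hg3]

open Classical in
/-- the canonical continuous logarithm of the difference quotient -/
noncomputable def lam (h : ℂ ≃ₜ ℂ) : ℂ → ℂ → ℂ :=
  if H : ∃ Λ, IsLam h Λ then H.choose else 0

theorem isLam {h : ℂ ≃ₜ ℂ} (hh : IdOut h) : IsLam h (lam h) := by
  rw [lam, dif_pos (exists_isLam hh)]
  exact (exists_isLam hh).choose_spec

theorem preconn_far (r : ℝ) :
    IsPreconnected {p : ℂ × ℂ | p.1 ≠ p.2 ∧ 2 * r < ‖p.1 - p.2‖} := by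
  have hC : IsPreconnected ({q : ℂ × ℂ | r < Real.exp q.2.re}) := by
    have : {q : ℂ × ℂ | r < Real.exp q.2.re} = Set.univ ×ˢ (Complex.re ⁻¹' {t | r < Real.exp t}) := by
      ext; simp
    rw [this]
    refine isPreconnected_univ.prod (Convex.isPreconnected ?_)
    have hc : Convex ℝ {t : ℝ | r < Real.exp t} := by
      apply Set.OrdConnected.convex
      constructor
      intro a ha b hb c hc
      exact lt_of_lt_of_le ha (Real.exp_le_exp.2 hc.1)
    exact hc.linear_preimage Complex.reLm
  have := hC.image (fun q : ℂ × ℂ => (q.1 + Complex.exp q.2, q.1 - Complex.exp q.2))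
    (by fun_prop)
  convert this using 1
  ext ⟨x, y⟩
  simp only [Set.mem_ofPred_eq, Set.mem_image, Prod.mk.injEq, Prod.exists]
  constructor
  · rintro ⟨hne, hlt⟩
    have hz : (x - y) / 2 ≠ 0 := div_ne_zero (sub_ne_zero.2 hne) two_ne_zero
    refine ⟨(x + y) / 2, Complex.log ((x - y) / 2), ?_, ?_, ?_⟩
    · rw [← Complex.norm_exp, Complex.exp_log hz, norm_div]; simp; linarith
    · rw [Complex.exp_log hz]; ring
    · rw [Complex.exp_log hz]; ring
  · rintro ⟨c, ξ, hr, rfl, rfl⟩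
    have : c + Complex.exp ξ - (c - Complex.exp ξ) = 2 * Complex.exp ξ := by ring
    constructor
    · rw [← sub_ne_zero, this]; simp
    · rw [this, norm_mul, Complex.norm_exp]; simp; exact hr

theorem preconn_ne : IsPreconnected {p : ℂ × ℂ | p.1 ≠ p.2} := by
  have := preconn_far (-1)
  convert this using 1
  ext p
  simp only [Set.mem_ofPred_eq]
  constructor
  · intro hp; exact ⟨hp, by linarith [norm_nonneg (p.1 - p.2)]⟩
  · exact fun hp => hp.1

theorem IsLam.unique {h : ℂ ≃ₜ ℂ} {A B : ℂ → ℂ → ℂ} (hA : IsLam h A) (hB : IsLam h B) {x y : ℂ}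
    (hxy : x ≠ y) : A x y = B x y := by
  refine log_eq_of_eq preconn_ne hA.cont hB.cont ?_ (x := (3, -3)) (y := (x, y)) ?_ hxy ?_
  · intro p hp
    rw [hA.exp _ _ hp, hB.exp _ _ hp]
  · simp; norm_num
  · simp [hA.norm, hB.norm]

theorem lam_mul {g h : ℂ ≃ₜ ℂ} (hg : IdOut g) (hh : IdOut h) {x y : ℂ} (hxy : x ≠ y) :
    lam (g * h) x y = lam h x y + lam g (h x) (h y) := by
  refine (isLam (hg.mul hh)).unique (B := fun x y => lam h x y + lam g (h x) (h y)) ?_ hxy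
  have H := isLam hh
  have G := isLam hg
  refine ⟨H.cont.add ?_, ?_, ?_⟩
  · refine G.cont.comp (f := fun p : ℂ × ℂ => (h p.1, h p.2)) ?_ ?_
    · apply Continuous.continuousOn
      exact (h.continuous.comp continuous_fst).prodMk (h.continuous.comp continuous_snd)
    · intro p hp; exact fun he => hp (h.injective he)
  · intro x y hxy
    have h1 : h x - h y ≠ 0 := sub_ne_zero.2 fun he => hxy (h.injective he)
    have h2 : x - y ≠ 0 := sub_ne_zero.2 hxy
    rw [Complex.exp_add, H.exp x y hxy, G.exp _ _ (fun he => hxy (h.injective he)),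
      Homeomorph.mul_apply, Homeomorph.mul_apply]
    field_simp
  · rw [hh 3 (by norm_num), hh (-3) (by norm_num), H.norm, G.norm, add_zero]

theorem lam_eq_log {h : ℂ ≃ₜ ℂ} (hh : IdOut h) {η : ℝ} (hη3 : η < 3)
    (hη : ∀ x, ‖h x - x‖ ≤ η) {x y : ℂ} (hne : x ≠ y) (hxy : 2 * η < ‖x - y‖) :
    lam h x y = Complex.log ((h x - h y) / (x - y)) := by
  have H := isLam hh
  have hsl : ∀ x y : ℂ, x ≠ y → 2 * η < ‖x - y‖ → (h x - h y) / (x - y) ∈ Complex.slitPlane := by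
    intro x y hne hxy
    apply slit_of_lt
    have hxy0 : x - y ≠ 0 := sub_ne_zero.2 hne
    have : (h x - h y) / (x - y) - 1 = ((h x - x) - (h y - y)) / (x - y) := by
      field_simp; ring
    rw [this, norm_div, div_lt_one (norm_pos_iff.2 hxy0)]
    calc _ ≤ ‖h x - x‖ + ‖h y - y‖ := norm_sub_le _ _
      _ ≤ η + η := add_le_add (hη _) (hη _)
      _ < _ := by linarith
  refine log_eq_of_eq (preconn_far η) (g := fun p : ℂ × ℂ => lam h p.1 p.2)
    (g' := fun p : ℂ × ℂ => Complex.log ((h p.1 - h p.2) / (p.1 - p.2)))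
    (x := (3, -3)) (y := (x, y)) (H.cont.mono fun p hp => hp.1) ?_ ?_ ?_ ⟨hne, hxy⟩ ?_
  · rintro p hp
    have hp0 : p.1 - p.2 ≠ 0 := sub_ne_zero.2 hp.1
    apply ContinuousAt.continuousWithinAt
    refine ContinuousAt.clog (ContinuousAt.div ?_ (by fun_prop) hp0) (hsl _ _ hp.1 hp.2)
    exact ((h.continuous.comp continuous_fst).sub (h.continuous.comp continuous_snd)).continuousAt
  · intro p hp
    rw [H.exp _ _ hp.1, Complex.exp_log (Complex.slitPlane_ne_zero (hsl _ _ hp.1 hp.2))]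
  · constructor
    · simp; norm_num
    · simp only; norm_num; linarith
  · simp only
    rw [hh 3 (by norm_num), hh (-3) (by norm_num), H.norm]
    norm_num

theorem lam_small {x y : ℂ} (hxy : x ≠ y) {ε : ℝ} (hε : 0 < ε) :
    ∃ η > 0, ∀ h : ℂ ≃ₜ ℂ, IdOut h → (∀ z, ‖h z - z‖ < η) → ‖lam h x y‖ < ε := by
  have hc : ContinuousAt Complex.log 1 := continuousAt_clog (by simp)
  obtain ⟨δ, hδ, hd⟩ := Metric.continuousAt_iff.1 hc ε hε
  have hxy0 : 0 < ‖x - y‖ := norm_pos_iff.2 (sub_ne_zero.2 hxy)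
  refine ⟨min 1 (min (‖x - y‖ / 4) (δ * ‖x - y‖ / 4)), by positivity, ?_⟩
  intro h hh hz
  have h1 : ∀ z, ‖h z - z‖ ≤ ‖x - y‖ / 4 := fun z =>
    (hz z).le.trans ((min_le_right _ _).trans (min_le_left _ _))
  have h2 : ∀ z, ‖h z - z‖ ≤ δ * ‖x - y‖ / 4 := fun z =>
    (hz z).le.trans ((min_le_right _ _).trans (min_le_right _ _))
  have h3 : ∀ z, ‖h z - z‖ ≤ min 1 (‖x - y‖ / 4) := fun z =>
    le_min ((hz z).le.trans (min_le_left _ _)) (h1 z)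
  rw [lam_eq_log hh (η := min 1 (‖x - y‖ / 4)) (lt_of_le_of_lt (min_le_left _ _) (by norm_num)) h3
    hxy (by have := min_le_right 1 (‖x - y‖ / 4); linarith)]
  have := hd (x := (h x - h y) / (x - y)) ?_
  · simpa using this
  · have hxy1 : x - y ≠ 0 := sub_ne_zero.2 hxy
    have : (h x - h y) / (x - y) - 1 = ((h x - x) - (h y - y)) / (x - y) := by
      field_simp; ring
    rw [dist_eq_norm, this, norm_div, div_lt_iff₀ hxy0]
    calc _ ≤ ‖h x - x‖ + ‖h y - y‖ := norm_sub_le _ _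
      _ ≤ δ * ‖x - y‖ / 4 + δ * ‖x - y‖ / 4 := add_le_add (h2 _) (h2 _)
      _ < _ := by nlinarith [mul_pos hδ hxy0]

theorem lam_fix_fix {h : ℂ ≃ₜ ℂ} (hh : IdOut h) (hr : Recu h) {w w' : ℂ} (hne : w ≠ w')
    (hw : h w = w) (hw' : h w' = w') : lam h w w' = 0 := by
  have hn : ∀ n : ℕ, lam (h ^ (n + 1)) w w' = (n + 1) * lam h w w' := by
    intro n
    induction n with
    | zero => simp
    | succ n ih =>
      rw [pow_succ, lam_mul (hh.pow _) hh hne, hw, hw', ih]; push_cast; ring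
  obtain ⟨η, hη, hsm⟩ := lam_small hne (ε := 1) one_pos
  obtain ⟨n, hn0, hd⟩ := hr η hη 1
  obtain ⟨m, rfl⟩ : ∃ m, n = m + 1 := ⟨n - 1, by omega⟩
  have h1 := hsm _ (hh.pow (m + 1)) hd
  rw [hn m, norm_mul] at h1
  have h2 : ‖((m : ℂ) + 1)‖ = m + 1 := by
    have : ((m : ℂ) + 1) = ((m + 1 : ℕ) : ℂ) := by push_cast; rfl
    rw [this, Complex.norm_natCast]; push_cast; rfl
  rw [h2] at h1
  have h3 : ‖lam h w w'‖ < 1 := by nlinarith [norm_nonneg (lam h w w'), (Nat.cast_nonneg m : (0:ℝ) ≤ m)]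
  have h4 := (isLam hh).exp w w' hne
  rw [hw, hw', div_self (sub_ne_zero.2 hne)] at h4
  obtain ⟨k, hk⟩ := Complex.exp_eq_one_iff.1 h4
  rw [hk, norm_mul] at h3
  have h5 : ‖(2 * Real.pi * Complex.I : ℂ)‖ = 2 * Real.pi := by
    simp [abs_of_pos Real.pi_pos]
  rw [h5] at h3
  by_cases hk0 : k = 0
  · rw [hk, hk0]; simp
  · exfalso
    have : (1:ℝ) ≤ ‖(k:ℂ)‖ := by
      rw [Complex.norm_intCast]; exact_mod_cast Int.one_le_abs hk0
    nlinarith [Real.pi_gt_three]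

theorem swap_contra {g : ℂ ≃ₜ ℂ} (hg : IdOut g) {z1 z2 : ℂ} (hne : z1 ≠ z2) (h12 : g z1 = z2)
    (h21 : g z2 = z1) (hfix : ∀ x, g x = x → lam g x z1 + lam g x z2 = 0) : False := by
  obtain ⟨c, hc⟩ : ∃ c, c = (z1 + z2) / 2 := ⟨_, rfl⟩
  obtain ⟨e, he⟩ : ∃ e, e = (z1 - z2) / 2 := ⟨_, rfl⟩
  have e1 : z1 = c + e := by rw [hc, he]; ring
  have e2 : z2 = c - e := by rw [hc, he]; ring
  have he0 : e ≠ 0 := by rw [he]; exact div_ne_zero (sub_ne_zero.2 hne) two_ne_zero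
  let X : ℂ → ℂ := fun ζ => c + e * (ζ + ζ⁻¹) / 2
  let y : ℂ → ℂ := fun ζ => e * (ζ - ζ⁻¹) / 2
  let q : ℂ → ℂ := fun x => (x - z1) * (x - z2)
  let Th : ℂ → ℂ := fun x => lam g x z1 + lam g x z2
  let Y : ℂ → ℂ := fun ζ => y ζ * Complex.exp (Th (X ζ) / 2)
  let F : ℂ → ℂ := fun ζ => (g (X ζ) - c + Y ζ) * (e * ζ) - e ^ 2
  have hL := isLam hg
  have hyq : ∀ ζ, ζ ≠ 0 → y ζ ^ 2 = q (X ζ) := by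
    intro ζ hζ
    simp only [y, q, X, e1, e2]
    field_simp
    ring
  have hYq : ∀ ζ, ζ ≠ 0 → Y ζ ^ 2 = q (g (X ζ)) := by
    intro ζ hζ
    by_cases hq : q (X ζ) = 0
    · have h1 : y ζ = 0 := by
        have := hyq ζ hζ; rw [hq] at this; exact pow_eq_zero_iff two_ne_zero |>.1 this
      have h2 : q (g (X ζ)) = 0 := by
        simp only [q, mul_eq_zero, sub_eq_zero] at hq ⊢
        rcases hq with hq | hq
        · right; rw [hq, h12]
        · left; rw [hq, h21]
      simp only [Y, h1, h2]; simp
    · have hq' := hq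
      simp only [q, mul_eq_zero, sub_eq_zero, not_or] at hq'
      simp only [Y]
      rw [mul_pow, hyq ζ hζ, ← Complex.exp_nat_mul]
      have : ((2 : ℕ) : ℂ) * (Th (X ζ) / 2) = Th (X ζ) := by push_cast; ring
      rw [this]
      simp only [Th]
      rw [Complex.exp_add, hL.exp _ _ hq'.1, hL.exp _ _ hq'.2, h12, h21]
      have := sub_ne_zero.2 hq'.1
      have := sub_ne_zero.2 hq'.2
      simp only [q]
      field_simp
  have hXc : ContinuousOn X {0}ᶜ := by
    have : ContinuousOn (fun z : ℂ => z⁻¹) {0}ᶜ := continuousOn_inv₀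
    simp only [X]; fun_prop
  have hyc : ContinuousOn y {0}ᶜ := by
    have : ContinuousOn (fun z : ℂ => z⁻¹) {0}ᶜ := continuousOn_inv₀
    simp only [y]; fun_prop
  have hgX : ContinuousOn (fun ζ => g (X ζ)) {0}ᶜ := g.continuous.comp_continuousOn hXc
  have hYc : ContinuousOn Y {0}ᶜ := by
    intro ζ hζ
    by_cases hq : q (X ζ) = 0
    · have h1 : y ζ = 0 := by
        have := hyq ζ hζ; rw [hq] at this; exact pow_eq_zero_iff two_ne_zero |>.1 this
      have hY0 : Y ζ = 0 := by simp only [Y, h1, zero_mul]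
      rw [ContinuousWithinAt, hY0, tendsto_zero_iff_norm_tendsto_zero]
      have h2 : ContinuousWithinAt (fun ζ => Real.sqrt ‖q (g (X ζ))‖) {0}ᶜ ζ := by
        have := hgX ζ hζ
        simp only [q]
        refine ContinuousWithinAt.sqrt ?_
        exact ((this.sub continuousWithinAt_const).mul (this.sub continuousWithinAt_const)).norm
      have h3 : Real.sqrt ‖q (g (X ζ))‖ = 0 := by
        rw [← hYq ζ hζ, hY0]; simp
      rw [ContinuousWithinAt, h3] at h2
      refine h2.congr' ?_
      filter_upwards [self_mem_nhdsWithin] with ξ hξ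
      rw [← hYq ξ hξ, norm_pow, Real.sqrt_sq (norm_nonneg _)]
    · simp only [q, mul_eq_zero, sub_eq_zero, not_or] at hq
      have hl : ∀ z, X ζ ≠ z → ContinuousWithinAt (fun ζ => lam g (X ζ) z) {0}ᶜ ζ := by
        intro z hz
        have hcA : ContinuousAt (fun p : ℂ × ℂ => lam g p.1 p.2) (X ζ, z) := by
          refine hL.cont.continuousAt (IsOpen.mem_nhds ?_ hz)
          exact isOpen_ne_fun continuous_fst continuous_snd
        exact hcA.comp_continuousWithinAt (f := fun ζ => (X ζ, z))
          ((hXc ζ hζ).prodMk continuousWithinAt_const)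
      have := hl z1 hq.1
      have := hl z2 hq.2
      refine (hyc ζ hζ).mul (ContinuousWithinAt.cexp ?_)
      simp only [Th]
      exact ((hl z1 hq.1).add (hl z2 hq.2)).div_const _
  have hFc : ContinuousOn F {0}ᶜ := by
    simp only [F]; fun_prop
  have hF0 : ∀ ζ, ζ ≠ 0 → F ζ ≠ 0 := by
    intro ζ hζ h0
    have h1 : (g (X ζ) - c + Y ζ) * (g (X ζ) - c - Y ζ) = e ^ 2 := by
      have := hYq ζ hζ
      simp only [q, e1, e2] at this
      linear_combination -this
    have h2 : (g (X ζ) - c + Y ζ) * (e * ζ) = e ^ 2 := by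
      simp only [F] at h0
      linear_combination h0
    have h3 : g (X ζ) - c + Y ζ ≠ 0 := by
      intro h; rw [h, zero_mul] at h2
      exact he0 (pow_eq_zero_iff two_ne_zero |>.1 h2.symm)
    have h4 : g (X ζ) - c - Y ζ = e * ζ := mul_left_cancel₀ h3 (h1.trans h2.symm)
    have h5 : g (X ζ) - c + Y ζ = e * ζ⁻¹ := by
      apply mul_right_cancel₀ (mul_ne_zero he0 hζ)
      rw [h2]; field_simp
    have h6 : g (X ζ) = X ζ := by
      simp only [X] at h4 h5 ⊢
      linear_combination (h4 + h5) / 2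
    have h7 : Y ζ = - y ζ := by
      simp only [y]
      linear_combination (h5 - h4) / 2
    have h8 : y ζ ≠ 0 := by
      intro hy
      have := hyq ζ hζ
      rw [hy] at this
      simp only [q] at this
      have : (X ζ - z1) * (X ζ - z2) = 0 := by rw [← this]; ring
      simp only [mul_eq_zero, sub_eq_zero] at this
      rcases this with hx | hx <;> rw [hx] at h6
      · exact hne (h6.symm.trans h12)
      · exact hne (h21.symm.trans h6)
    have h9 := hfix _ h6
    simp only [Y, Th] at h7
    rw [h9] at h7
    simp at h7
    have : y ζ = 0 := by linear_combination h7 / 2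
    exact h8 this
  have hsp : ∀ ζ, ζ ≠ 0 → 1 ≤ ‖X ζ‖ → F ζ = e ^ 2 * ζ ^ 2 - e ^ 2 := by
    intro ζ hζ hX
    have h6 := hg _ hX
    have h9 := hfix _ h6
    simp only [F, Y, Th]
    rw [h9, h6]
    simp only [X, y]
    field_simp
    simp
    ring
  obtain ⟨s, hs⟩ : ∃ s : ℝ, s = 2 + 2 * (1 + ‖c‖) / ‖e‖ := ⟨_, rfl⟩
  have hepos : 0 < ‖e‖ := norm_pos_iff.2 he0
  have hs2 : 2 ≤ s := by rw [hs]; have : 0 ≤ 2 * (1 + ‖c‖) / ‖e‖ := by positivity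
                         linarith
  have hbig : ∀ ζ : ℂ, s - 1 ≤ ‖ζ + ζ⁻¹‖ → 1 ≤ ‖X ζ‖ := by
    intro ζ h
    have h1 : ‖e * (ζ + ζ⁻¹) / 2‖ ≤ ‖X ζ‖ + ‖c‖ := by
      have : e * (ζ + ζ⁻¹) / 2 = X ζ - c := by simp only [X]; ring
      rw [this]; exact norm_sub_le _ _
    rw [norm_div, norm_mul] at h1
    simp at h1
    have h2 : ‖e‖ * (s - 1) ≤ ‖e‖ * ‖ζ + ζ⁻¹‖ := by gcongr
    have h3 : ‖e‖ * (s - 1) = ‖e‖ + 2 * (1 + ‖c‖) := by rw [hs]; field_simp; ring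
    linarith
  have hinv : s⁻¹ ≤ 1 := inv_le_one_of_one_le₀ (by linarith)
  have hs0 : 0 < s := by linarith
  have hb1 : ∀ ζ : ℂ, ‖ζ‖ = s → s - 1 ≤ ‖ζ + ζ⁻¹‖ := by
    intro ζ h
    have : ‖ζ‖ - ‖-ζ⁻¹‖ ≤ ‖ζ - -ζ⁻¹‖ := norm_sub_norm_le _ _
    rw [norm_neg, norm_inv, h, sub_neg_eq_add] at this
    linarith
  have hb2 : ∀ ζ : ℂ, ‖ζ‖ = s⁻¹ → s - 1 ≤ ‖ζ + ζ⁻¹‖ := by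
    intro ζ h
    have : ‖ζ⁻¹‖ - ‖-ζ‖ ≤ ‖ζ⁻¹ - -ζ‖ := norm_sub_norm_le _ _
    rw [norm_neg, norm_inv, h, sub_neg_eq_add, inv_inv, add_comm] at this
    linarith
  have he2 : 0 < ‖e ^ 2‖ := by rw [norm_pow]; positivity
  refine winding_contra hFc hF0 (m := 2) (n := 0) (by norm_num) hs0 (inv_pos.2 hs0)
    (a := e ^ 2) (b := - e ^ 2) (pow_ne_zero _ he0) (neg_ne_zero.2 (pow_ne_zero _ he0)) ?_ ?_
  · intro ζ h
    have hz : ζ ≠ 0 := by rintro rfl; simp at h; linarith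
    rw [hsp ζ hz (hbig _ (hb1 _ h))]
    have : e ^ 2 * ζ ^ 2 - e ^ 2 - e ^ 2 * ζ ^ 2 = - e ^ 2 := by ring
    rw [this, norm_neg, norm_mul, norm_pow ζ, h]
    have h5 : 1 < s ^ 2 := by nlinarith
    exact lt_mul_of_one_lt_right he2 h5
  · intro ζ h
    have hz : ζ ≠ 0 := by rintro rfl; simp at h; linarith
    rw [hsp ζ hz (hbig _ (hb2 _ h))]
    have : e ^ 2 * ζ ^ 2 - e ^ 2 - -e ^ 2 * ζ ^ 0 = e ^ 2 * ζ ^ 2 := by ring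
    rw [this, pow_zero, mul_one, norm_neg, norm_mul, norm_pow ζ, h]
    have : s⁻¹ ≤ 2⁻¹ := inv_anti₀ (by norm_num) hs2
    have h0 : 0 < s⁻¹ := inv_pos.2 hs0
    have h5 : s⁻¹ ^ 2 < 1 := by nlinarith
    exact mul_lt_of_lt_one_right he2 h5

theorem branch_far {X : Set ℂ} (hX : IsPreconnected X) {a b : ℂ} (ha : a ∈ X) (hb : b ∈ X)
    {ε : ℝ} (hε : 0 < ε) : ∃ L : ℂ → ℂ, ContinuousOn L {x | ε < infDist x X} ∧
      ∀ x, ε < infDist x X → Complex.exp (L x) = (x - a) / (x - b) := by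
  have hne : ∀ x z, ε < infDist x X → z ∈ X → x - z ≠ 0 := by
    intro x z hx hz h0
    rw [sub_eq_zero] at h0
    rw [h0, infDist_zero_of_mem hz] at hx
    linarith
  refine hX.induction₂ (P := fun a b => ∃ L : ℂ → ℂ, ContinuousOn L {x | ε < infDist x X} ∧
      ∀ x, ε < infDist x X → Complex.exp (L x) = (x - a) / (x - b)) ?_ ?_ ?_ ha hb
  · intro u hu
    filter_upwards [self_mem_nhdsWithin, nhdsWithin_le_nhds (ball_mem_nhds u hε)] with v hv huv
    have hs : ∀ x, ε < infDist x X → (x - u) / (x - v) ∈ Complex.slitPlane := by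
      intro x hx
      apply slit_of_lt
      have h0 := hne x v hx hv
      have : (x - u) / (x - v) - 1 = (v - u) / (x - v) := by field_simp; ring
      rw [this, norm_div, div_lt_one (norm_pos_iff.2 h0), ← dist_eq_norm, ← dist_eq_norm]
      calc dist v u < ε := huv
        _ < infDist x X := hx
        _ ≤ dist x v := infDist_le_dist_of_mem hv
    refine ⟨fun x => Complex.log ((x - u) / (x - v)), ?_, ?_⟩
    · intro x hx
      apply ContinuousAt.continuousWithinAt
      refine ContinuousAt.clog (ContinuousAt.div (by fun_prop) (by fun_prop) (hne x v hx hv))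
        (hs x hx)
    · intro x hx
      rw [Complex.exp_log (Complex.slitPlane_ne_zero (hs x hx))]
  · rintro u v w hu hv hw ⟨L, hL, hLe⟩ ⟨L', hL', hLe'⟩
    refine ⟨fun x => L x + L' x, hL.add hL', fun x hx => ?_⟩
    rw [Complex.exp_add, hLe x hx, hLe' x hx]
    have := hne x v hx hv
    have := hne x w hx hw
    field_simp
  · rintro u v hu hv ⟨L, hL, hLe⟩
    refine ⟨fun x => - L x, hL.neg, fun x hx => ?_⟩
    rw [Complex.exp_neg, hLe x hx, inv_div]

theorem branch_quot {X : Set ℂ} (hXc : IsClosed X) (hX : IsPreconnected X) {a b : ℂ} (ha : a ∈ X)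
    (hb : b ∈ X) : ∃ L : ℂ → ℂ, ContinuousOn L Xᶜ ∧
      ∀ x, x ∉ X → Complex.exp (L x) = (x - a) / (x - b) := by
  classical
  have hpos : ∀ n : ℕ, (0:ℝ) < 1 / ((n:ℝ) + 1) := fun n => by positivity
  choose L hLc hLe using fun n : ℕ => branch_far hX ha hb (hpos n)
  let Ω : ℕ → Set ℂ := fun n => {x | 1 / ((n:ℝ) + 1) < infDist x X}
  have hΩo : ∀ n, IsOpen (Ω n) := fun n => isOpen_lt continuous_const (continuous_infDist_pt X)
  have hΩm : ∀ m n, m ≤ n → Ω m ⊆ Ω n := by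
    intro m n hmn x hx
    have hx1 : 1 / ((m:ℝ) + 1) < infDist x X := hx
    refine lt_of_le_of_lt ?_ hx1
    apply one_div_le_one_div_of_le <;> [positivity; gcongr]
  have hΩX : ∀ n x, x ∈ Ω n → x ∉ X := by
    intro n x hx hxX
    have h1 : 1 / ((n:ℝ) + 1) < infDist x X := hx
    rw [infDist_zero_of_mem hxX] at h1
    linarith [hpos n]
  let Good : ℕ → ℂ → ℂ → Prop := fun n x y => ∃ T ⊆ Ω n, IsPreconnected T ∧ x ∈ T ∧ y ∈ T
  have hgood : ∀ x y, JoinedIn Xᶜ x y → ∃ n, Good n x y := by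
    intro x y hj
    obtain ⟨γ, hγ⟩ := hj
    have hcomp : IsCompact (Set.range γ) := isCompact_range γ.continuous
    have hconn : IsPreconnected (Set.range γ) := isPreconnected_range γ.continuous
    obtain ⟨z, ⟨t, rfl⟩, hz⟩ := hcomp.exists_isMinOn ⟨_, ⟨0, rfl⟩⟩
      (continuous_infDist_pt X).continuousOn
    have h0 : 0 < infDist (γ t) X := (hXc.notMem_iff_infDist_pos ⟨a, ha⟩).1 (hγ t)
    obtain ⟨n, hn⟩ := exists_nat_one_div_lt h0
    refine ⟨n, Set.range γ, ?_, hconn, ⟨0, by simp⟩, ⟨1, by simp⟩⟩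
    rintro _ ⟨s, rfl⟩
    exact lt_of_lt_of_le hn (hz ⟨s, rfl⟩)
  have hcmp : ∀ m n x y, m ≤ n → Good m x y → L m x - L m y = L n x - L n y := by
    rintro m n x y hmn ⟨T, hT, hTp, hx, hy⟩
    have := log_diff_const hTp ((hLc m).mono hT) ((hLc n).mono (hT.trans (hΩm m n hmn)))
      (fun z hz => by rw [hLe m z (hT hz), hLe n z (hΩm m n hmn (hT hz))]) hx hy
    linear_combination this
  have hcmp' : ∀ m n x y, Good m x y → Good n x y → L m x - L m y = L n x - L n y := by
    intro m n x y h1 h2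
    rcases le_total m n with h | h
    · exact hcmp m n x y h h1
    · exact (hcmp n m x y h h2).symm
  let bs : Set ℂ → ℂ := fun S => if h : S.Nonempty then h.choose else 0
  let B : ℂ → ℂ := fun x => bs (pathComponentIn Xᶜ x)
  have hB : ∀ x, x ∉ X → JoinedIn Xᶜ x (B x) := by
    intro x hx
    have : (pathComponentIn Xᶜ x).Nonempty := ⟨x, mem_pathComponentIn_self hx⟩
    simp only [B, bs]
    rw [dif_pos this]
    exact this.choose_spec
  have hBB : ∀ x y, JoinedIn Xᶜ x y → B x = B y := by
    intro x y hj
    simp only [B]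
    rw [pathComponentIn_congr (show y ∈ pathComponentIn Xᶜ x from hj)]
  have hN : ∀ x, ∃ n, x ∉ X → Good n x (B x) := by
    intro x
    by_cases hx : x ∈ X
    · exact ⟨0, fun h => absurd hx h⟩
    · obtain ⟨n, hn⟩ := hgood x _ (hB x hx)
      exact ⟨n, fun _ => hn⟩
  choose N hN using hN
  refine ⟨fun x => L (N x) x - L (N x) (B x) + Complex.log ((B x - a) / (B x - b)), ?_, ?_⟩
  · intro x hx
    apply ContinuousAt.continuousWithinAt
    obtain ⟨T, hT, hTp, hxT, hBT⟩ := hN x hx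
    obtain ⟨r, hr, hball⟩ := Metric.isOpen_iff.1 (hΩo (N x)) x (hT hxT)
    have hev : ∀ y ∈ ball x r, L (N y) y - L (N y) (B y) + Complex.log ((B y - a) / (B y - b)) =
        L (N x) y - L (N x) (B x) + Complex.log ((B x - a) / (B x - b)) := by
      intro y hy
      have hj : JoinedIn Xᶜ x y := by
        refine ((convex_ball x r).isPathConnected ⟨x, mem_ball_self hr⟩).joinedIn x
          (mem_ball_self hr) y hy |>.mono ?_
        intro z hz; exact hΩX _ _ (hball hz)
      have hyX : y ∉ X := hΩX _ _ (hball hy)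
      have hBy := hBB x y hj
      have hg : Good (N x) y (B y) := by
        refine ⟨ball x r ∪ T, Set.union_subset hball hT, ?_, Or.inl hy, ?_⟩
        · exact IsPreconnected.union x (mem_ball_self hr) hxT (convex_ball x r).isPreconnected hTp
        · rw [← hBy]; exact Or.inr hBT
      rw [hcmp' _ _ _ _ (hN y hyX) hg, hBy]
    have hc : ContinuousAt (fun y => L (N x) y - L (N x) (B x) +
        Complex.log ((B x - a) / (B x - b))) x := by
      have : ContinuousAt (L (N x)) x := (hLc (N x)).continuousAt ((hΩo _).mem_nhds (hT hxT))
      fun_prop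
    refine hc.congr ?_
    filter_upwards [ball_mem_nhds x hr] with y hy
    exact (hev y hy).symm
  · intro x hx
    obtain ⟨T, hT, hTp, hxT, hBT⟩ := hN x hx
    have hBX := hΩX _ _ (hT hBT)
    have h1 : B x - a ≠ 0 := sub_ne_zero.2 fun h => hBX (h ▸ ha)
    have h2 : B x - b ≠ 0 := sub_ne_zero.2 fun h => hBX (h ▸ hb)
    have h3 : x - b ≠ 0 := sub_ne_zero.2 fun h => hx (h ▸ hb)
    rw [Complex.exp_add, Complex.exp_sub, hLe _ _ (hT hxT), hLe _ _ (hT hBT),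
      Complex.exp_log (div_ne_zero h1 h2)]
    field_simp

theorem branch_sub {F : Set ℂ} (hFc : IsClosed F) (hF : IsPreconnected F)
    (hout : ∀ x : ℂ, 1 ≤ ‖x‖ → x ∈ F) {w : ℂ} (hw : w ∈ F) :
    ∃ L : ℂ → ℂ, ContinuousOn L Fᶜ ∧ ∀ x, x ∉ F → Complex.exp (L x) = x - w := by
  obtain ⟨L, hL, hLe⟩ := branch_quot hFc hF hw (hout 2 (by norm_num))
  have hs : ∀ x, x ∉ F → 2 - x ∈ Complex.slitPlane := by
    intro x hx
    have : ‖x‖ < 1 := by by_contra h; exact hx (hout x (not_lt.1 h))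
    left
    have := (Complex.abs_re_le_norm x).trans_lt this
    simp; linarith [abs_lt.1 this]
  refine ⟨fun x => L x + (Complex.log (2 - x) + Real.pi * Complex.I), ?_, ?_⟩
  · refine hL.add (ContinuousOn.add ?_ continuousOn_const)
    exact ContinuousOn.clog (by fun_prop) hs
  · intro x hx
    have h0 := Complex.slitPlane_ne_zero (hs x hx)
    rw [Complex.exp_add, Complex.exp_add, hLe x hx, Complex.exp_log h0, Complex.exp_pi_mul_I]
    have : x - 2 ≠ 0 := by rw [← neg_sub]; exact neg_ne_zero.2 h0
    field_simp
    ring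

theorem no_branch {K F : Set ℂ} (hK : IsCompact K) (hF : IsClosed F)
    (hout : ∀ x : ℂ, 1 ≤ ‖x‖ → x ∈ F) (hKF : Disjoint K F) {w : ℂ} (hw : w ∈ K)
    {ℓ : ℂ → ℂ} (hℓ : ContinuousOn ℓ (K ∪ F)ᶜ)
    (hℓe : ∀ x, x ∉ K → x ∉ F → Complex.exp (ℓ x) = x - w) : False := by
  classical
  have hKn : K.Nonempty := ⟨w, hw⟩
  have hFn : F.Nonempty := ⟨2, hout 2 (by norm_num)⟩
  have hden : ∀ x, 0 < infDist x K + infDist x F := by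
    intro x
    by_cases hx : x ∈ K
    · have : 0 < infDist x F := (hF.notMem_iff_infDist_pos hFn).1 (Set.disjoint_left.1 hKF hx)
      linarith [infDist_nonneg (x := x) (s := K)]
    · have : 0 < infDist x K := (hK.isClosed.notMem_iff_infDist_pos hKn).1 hx
      linarith [infDist_nonneg (x := x) (s := F)]
  let u : ℂ → ℝ := fun x => infDist x F / (infDist x K + infDist x F)
  have huc : Continuous u := by
    refine Continuous.div (continuous_infDist_pt F)
      ((continuous_infDist_pt K).add (continuous_infDist_pt F)) fun x => (hden x).ne'
  have huK : ∀ x ∈ K, u x = 1 := by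
    intro x hx
    have := hden x
    simp only [u]
    rw [infDist_zero_of_mem hx, zero_add] at this ⊢
    exact div_self this.ne'
  have huF : ∀ x ∈ F, u x = 0 := by
    intro x hx
    simp only [u]
    rw [infDist_zero_of_mem hx, zero_div]
  let χ : ℂ → ℝ := fun x => min 1 (max 0 (3 * u x - 1))
  have hχc : Continuous χ := by
    simp only [χ]; fun_prop
  let G : ℂ → ℂ := fun x => if x ∈ K then x - w else if x ∈ F then 1 else Complex.exp (χ x * ℓ x)
  have hG1 : ∀ x, 2 / 3 < u x → G x = x - w := by
    intro x hx
    by_cases hxK : x ∈ K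
    · simp only [G, if_pos hxK]
    · have hxF : x ∉ F := fun h => by rw [huF x h] at hx; norm_num at hx
      have : χ x = 1 := by
        simp only [χ]; rw [max_eq_right (by linarith), min_eq_left (by linarith)]
      simp only [G, if_neg hxK, if_neg hxF, this]
      simp [hℓe x hxK hxF]
  have hG2 : ∀ x, u x < 1 / 3 → G x = 1 := by
    intro x hx
    have hxK : x ∉ K := fun h => by rw [huK x h] at hx; norm_num at hx
    by_cases hxF : x ∈ F
    · simp only [G, if_neg hxK, if_pos hxF]
    · have : χ x = 0 := by
        simp only [χ]; rw [max_eq_left (by linarith)]; simp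
      simp only [G, if_neg hxK, if_neg hxF, this]
      simp
  have hKFc : IsClosed (K ∪ F) := hK.isClosed.union hF
  have hGc : Continuous G := by
    rw [continuous_iff_continuousAt]
    intro x
    by_cases hxK : x ∈ K
    · have : ∀ᶠ y in 𝓝 x, 2 / 3 < u y :=
        huc.continuousAt.eventually (lt_mem_nhds (by rw [huK x hxK]; norm_num))
      refine ContinuousAt.congr (f := fun x => x - w) (by fun_prop) ?_
      filter_upwards [this] with y hy
      exact (hG1 y hy).symm
    · by_cases hxF : x ∈ F
      · have : ∀ᶠ y in 𝓝 x, u y < 1 / 3 :=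
          huc.continuousAt.eventually (gt_mem_nhds (by rw [huF x hxF]; norm_num))
        refine ContinuousAt.congr (f := fun x => 1) (by fun_prop) ?_
        filter_upwards [this] with y hy
        exact (hG2 y hy).symm
      · have hx : x ∈ (K ∪ F)ᶜ := by simp [hxK, hxF]
        have hn := hKFc.isOpen_compl.mem_nhds hx
        have : ContinuousAt ℓ x := hℓ.continuousAt hn
        refine ContinuousAt.congr (f := fun x => Complex.exp (χ x * ℓ x)) ?_ ?_
        · refine ContinuousAt.cexp (ContinuousAt.mul ?_ this)
          exact (Complex.continuous_ofReal.comp hχc).continuousAt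
        · filter_upwards [hn] with y hy
          simp only [Set.mem_compl_iff, Set.mem_union, not_or] at hy
          simp only [G, if_neg hy.1, if_neg hy.2]
  have hG0 : ∀ x, x ≠ w → G x ≠ 0 := by
    intro x hx
    by_cases hxK : x ∈ K
    · simp only [G, if_pos hxK]; exact sub_ne_zero.2 hx
    · by_cases hxF : x ∈ F
      · simp [G, hxK, hxF]
      · simp only [G, if_neg hxK, if_neg hxF]; exact Complex.exp_ne_zero _
  have hev : ∀ᶠ y in 𝓝 w, 2 / 3 < u y :=
    huc.continuousAt.eventually (lt_mem_nhds (by rw [huK w hw]; norm_num))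
  obtain ⟨r, hr, hrb⟩ := Metric.eventually_nhds_iff.1 hev
  refine winding_contra (G := fun ζ => G (w + ζ)) (by fun_prop)
    (fun ζ hζ => hG0 _ (by simpa using hζ)) (m := 1) (n := 0) (by norm_num) (half_pos hr)
    (s := ‖w‖ + 1) (by positivity) (a := 1) (b := 1) one_ne_zero one_ne_zero ?_ ?_
  · intro ζ hζ
    rw [hG1 _ (hrb (by simp [hζ]; linarith))]
    simp [hζ]
    exact hr
  · intro ζ hζ
    rw [hG2 _ (by
      rw [huF]; · norm_num
      apply hout
      have : ‖ζ‖ - ‖-w‖ ≤ ‖ζ - -w‖ := norm_sub_norm_le _ _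
      rw [norm_neg, hζ, sub_neg_eq_add, add_comm ζ] at this
      linarith)]
    simp

theorem exp_one_small {z : ℂ} (h : Complex.exp z = 1) (hz : ‖z‖ < 1) : z = 0 := by
  obtain ⟨k, hk⟩ := Complex.exp_eq_one_iff.1 h
  rw [hk, norm_mul] at hz
  have h5 : ‖(2 * Real.pi * Complex.I : ℂ)‖ = 2 * Real.pi := by
    simp [abs_of_pos Real.pi_pos]
  rw [h5] at hz
  by_cases hk0 : k = 0
  · rw [hk, hk0]; simp
  · exfalso
    have : (1:ℝ) ≤ ‖(k:ℂ)‖ := by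
      rw [Complex.norm_intCast]; exact_mod_cast Int.one_le_abs hk0
    nlinarith [Real.pi_gt_three]

theorem ev_const_of_exp_one {X : Type*} [TopologicalSpace X] {f : X → ℂ} {x0 : X}
    (hc : ContinuousAt f x0) (h1 : ∀ᶠ x in 𝓝 x0, Complex.exp (f x) = 1) :
    ∀ᶠ x in 𝓝 x0, f x = f x0 := by
  have h2 : ∀ᶠ x in 𝓝 x0, ‖f x - f x0‖ < 1 := by
    have := Metric.continuousAt_iff'.1 hc 1 one_pos
    simpa [dist_eq_norm] using this
  filter_upwards [h1, h2] with x hx1 hx2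
  refine sub_eq_zero.1 (exp_one_small ?_ hx2)
  rw [Complex.exp_sub, hx1, h1.self_of_nhds, div_one]

theorem preconn_pred {X : Type*} [TopologicalSpace X] {S : Set X} (hS : IsPreconnected S)
    (P : X → Prop) (h : ∀ x ∈ S, ∀ᶠ y in 𝓝 x, (P y ↔ P x)) {x y : X} (hx : x ∈ S) (hy : y ∈ S)
    (hP : P x) : P y := by
  have := hS.induction₂ (P := fun a b => (P a ↔ P b))
    (fun x hx => by
      filter_upwards [nhdsWithin_le_nhds (h x hx)] with y hy
      exact hy.symm)
    (fun a b c _ _ _ h1 h2 => h1.trans h2) (fun a b _ _ h1 => h1.symm) hx hy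
  exact this.1 hP

theorem lam_contAt {k : ℂ ≃ₜ ℂ} (hk : IdOut k) {w x : ℂ} (hx : w ≠ x) :
    ContinuousAt (fun y => lam k w y) x := by
  have hcA : ContinuousAt (fun p : ℂ × ℂ => lam k p.1 p.2) (w, x) :=
    (isLam hk).cont.continuousAt
      (IsOpen.mem_nhds (isOpen_ne_fun continuous_fst continuous_snd) hx)
  exact hcA.comp (f := fun y => (w, y)) (by fun_prop)

theorem free_abs {k : ℂ ≃ₜ ℂ} (hk : IdOut k) (hr : Recu k) {K F : Set ℂ} (hK : IsCompact K)
    (hF : IsClosed F) (hout : ∀ x : ℂ, 1 ≤ ‖x‖ → x ∈ F) (hKF : Disjoint K F) {w : ℂ} (hw : w ∈ K)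
    (hkw : k w = w) (hkK : ∀ x, k x ∈ K ↔ x ∈ K) (hkF : ∀ x, k x ∈ F ↔ x ∈ F)
    {ℓ ℓp : ℂ → ℂ} {S M : Set ℂ} (hSc : IsPreconnected S) {p0 : ℂ} (hp0 : p0 ∈ S)
    (hSA : ∀ x ∈ S, x ∉ K ∧ x ∉ F) (hfree : ∀ x ∈ S, k x ∉ S)
    (hexp : ∀ x, x ∉ K → x ∉ F → Complex.exp (ℓ x) = x - w)
    (hcont : ∀ x, x ∉ K → x ∉ F → x ∉ S → ContinuousAt ℓ x)
    (hp : ∀ x ∈ S, ContinuousAt ℓp x)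
    (hloc : ∀ x ∈ S, ∀ᶠ y in 𝓝 x, (y ∈ M → ℓ y = ℓp y + 2 * Real.pi * Complex.I) ∧
      (y ∉ M → ℓ y = ℓp y))
    (hSrel : ∀ x, x ∉ K → x ∉ F → x ∉ S → ∀ᶠ y in 𝓝 x, y ∉ S)
    (hMS : ∀ x ∈ S, x ∉ M) (hacc : ∃ᶠ y in 𝓝 p0, y ∈ M) : False := by
  classical
  let A : Set ℂ := (K ∪ F)ᶜ
  have hAo : IsOpen A := (hK.isClosed.union hF).isOpen_compl
  have hA : ∀ x, x ∈ A ↔ x ∉ K ∧ x ∉ F := by intro x; simp [A]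
  have hkA : ∀ x, k x ∈ A ↔ x ∈ A := by intro x; rw [hA, hA, hkK, hkF]
  have hkiA : ∀ x, k.symm x ∈ A ↔ x ∈ A := by
    intro x; rw [← hkA, k.apply_symm_apply]
  have hSA' : ∀ x ∈ S, x ∈ A := fun x hx => (hA x).2 (hSA x hx)
  have hexp' : ∀ x ∈ A, Complex.exp (ℓ x) = x - w := fun x hx =>
    hexp x ((hA x).1 hx).1 ((hA x).1 hx).2
  have hcont' : ∀ x ∈ A, x ∉ S → ContinuousAt ℓ x := fun x hx =>
    hcont x ((hA x).1 hx).1 ((hA x).1 hx).2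
  have hAw : ∀ x ∈ A, w ≠ x := by
    rintro x hx rfl; exact ((hA _).1 hx).1 hw
  have hAw' : ∀ x ∈ A, x - w ≠ 0 := fun x hx => sub_ne_zero.2 (hAw x hx).symm
  have hp2 : (2 * Real.pi * Complex.I : ℂ) ≠ 0 := Complex.two_pi_I_ne_zero
  -- the transported branch
  let ℓ' : ℂ → ℂ := fun x => ℓ (k.symm x) + lam k w (k.symm x)
  have hexpl : ∀ x ∈ A, Complex.exp (lam k w (k.symm x)) = (w - x) / (w - k.symm x) := by
    intro x hx
    rw [(isLam hk).exp _ _ (hAw _ ((hkiA x).2 hx)), hkw, k.apply_symm_apply]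
  have hexpl' : ∀ x ∈ A, Complex.exp (ℓ' x) = x - w := by
    intro x hx
    have h1 := hAw' _ ((hkiA x).2 hx)
    have h2 : w - k.symm x ≠ 0 := by rw [← neg_sub]; exact neg_ne_zero.2 h1
    simp only [ℓ']
    rw [Complex.exp_add, hexp' _ ((hkiA x).2 hx), hexpl x hx]
    field_simp
    ring
  have hlc : ∀ x ∈ A, ContinuousAt (fun y => lam k w (k.symm y)) x := by
    intro x hx
    exact (lam_contAt hk (hAw _ ((hkiA x).2 hx))).comp k.symm.continuous.continuousAt
  have hcl' : ∀ x ∈ A, k.symm x ∉ S → ContinuousAt ℓ' x := by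
    intro x hx hxS
    exact (ContinuousAt.comp (f := fun y => k.symm y) (hcont' _ ((hkiA x).2 hx) hxS)
      k.symm.continuous.continuousAt).add (hlc x hx)
  have hd : ∀ x, ∃ n : ℤ, x ∈ A → ℓ x - ℓ' x = n * (2 * Real.pi * Complex.I) := by
    intro x
    by_cases hx : x ∈ A
    · have : Complex.exp (ℓ x - ℓ' x) = 1 := by
        rw [Complex.exp_sub, hexp' x hx, hexpl' x hx, div_self (hAw' x hx)]
      obtain ⟨n, hn⟩ := Complex.exp_eq_one_iff.1 this
      exact ⟨n, fun _ => hn⟩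
    · exact ⟨0, fun h => absurd h hx⟩
  choose d hd using hd
  have hdinj : ∀ (a b : ℤ), (a : ℂ) * (2 * Real.pi * Complex.I) = b * (2 * Real.pi * Complex.I) →
      a = b := fun a b h => by exact_mod_cast mul_right_cancel₀ hp2 h
  have hevA : ∀ x ∈ A, ∀ᶠ y in 𝓝 x, y ∈ A := fun x hx => hAo.mem_nhds hx
  -- local behaviour
  have E1 : ∀ x ∈ A, x ∉ S → k.symm x ∉ S → ∀ᶠ y in 𝓝 x, d y = d x := by
    intro x hx h1 h2
    have := ev_const_of_exp_one (f := fun y => ℓ y - ℓ' y) (x0 := x)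
      ((hcont' x hx h1).sub (hcl' x hx h2)) (by
        filter_upwards [hevA x hx] with y hy
        rw [Complex.exp_sub, hexp' y hy, hexpl' y hy, div_self (hAw' y hy)])
    filter_upwards [this, hevA x hx] with y hy hyA
    rw [hd y hyA, hd x hx] at hy
    exact hdinj _ _ hy
  have hexpp : ∀ x ∈ S, ∀ᶠ y in 𝓝 x, Complex.exp (ℓp y) = y - w := by
    intro x hx
    filter_upwards [hloc x hx, hevA x (hSA' x hx)] with y hy hyA
    rw [← hexp' y hyA]
    by_cases hM : y ∈ M
    · rw [hy.1 hM, Complex.exp_add, Complex.exp_two_pi_mul_I, mul_one]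
    · rw [hy.2 hM]
  have hlpS : ∀ x ∈ S, ℓ x = ℓp x := fun x hx => (hloc x hx).self_of_nhds.2 (hMS x hx)
  have hkS : ∀ x ∈ S, k.symm x ∉ S := by
    intro x hx h
    have := hfree _ h
    rw [k.apply_symm_apply] at this
    exact this hx
  have E2 : ∀ x ∈ S, ∀ᶠ y in 𝓝 x, (y ∈ M → d y = d x + 1) ∧ (y ∉ M → d y = d x) := by
    intro x hx
    have hxA := hSA' x hx
    have := ev_const_of_exp_one (f := fun y => ℓp y - ℓ' y) (x0 := x)
      ((hp x hx).sub (hcl' x hxA (hkS x hx))) (by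
        filter_upwards [hevA x hxA, hexpp x hx] with y hy hy2
        rw [Complex.exp_sub, hy2, hexpl' y hy, div_self (hAw' y hy)])
    filter_upwards [this, hevA x hxA, hloc x hx] with y hy hyA hyl
    rw [← hlpS x hx, hd x hxA] at hy
    constructor
    · intro hM
      apply hdinj
      rw [← hd y hyA, hyl.1 hM]
      push_cast
      linear_combination hy
    · intro hM
      apply hdinj
      rw [← hd y hyA, hyl.2 hM, hy]
  have E3 : ∀ x, k.symm x ∈ S → ∀ᶠ y in 𝓝 x, (k.symm y ∈ M → d y = d x - 1) ∧
      (k.symm y ∉ M → d y = d x) := by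
    intro x hx
    have hxA := (hkiA x).1 (hSA' _ hx)
    have hxS : x ∉ S := fun h => hkS x h hx
    have ht : Tendsto (fun y => k.symm y) (𝓝 x) (𝓝 (k.symm x)) := k.symm.continuous.continuousAt
    have hc : ContinuousAt (fun y => ℓp (k.symm y) + lam k w (k.symm y)) x :=
      (ContinuousAt.comp (f := fun y => k.symm y) (hp _ hx) k.symm.continuous.continuousAt).add
        (hlc x hxA)
    have := ev_const_of_exp_one (f := fun y => ℓ y - (ℓp (k.symm y) + lam k w (k.symm y)))
      (x0 := x) ((hcont' x hxA hxS).sub hc) (by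
        filter_upwards [hevA x hxA, ht.eventually (hexpp _ hx)] with y hy hy2
        rw [Complex.exp_sub, Complex.exp_add, hy2, ← hexp' _ ((hkiA y).2 hy), ← Complex.exp_add]
        rw [show ℓ (k.symm y) + lam k w (k.symm y) = ℓ' y from rfl]
        rw [hexp' y hy, hexpl' y hy, div_self (hAw' y hy)])
    filter_upwards [this, hevA x hxA, ht.eventually (hloc _ hx)] with y hy hyA hyl
    have hx' := hd x hxA
    have hy' := hd y hyA
    simp only [ℓ'] at hx' hy'
    rw [← hlpS _ hx, hx'] at hy
    constructor
    · intro hM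
      apply hdinj
      rw [← hy', hyl.1 hM]
      push_cast
      linear_combination hy
    · intro hM
      apply hdinj
      rw [← hy', hyl.2 hM, ← hy]
  have hdS : ∀ x ∈ S, d x = d p0 := by
    intro x hx
    have hc : ContinuousOn (fun y => ℓp y - ℓ' y) S := fun y hy =>
      ((hp y hy).sub (hcl' y (hSA' y hy) (hkS y hy))).continuousWithinAt
    have := exp_one_const hSc hc (fun y hy => by
      rw [Complex.exp_sub, (hexpp y hy).self_of_nhds, hexpl' y (hSA' y hy),
        div_self (hAw' y (hSA' y hy))]) hx hp0
    simp only [← hlpS x hx, ← hlpS p0 hp0] at this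
    rw [hd x (hSA' x hx), hd p0 (hSA' _ hp0)] at this
    exact hdinj _ _ this
  have hdkS : ∀ x ∈ S, d (k x) = d (k p0) := by
    intro x hx
    have hkAS : ∀ y ∈ S, k y ∈ A := fun y hy => (hkA y).2 (hSA' y hy)
    have hc : ContinuousOn (fun y => ℓ (k y) - (ℓp y + lam k w y)) S := fun y hy => by
      refine ContinuousAt.continuousWithinAt ?_
      refine ContinuousAt.sub ?_ ((hp y hy).add (lam_contAt hk (hAw _ (hSA' y hy))))
      exact ContinuousAt.comp (f := fun y => k y) (hcont' _ (hkAS y hy) (hfree y hy))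
        k.continuous.continuousAt
    have e : ∀ y ∈ S, ℓ (k y) - (ℓp y + lam k w y) = d (k y) * (2 * Real.pi * Complex.I) := by
      intro y hy
      rw [← hd _ (hkAS y hy), ← hlpS y hy]
      simp only [ℓ', k.symm_apply_apply]
    have := exp_one_const hSc hc (fun y hy => by
      rw [e y hy, Complex.exp_int_mul_two_pi_mul_I]) hx hp0
    rw [e x hx, e p0 hp0] at this
    exact hdinj _ _ this
  obtain ⟨n0, hn0⟩ : ∃ n, n = d p0 := ⟨_, rfl⟩
  obtain ⟨n1, hn1⟩ : ∃ n, n = d (k p0) := ⟨_, rfl⟩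
  have hdkS' : ∀ x, k.symm x ∈ S → d x = n1 := by
    intro x hx
    have := hdkS _ hx
    rwa [k.apply_symm_apply, ← hn1] at this
  have hdS' : ∀ x ∈ S, d x = n0 := fun x hx => (hdS x hx).trans hn0.symm
  -- contradiction from a branch on A
  have nob : ∀ H : ℂ → ℂ, (∀ x ∈ A, ContinuousAt H x) → (∀ x ∈ A, Complex.exp (H x) = x - w) →
      False := by
    intro H h1 h2
    exact no_branch hK hF hout hKF hw (ℓ := H) (fun x hx => (h1 x hx).continuousWithinAt)
      (fun x hxK hxF => h2 x ((hA x).2 ⟨hxK, hxF⟩))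
  by_cases hn : n1 = n0 + 1
  swap
  · refine nob (fun x => ℓ x - (if n0 + 1 ≤ d x then 1 else 0) * (2 * Real.pi * Complex.I)) ?_ ?_
    · intro x hx
      by_cases hxS : x ∈ S
      · refine (hp x hxS).congr ?_
        filter_upwards [hloc x hxS, E2 x hxS] with y hy1 hy2
        rw [hdS' x hxS] at hy2
        by_cases hM : y ∈ M
        · rw [hy1.1 hM, hy2.1 hM, if_pos le_rfl]; ring
        · rw [hy1.2 hM, hy2.2 hM, if_neg (by omega)]; ring
      · have hc := hcont' x hx hxS
        have hev : ∀ᶠ y in 𝓝 x, (n0 + 1 ≤ d y ↔ n0 + 1 ≤ d x) := by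
          by_cases hkx : k.symm x ∈ S
          · filter_upwards [E3 x hkx] with y hy
            rw [hdkS' x hkx] at hy ⊢
            by_cases hM : k.symm y ∈ M
            · rw [hy.1 hM]; omega
            · rw [hy.2 hM]
          · filter_upwards [E1 x hx hxS hkx] with y hy
            rw [hy]
        refine ContinuousAt.congr (f := fun y => ℓ y - (if n0 + 1 ≤ d x then 1 else 0) *
          (2 * Real.pi * Complex.I)) (by fun_prop) ?_
        filter_upwards [hev] with y hy
        simp only [hy]
    · intro x hx
      rw [Complex.exp_sub, hexp' x hx]
      split_ifs
      · rw [one_mul, Complex.exp_two_pi_mul_I, div_one]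
      · simp
  -- the component
  let A0 := connectedComponentIn A p0
  have hp0A : p0 ∈ A := hSA' _ hp0
  have hA0A : A0 ⊆ A := connectedComponentIn_subset _ _
  have hA0o : IsOpen A0 := hAo.connectedComponentIn
  have hA0c : ∀ x ∈ A, x ∉ A0 → ∀ᶠ y in 𝓝 x, y ∉ A0 := by
    intro x hx hxA0
    filter_upwards [(hAo.connectedComponentIn (x := x)).mem_nhds (mem_connectedComponentIn hx)]
      with y hy hy0
    apply hxA0
    have h1 := connectedComponentIn_eq hy
    have h2 := connectedComponentIn_eq hy0
    simp only [A0]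
    rw [h2, ← h1]
    exact mem_connectedComponentIn hx
  have hSA0 : S ⊆ A0 := hSc.subset_connectedComponentIn hp0 hSA'
  have hkp0 : k p0 ∈ A0 := by
    by_contra hc
    have hkS0 : ∀ x, k.symm x ∈ S → x ∉ A0 := by
      intro x hx hxA0
      have h1 : IsPreconnected (k '' S) := hSc.image _ k.continuous.continuousOn
      have h2 : k '' S ⊆ connectedComponentIn A x := h1.subset_connectedComponentIn
        ⟨_, hx, k.apply_symm_apply x⟩ (by rintro _ ⟨y, hy, rfl⟩; exact (hkA y).2 (hSA' y hy))
      rw [← connectedComponentIn_eq hxA0] at h2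
      exact hc (h2 ⟨p0, hp0, rfl⟩)
    refine nob (fun x => if x ∈ A0 then ℓ' x else ℓ x) ?_ ?_
    · intro x hx
      by_cases hx0 : x ∈ A0
      · refine (hcl' x hx (fun h => hkS0 x h hx0)).congr ?_
        filter_upwards [hA0o.mem_nhds hx0] with y hy
        rw [if_pos hy]
      · refine (hcont' x hx (fun h => hx0 (hSA0 h))).congr ?_
        filter_upwards [hA0c x hx hx0] with y hy
        rw [if_neg hy]
    · intro x hx
      split_ifs
      · exact hexpl' x hx
      · exact hexp' x hx
  have hkA0 : ∀ x ∈ A0, k x ∈ A0 := by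
    intro x hx
    have h1 : IsPreconnected (k '' A0) :=
      isPreconnected_connectedComponentIn.image _ k.continuous.continuousOn
    have h2 : k '' A0 ⊆ connectedComponentIn A (k p0) := h1.subset_connectedComponentIn
      ⟨_, mem_connectedComponentIn hp0A, rfl⟩
      (by rintro _ ⟨y, hy, rfl⟩; exact (hkA y).2 (hA0A hy))
    rw [← connectedComponentIn_eq hkp0] at h2
    exact h2 ⟨x, hx, rfl⟩
  have hdA0 : ∀ x ∈ A0, d x = n0 ∨ d x = n0 + 1 := by
    intro x hx
    refine preconn_pred (S := A0) isPreconnected_connectedComponentIn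
      (fun x => d x = n0 ∨ d x = n0 + 1) ?_ (mem_connectedComponentIn hp0A) hx (Or.inl hn0.symm)
    intro y hy
    have hyA := hA0A hy
    by_cases hyS : y ∈ S
    · filter_upwards [E2 y hyS] with z hz
      rw [hdS' y hyS] at hz ⊢
      by_cases hM : z ∈ M
      · rw [hz.1 hM]; omega
      · rw [hz.2 hM]
    · by_cases hkx : k.symm y ∈ S
      · filter_upwards [E3 y hkx] with z hz
        rw [hdkS' y hkx] at hz ⊢
        by_cases hM : k.symm z ∈ M
        · rw [hz.1 hM]; omega
        · rw [hz.2 hM]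
      · filter_upwards [E1 y hyA hyS hkx] with z hz
        rw [hz]
  -- choice of the starting point
  have hkeysum : ∀ y ∈ A, ∀ n : ℕ, lam (k ^ n) w y = ℓ ((k ^ n) y) - ℓ y -
      ((∑ m ∈ Finset.range n, d ((k ^ (m + 1)) y) : ℤ) : ℂ) * (2 * Real.pi * Complex.I) := by
    intro y hy n
    have hAn : ∀ n : ℕ, (k ^ n) y ∈ A := by
      intro n
      induction n with
      | zero => simpa using hy
      | succ n ih => rw [pow_succ_app, hkA]; exact ih
    induction n with
    | zero =>
      have h0 := (isLam IdOut.one).unique (B := fun _ _ => 0)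
        ⟨continuousOn_const, fun x y hxy => by simp [div_self (sub_ne_zero.2 hxy)], rfl⟩ (hAw y hy)
      simp [h0]
    | succ n ih =>
      rw [pow_succ', lam_mul hk (hk.pow n) (hAw y hy), ih, pow_fix hkw, Finset.sum_range_succ,
        Homeomorph.mul_apply]
      have := hd _ (hAn (n + 1))
      simp only [ℓ'] at this
      rw [pow_succ_app, k.symm_apply_apply] at this
      push_cast
      rw [pow_succ_app]
      linear_combination -this
  have hfin : ∀ y ∈ A0, y ∉ S → d (k y) ≠ 0 → ((∀ x ∈ A0, 0 ≤ d x) ∨ (∀ x ∈ A0, d x ≤ 0)) →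
      False := by
    intro y hy hyS hdy hsgn
    have hyA := hA0A hy
    obtain ⟨η, hη, hsm⟩ := lam_small (hAw y hyA) (ε := 1) one_pos
    have hc := hcont' y hyA hyS
    obtain ⟨η2, hη2, hsm2⟩ := Metric.continuousAt_iff.1 hc 1 one_pos
    obtain ⟨n, hn, hnd⟩ := hr (min η η2) (lt_min hη hη2) 1
    have h1 := hsm _ (hk.pow n) (fun z => (hnd z).trans_le (min_le_left _ _))
    have h2 := hsm2 (x := (k ^ n) y) (by
      rw [dist_eq_norm]; exact (hnd y).trans_le (min_le_right _ _))
    rw [dist_eq_norm] at h2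
    have hAn : ∀ n : ℕ, (k ^ n) y ∈ A0 := by
      intro n
      induction n with
      | zero => simpa using hy
      | succ n ih => rw [pow_succ_app]; exact hkA0 _ ih
    obtain ⟨Sg, hSg⟩ : ∃ s : ℤ, s = ∑ m ∈ Finset.range n, d ((k ^ (m + 1)) y) := ⟨_, rfl⟩
    have hS0 : Sg ≠ 0 := by
      intro h0
      rw [hSg] at h0
      have hd0 : d ((k ^ (0 + 1)) y) = 0 := by
        rcases hsgn with hs | hs
        · exact (Finset.sum_eq_zero_iff_of_nonneg (fun m _ => hs _ (hAn _))).1 h0 0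
            (Finset.mem_range.2 hn)
        · exact (Finset.sum_eq_zero_iff_of_nonpos (fun m _ => hs _ (hAn _))).1 h0 0
            (Finset.mem_range.2 hn)
      simp at hd0
      exact hdy hd0
    have h3 := hkeysum y hyA n
    rw [← hSg] at h3
    have h4 : (Sg : ℂ) * (2 * Real.pi * Complex.I) = (ℓ ((k ^ n) y) - ℓ y) - lam (k ^ n) w y := by
      rw [h3]; ring
    have h5 : ‖(Sg : ℂ) * (2 * Real.pi * Complex.I)‖ < 2 := by
      rw [h4]
      exact (norm_sub_le _ _).trans_lt (by linarith)
    rw [norm_mul, Complex.norm_intCast] at h5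
    have h6 : ‖(2 * Real.pi * Complex.I : ℂ)‖ = 2 * Real.pi := by
      simp [abs_of_pos Real.pi_pos]
    rw [h6] at h5
    have : (1:ℝ) ≤ |(Sg:ℝ)| := by exact_mod_cast Int.one_le_abs hS0
    nlinarith [Real.pi_gt_three]
  have hkinv : ∀ x ∈ A0, k.symm x ∈ A0 := by
    intro x hx
    have h1 : IsPreconnected (k.symm '' A0) :=
      isPreconnected_connectedComponentIn.image _ k.symm.continuous.continuousOn
    have h2 : k.symm '' A0 ⊆ connectedComponentIn A p0 := h1.subset_connectedComponentIn
      ⟨_, hkp0, k.symm_apply_apply p0⟩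
      (by rintro _ ⟨y, hy, rfl⟩; exact (hkiA y).2 (hA0A hy))
    exact h2 ⟨x, hx, rfl⟩
  rcases le_or_gt 0 n0 with h0 | h0
  · have hci : Tendsto (fun y => k.symm y) (𝓝 p0) (𝓝 (k.symm p0)) := k.symm.continuous.continuousAt
    have hkpA := (hA _).1 ((hkiA p0).2 hp0A)
    have hnS : ∀ᶠ x in 𝓝 p0, k.symm x ∉ S := hci.eventually (hSrel _ hkpA.1 hkpA.2 (hkS _ hp0))
    obtain ⟨x0, hx0M, hx0d, hx0S, hx0A⟩ := (hacc.and_eventually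
      ((E2 p0 hp0).and (hnS.and (hA0o.mem_nhds (mem_connectedComponentIn hp0A))))).exists
    refine hfin (k.symm x0) (hkinv _ hx0A) hx0S ?_ (Or.inl ?_)
    · rw [k.apply_symm_apply, hx0d.1 hx0M]; omega
    · intro x hx; rcases hdA0 x hx with h | h <;> omega
  · refine hfin (k.symm p0) (hkinv _ (hSA0 hp0)) (hkS _ hp0) ?_ (Or.inr ?_)
    · rw [k.apply_symm_apply]; omega
    · intro x hx; rcases hdA0 x hx with h | h <;> omega

theorem clog_neg_pos {q : ℂ} (hq : 0 < q.im) :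
    Complex.log (-q) = Complex.log q - Real.pi * Complex.I := by
  rw [Complex.log, Complex.log, Complex.arg_neg_eq_arg_sub_pi_of_im_pos hq, norm_neg]
  push_cast; ring

theorem clog_neg_neg {q : ℂ} (hq : q.im < 0) :
    Complex.log (-q) = Complex.log q + Real.pi * Complex.I := by
  rw [Complex.log, Complex.log, Complex.arg_neg_eq_arg_add_pi_of_im_neg hq, norm_neg]
  push_cast; ring

theorem no_free_aux {k : ℂ ≃ₜ ℂ} (hk : IdOut k) (hr : Recu k) {K F : Set ℂ} (hK : IsCompact K)
    (hKc : IsPreconnected K) (hF : IsClosed F) (hFc : IsPreconnected F)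
    (hout : ∀ x : ℂ, 1 ≤ ‖x‖ → x ∈ F) (hKF : Disjoint K F) {w : ℂ} (hw : w ∈ K)
    (hkw : k w = w) (hkK : ∀ x, k x ∈ K ↔ x ∈ K) (hkF : ∀ x, k x ∈ F ↔ x ∈ F)
    {y2 y1 : ℂ} (hy2 : y2 ∈ K) (hy1 : y1 ∈ F)
    (hA : ∀ s : ℝ, 0 < s → s < 1 → y2 + s * (y1 - y2) ∉ K ∧ y2 + s * (y1 - y2) ∉ F)
    (hfree : ∀ s t : ℝ, 0 < s → s < 1 → 0 < t → t < 1 →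
      k (y2 + s * (y1 - y2)) ≠ y2 + t * (y1 - y2)) : False := by
  classical
  have hne : y1 - y2 ≠ 0 := by
    intro h
    rw [sub_eq_zero] at h
    rw [h] at hy1
    exact Set.disjoint_left.1 hKF hy2 hy1
  obtain ⟨l1, hl1c, hl1⟩ := branch_sub hF hFc hout hy1
  obtain ⟨l2, hl2c, hl2⟩ := branch_quot hK.isClosed hKc hw hy2
  let ξ : ℂ → ℂ := fun x => (x - y2) / (y1 - y2)
  have hξc : Continuous ξ := by fun_prop
  have hxξ : ∀ x, x = y2 + ξ x * (y1 - y2) := by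
    intro x; simp only [ξ]; field_simp; ring
  have hξx : ∀ s, ξ (y2 + s * (y1 - y2)) = s := by
    intro s; simp only [ξ]; field_simp; ring
  let S : Set ℂ := {x | (ξ x).im = 0 ∧ 0 < (ξ x).re ∧ (ξ x).re < 1}
  let M : Set ℂ := {x | (ξ x).im < 0}
  have hS : ∀ x, x ∈ S ↔ ∃ s : ℝ, 0 < s ∧ s < 1 ∧ x = y2 + s * (y1 - y2) := by
    intro x
    constructor
    · rintro ⟨h1, h2, h3⟩
      refine ⟨(ξ x).re, h2, h3, ?_⟩
      have : (((ξ x).re : ℝ) : ℂ) = ξ x := by apply Complex.ext <;> simp [h1]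
      rw [this]; exact hxξ x
    · rintro ⟨s, h1, h2, rfl⟩
      simp only [S, Set.mem_ofPred_eq, hξx]
      simpa using ⟨h1, h2⟩
  have hSA : ∀ x ∈ S, x ∉ K ∧ x ∉ F := by
    intro x hx
    obtain ⟨s, h1, h2, rfl⟩ := (hS x).1 hx
    exact hA s h1 h2
  have hSc : IsPreconnected S := by
    have : S = (fun s : ℝ => y2 + s * (y1 - y2)) '' Set.Ioo (0:ℝ) 1 := by
      ext x
      rw [hS]
      constructor
      · rintro ⟨s, h1, h2, rfl⟩; exact ⟨s, ⟨h1, h2⟩, rfl⟩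
      · rintro ⟨s, ⟨h1, h2⟩, rfl⟩; exact ⟨s, h1, h2, rfl⟩
    rw [this]
    exact isPreconnected_Ioo.image _ (by fun_prop)
  have hk2 : ∀ x, x ∉ K → x - y2 ≠ 0 := by
    intro x hx h; rw [sub_eq_zero] at h; exact hx (h ▸ hy2)
  have hk1 : ∀ x, x ∉ F → x - y1 ≠ 0 := by
    intro x hx h; rw [sub_eq_zero] at h; exact hx (h ▸ hy1)
  have hξ0 : ∀ x, x ∉ K → ξ x ≠ 0 := fun x hx => div_ne_zero (hk2 x hx) hne
  have hξ1 : ∀ x, x ∉ F → ξ x ≠ 1 := by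
    intro x hx h
    have := hxξ x
    rw [h] at this
    apply hk1 x hx
    linear_combination this
  have hSrel : ∀ x, x ∉ K → x ∉ F → x ∉ S → ∀ᶠ y in 𝓝 x, y ∉ S := by
    intro x hx1 hx2 hxS
    let S' : Set ℂ := {x | (ξ x).im = 0 ∧ 0 ≤ (ξ x).re ∧ (ξ x).re ≤ 1}
    have hS'c : IsClosed S' := by
      refine IsClosed.inter (isClosed_eq (Complex.continuous_im.comp hξc) continuous_const)
        (IsClosed.inter (isClosed_le continuous_const (Complex.continuous_re.comp hξc))
          (isClosed_le (Complex.continuous_re.comp hξc) continuous_const))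
    have hxS' : x ∉ S' := by
      rintro ⟨h1, h2, h3⟩
      apply hxS
      refine ⟨h1, lt_of_le_of_ne h2 ?_, lt_of_le_of_ne h3 ?_⟩
      · intro h; exact hξ0 x hx1 (Complex.ext h.symm h1)
      · intro h; exact hξ1 x hx2 (Complex.ext (by simpa using h) (by simpa using h1))
    filter_upwards [hS'c.isOpen_compl.mem_nhds hxS'] with y hy hyS
    exact hy ⟨hyS.1, hyS.2.1.le, hyS.2.2.le⟩
  let q : ℂ → ℂ := fun x => (y1 - x) / (x - y2)
  have hqc : ∀ x, x ∉ K → ContinuousAt q x := by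
    intro x hx
    exact ContinuousAt.div (by fun_prop) (by fun_prop) (hk2 x hx)
  have hqξ : ∀ x, x ∉ K → q x = (ξ x)⁻¹ - 1 := by
    intro x hx
    have := hk2 x hx
    simp only [q, ξ]; field_simp; ring
  have hq0 : ∀ x, x ∉ K → x ∉ F → q x ≠ 0 := by
    intro x hx hx2
    refine div_ne_zero ?_ (hk2 x hx)
    rw [← neg_sub]; exact neg_ne_zero.2 (hk1 x hx2)
  have hqim : ∀ x, x ∉ K → (q x).im = - (ξ x).im / Complex.normSq (ξ x) := by
    intro x hx; rw [hqξ x hx]; simp [Complex.inv_im]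
  have hnS : ∀ x, x ∉ K → 0 < Complex.normSq (ξ x) := fun x hx => Complex.normSq_pos.2 (hξ0 x hx)
  have hqS : ∀ x ∈ S, q x ∈ Complex.slitPlane := by
    intro x hx
    obtain ⟨s, h1, h2, rfl⟩ := (hS x).1 hx
    rw [hqξ _ (hSA _ hx).1, hξx, Complex.mem_slitPlane_iff]
    left
    have : ((s:ℂ)⁻¹ - 1) = ((s⁻¹ - 1 : ℝ) : ℂ) := by push_cast; ring
    rw [this, Complex.ofReal_re]
    have := (one_lt_inv₀ h1).2 h2
    linarith
  have hqnS : ∀ x, x ∉ K → x ∉ F → x ∉ S → -q x ∈ Complex.slitPlane := by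
    intro x hx1 hx2 hxS
    rw [Complex.mem_slitPlane_iff]
    by_contra hc
    push Not at hc
    obtain ⟨h1, h2⟩ := hc
    have h3 : (q x).im = 0 := by simpa using h2
    rw [hqim x hx1, div_eq_zero_iff] at h3
    have h4 : (ξ x).im = 0 := by
      rcases h3 with h3 | h3
      · simpa using h3
      · exact absurd h3 (hnS x hx1).ne'
    have h5 : ξ x = ((ξ x).re : ℂ) := by apply Complex.ext <;> simp [h4]
    apply hxS
    have hq := hqξ x hx1
    rw [h5] at hq
    have h6 : (q x).re = ((ξ x).re)⁻¹ - 1 := by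
      rw [hq, ← Complex.ofReal_inv]; simp
    have h7 : 1 ≤ ((ξ x).re)⁻¹ := by
      have : (-q x).re = - (q x).re := by simp
      linarith
    have h8 : 0 < (ξ x).re := inv_pos.1 (by linarith)
    have h9 : (ξ x).re ≤ 1 := by
      rwa [one_le_inv₀ h8] at h7
    refine ⟨h4, h8, lt_of_le_of_ne h9 ?_⟩
    intro h; exact hξ1 x hx2 (Complex.ext (by simpa using h) (by simpa using h4))
  let ℓp : ℂ → ℂ := fun x => l1 x + l2 x - (Complex.log (q x) + Real.pi * Complex.I)
  let ℓ : ℂ → ℂ := fun x => l1 x + l2 x - (if x ∈ S then Complex.log (q x) + Real.pi * Complex.I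
    else Complex.log (-q x))
  have hl1c' : ∀ x, x ∉ F → ContinuousAt l1 x := fun x hx =>
    hl1c.continuousAt (hF.isOpen_compl.mem_nhds hx)
  have hl2c' : ∀ x, x ∉ K → ContinuousAt l2 x := fun x hx =>
    hl2c.continuousAt (hK.isClosed.isOpen_compl.mem_nhds hx)
  have hexpq : ∀ x, x ∉ K → x ∉ F → Complex.exp (l1 x + l2 x) / (-q x) = x - w := by
    intro x hx1 hx2
    rw [Complex.exp_add, hl1 x hx2, hl2 x hx1]
    have h1 := hk1 x hx2
    have h2 := hk2 x hx1
    have h3 : y1 - x ≠ 0 := by rw [← neg_sub]; exact neg_ne_zero.2 h1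
    simp only [q]
    rw [← neg_div, neg_sub]
    field_simp
  have hex : ∀ x, x ∉ K → x ∉ F → Complex.exp (ℓ x) = x - w := by
    intro x hx1 hx2
    rw [← hexpq x hx1 hx2]
    simp only [ℓ]
    rw [Complex.exp_sub]
    congr 1
    split_ifs
    · rw [Complex.exp_add, Complex.exp_log (hq0 x hx1 hx2), Complex.exp_pi_mul_I]; ring
    · rw [Complex.exp_log (neg_ne_zero.2 (hq0 x hx1 hx2))]
  obtain ⟨p0, hp0d⟩ : ∃ p0 : ℂ, p0 = y2 + ((1/2 : ℝ) : ℂ) * (y1 - y2) := ⟨_, rfl⟩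
  have hp0 : p0 ∈ S := (hS _).2 ⟨1/2, by norm_num, by norm_num, hp0d⟩
  refine free_abs hk hr hK hF hout hKF hw hkw hkK hkF (ℓ := ℓ) (ℓp := ℓp) (S := S) (M := M) hSc hp0
    hSA ?_ hex ?_ ?_ ?_ hSrel ?_ ?_
  · intro x hx hkx
    obtain ⟨s, h1, h2, rfl⟩ := (hS x).1 hx
    obtain ⟨t, h3, h4, h5⟩ := (hS _).1 hkx
    exact hfree s t h1 h2 h3 h4 h5
  · intro x hx1 hx2 hxS
    have hc : ContinuousAt (fun x => l1 x + l2 x - Complex.log (-q x)) x :=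
      ((hl1c' x hx2).add (hl2c' x hx1)).sub
        (ContinuousAt.clog (hqc x hx1).neg (hqnS x hx1 hx2 hxS))
    refine hc.congr ?_
    filter_upwards [hSrel x hx1 hx2 hxS] with y hy
    simp only [ℓ]
    rw [if_neg hy]
  · intro x hxS
    obtain ⟨hx1, hx2⟩ := hSA x hxS
    exact ((hl1c' x hx2).add (hl2c' x hx1)).sub
        ((ContinuousAt.clog (hqc x hx1) (hqS x hxS)).add continuousAt_const)
  · intro x hxS
    obtain ⟨hx1, hx2⟩ := hSA x hxS
    have e1 : ∀ᶠ y in 𝓝 x, 0 < (ξ y).re ∧ (ξ y).re < 1 := by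
      have : IsOpen {y | 0 < (ξ y).re ∧ (ξ y).re < 1} :=
        IsOpen.inter (isOpen_lt continuous_const (Complex.continuous_re.comp hξc))
          (isOpen_lt (Complex.continuous_re.comp hξc) continuous_const)
      exact this.mem_nhds hxS.2
    filter_upwards [e1, hK.isClosed.isOpen_compl.mem_nhds hx1] with y hy hyK
    constructor
    · intro hM
      have hM' : (ξ y).im < 0 := hM
      have hyS : y ∉ S := fun h => by have := h.1; linarith
      have : 0 < (q y).im := by
        rw [hqim y hyK]; exact div_pos (by linarith) (hnS y hyK)
      simp only [ℓ, ℓp]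
      rw [if_neg hyS, clog_neg_pos this]; ring
    · intro hM
      have hM' : 0 ≤ (ξ y).im := not_lt.1 hM
      simp only [ℓ, ℓp]
      by_cases hyS : y ∈ S
      · rw [if_pos hyS]
      · have h0 : (ξ y).im ≠ 0 := fun h => hyS ⟨h, hy⟩
        have : (q y).im < 0 := by
          rw [hqim y hyK]; exact div_neg_of_neg_of_pos (by
            have := lt_of_le_of_ne hM' h0.symm; linarith) (hnS y hyK)
        rw [if_neg hyS, clog_neg_neg this]
  · intro x hx hM
    have hM' : (ξ x).im < 0 := hM
    have := hx.1; linarith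
  · have ht : Tendsto (fun t : ℝ => p0 - t * Complex.I * (y1 - y2)) (𝓝[>] 0) (𝓝 p0) := by
      have : ContinuousAt (fun t : ℝ => p0 - t * Complex.I * (y1 - y2)) 0 := by fun_prop
      have h2 := this.tendsto
      simp only [Complex.ofReal_zero, zero_mul, sub_zero] at h2
      exact h2.mono_left nhdsWithin_le_nhds
    refine ht.frequently (Eventually.frequently ?_)
    filter_upwards [self_mem_nhdsWithin] with t ht0
    have : p0 - t * Complex.I * (y1 - y2) = y2 + (((1/2 : ℝ) : ℂ) - t * Complex.I) * (y1 - y2) := by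
      rw [hp0d]; ring
    have ht0' : 0 < t := ht0
    have h3 : ξ (p0 - t * Complex.I * (y1 - y2)) = ((1/2 : ℝ) : ℂ) - t * Complex.I := by
      rw [this, hξx]
    change (ξ _).im < 0
    rw [h3]
    simpa using ht0'

theorem no_free_segment {k : ℂ ≃ₜ ℂ} (hk : IdOut k) (hr : Recu k) {K F : Set ℂ} (hK : IsCompact K)
    (hKc : IsPreconnected K) (hF : IsClosed F) (hFc : IsPreconnected F)
    (hout : ∀ x : ℂ, 1 ≤ ‖x‖ → x ∈ F) (hKF : Disjoint K F) {w : ℂ} (hw : w ∈ K)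
    (hkw : k w = w) (hkK : ∀ x, k x ∈ K ↔ x ∈ K) (hkF : ∀ x, k x ∈ F ↔ x ∈ F)
    {u v : ℂ} (hu : u ∈ K) (hv : v ∈ F)
    (hfree : ∀ x ∈ segment ℝ u v, k x ∉ segment ℝ u v) : False := by
  let P : ℝ → ℂ := fun t => u + t * (v - u)
  have hPc : Continuous P := by fun_prop
  have hPs : ∀ t, 0 ≤ t → t ≤ 1 → P t ∈ segment ℝ u v := by
    intro t h0 h1
    rw [segment_eq_image']
    exact ⟨t, ⟨h0, h1⟩, by simp [P]⟩
  have hc1 : IsCompact (Set.Icc (0:ℝ) 1 ∩ P ⁻¹' F) := isCompact_Icc.inter_right (hF.preimage hPc)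
  obtain ⟨t1, ⟨⟨h10, h11⟩, ht1⟩, hm1⟩ := hc1.exists_isLeast ⟨1, ⟨by simp, by simpa [P] using hv⟩⟩
  have hc2 : IsCompact (Set.Icc (0:ℝ) t1 ∩ P ⁻¹' K) :=
    isCompact_Icc.inter_right (hK.isClosed.preimage hPc)
  obtain ⟨t2, ⟨⟨h20, h21⟩, ht2⟩, hm2⟩ := hc2.exists_isGreatest
    ⟨0, ⟨by simp [h10], by simpa [P] using hu⟩⟩
  have hlt : t2 < t1 := by
    refine lt_of_le_of_ne h21 ?_
    rintro rfl
    exact Set.disjoint_left.1 hKF ht2 ht1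
  have hP : ∀ s : ℝ, P t2 + s * (P t1 - P t2) = P (t2 + s * (t1 - t2)) := by
    intro s; simp only [P]; push_cast; ring
  refine no_free_aux hk hr hK hKc hF hFc hout hKF hw hkw hkK hkF (y2 := P t2) (y1 := P t1) ht2 ht1
    ?_ ?_
  · intro s hs0 hs1
    rw [hP]
    constructor
    · intro h
      have := hm2 ⟨⟨by nlinarith, by nlinarith⟩, h⟩
      nlinarith
    · intro h
      have := hm1 ⟨⟨by nlinarith, by nlinarith⟩, h⟩
      nlinarith
  · intro s t hs0 hs1 ht0 ht1'
    rw [hP, hP]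
    intro h
    refine hfree (P (t2 + s * (t1 - t2))) (hPs _ (by nlinarith) (by nlinarith)) ?_
    rw [h]
    exact hPs _ (by nlinarith) (by nlinarith)

/-- points of the disc whose full orbit avoids `E` -/
def Avoid (k : ℂ ≃ₜ ℂ) (E : Set ℂ) : Set ℂ := {q | ‖q‖ ≤ 1 ∧ ∀ n : ℤ, (k ^ n) q ∉ E}

theorem zpow_add_app (h : ℂ ≃ₜ ℂ) (m n : ℤ) (x : ℂ) : (h ^ (m + n)) x = (h ^ m) ((h ^ n) x) := by
  rw [zpow_add]; rfl

theorem zpow_fix {h : ℂ ≃ₜ ℂ} {x : ℂ} (hx : h x = x) (n : ℤ) : (h ^ n) x = x := by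
  cases n with
  | ofNat n => simpa using pow_fix hx n
  | negSucc n => rw [zpow_negSucc]; exact inv_fix (pow_fix hx _)

theorem rec_closed {k : ℂ ≃ₜ ℂ} (hr : Recu k) {T : Set ℂ} (hT : IsClosed T) {x : ℂ}
    (hx : ∀ i : ℕ, (k ^ i) x ∈ T) (n : ℤ) : (k ^ n) x ∈ T := by
  rw [← hT.closure_eq, Metric.mem_closure_iff]
  intro ε hε
  obtain ⟨N, hN, hd⟩ := hr ε hε n.natAbs
  obtain ⟨m, hm⟩ : ∃ m : ℕ, (m : ℤ) = N + n := ⟨(N + n).toNat, by omega⟩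
  refine ⟨(k ^ m) x, hx m, ?_⟩
  have : (k ^ m) x = (k ^ N) ((k ^ n) x) := by
    rw [← zpow_natCast, hm, zpow_add_app, zpow_natCast]
  rw [this, dist_comm, dist_eq_norm]
  exact hd _

theorem avoid_app {k : ℂ ≃ₜ ℂ} (hk : IdOut k) {E : Set ℂ} (m : ℤ) (x : ℂ) :
    (k ^ m) x ∈ Avoid k E ↔ x ∈ Avoid k E := by
  have key : ∀ (m : ℤ) x, x ∈ Avoid k E → (k ^ m) x ∈ Avoid k E := by
    rintro m x ⟨h1, h2⟩
    refine ⟨?_, fun n => ?_⟩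
    · rcases h1.lt_or_eq with h | h
      · exact ((hk.zpow m).lt_of_lt h).le
      · rw [hk.zpow m x h.ge]; exact h1
    · rw [← zpow_add_app]; exact h2 _
  refine ⟨fun h => ?_, key m x⟩
  have := key (-m) _ h
  rw [← zpow_add_app] at this
  simpa using this

theorem avoid_compact (k : ℂ ≃ₜ ℂ) {E : Set ℂ} (hE : IsOpen E) : IsCompact (Avoid k E) := by
  have : Avoid k E = closedBall 0 1 ∩ ⋂ n : ℤ, (k ^ n) ⁻¹' Eᶜ := by
    ext x; simp [Avoid]
  rw [this]
  exact (isCompact_closedBall 0 1).inter_right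
    (isClosed_iInter fun n => hE.isClosed_compl.preimage (k ^ n).continuous)

theorem comp_map {k : ℂ ≃ₜ ℂ} (hk : IdOut k) {E : Set ℂ} (m : ℤ) {w x : ℂ}
    (hx : x ∈ connectedComponentIn (Avoid k E) w) :
    (k ^ m) x ∈ connectedComponentIn (Avoid k E) ((k ^ m) w) := by
  have hw : w ∈ Avoid k E := by
    by_contra hc
    rw [connectedComponentIn_eq_empty hc] at hx
    exact hx
  have h1 : IsPreconnected ((k ^ m) '' connectedComponentIn (Avoid k E) w) :=
    isPreconnected_connectedComponentIn.image _ (k ^ m).continuous.continuousOn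
  have h2 := h1.subset_connectedComponentIn (F := Avoid k E) (x := (k ^ m) w)
    ⟨w, mem_connectedComponentIn hw, rfl⟩
    (by rintro _ ⟨y, hy, rfl⟩; exact (avoid_app hk m y).2 (connectedComponentIn_subset _ _ hy))
  exact h2 ⟨x, hx, rfl⟩

theorem exists_clopen_sep {I : Set ℂ} (hI : IsCompact I) {w : ℂ} (hw : w ∈ I) {O : Set ℂ}
    (hO : IsOpen O) (hX : connectedComponentIn I w ⊆ O) :
    ∃ Z Z' : Set ℂ, IsCompact Z ∧ IsCompact Z' ∧ Z ∪ Z' = I ∧ Disjoint Z Z' ∧ Z ⊆ O ∧ w ∈ Z := by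
  have : CompactSpace I := isCompact_iff_compactSpace.1 hI
  have hc : connectedComponentIn I w = (↑) '' connectedComponent (⟨w, hw⟩ : I) :=
    connectedComponentIn_eq_image hw
  have hdir : Directed (· ⊇ ·) (fun s : { s : Set I // IsClopen s ∧ (⟨w, hw⟩ : I) ∈ s } => (s : Set I)) := by
    intro a b
    exact ⟨⟨a.1 ∩ b.1, a.2.1.inter b.2.1, a.2.2, b.2.2⟩, Set.inter_subset_left,
      Set.inter_subset_right⟩
  have : Nonempty { s : Set I // IsClopen s ∧ (⟨w, hw⟩ : I) ∈ s } :=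
    ⟨⟨Set.univ, isClopen_univ, trivial⟩⟩
  obtain ⟨s, hs⟩ := exists_subset_nhds_of_compactSpace
    (V := fun s : { s : Set I // IsClopen s ∧ (⟨w, hw⟩ : I) ∈ s } => (s : Set I)) hdir
    (fun s => s.2.1.isClosed) (U := (↑) ⁻¹' O) (by
      intro x hx
      rw [← connectedComponent_eq_iInter_isClopen] at hx
      refine (hO.preimage continuous_subtype_val).mem_nhds (hX ?_)
      rw [hc]; exact ⟨x, hx, rfl⟩)
  refine ⟨(↑) '' (s : Set I), (↑) '' (s : Set I)ᶜ,
    s.2.1.isClosed.isCompact.image continuous_subtype_val,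
    s.2.1.compl.isClosed.isCompact.image continuous_subtype_val, ?_, ?_, ?_, ?_⟩
  · rw [← Set.image_union, Set.union_compl_self]; simp
  · exact (Set.disjoint_image_iff Subtype.val_injective).2 disjoint_compl_right
  · rintro _ ⟨x, hx, rfl⟩; exact hs hx
  · exact ⟨_, s.2.2, rfl⟩

theorem comp_closed {I : Set ℂ} (hI : IsClosed I) (w : ℂ) : IsClosed (connectedComponentIn I w) := by
  by_cases hw : w ∈ I
  · have h1 : IsPreconnected (closure (connectedComponentIn I w)) :=
      isPreconnected_connectedComponentIn.closure
    have h2 := h1.subset_connectedComponentIn (F := I) (x := w)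
      (subset_closure (mem_connectedComponentIn hw))
      (closure_minimal (connectedComponentIn_subset _ _) hI)
    exact isClosed_of_closure_subset h2
  · rw [connectedComponentIn_eq_empty hw]; exact isClosed_empty

theorem touch {k : ℂ ≃ₜ ℂ} (hk : IdOut k) (hr : Recu k) {E : Set ℂ} (hE : IsOpen E)
    (hEn : E.Nonempty) (hE1 : ∀ x ∈ E, ‖x‖ < 1) {w : ℂ} (hw : w ∈ Avoid k E) (hkw : k w = w) :
    ∃ x ∈ connectedComponentIn (Avoid k E) w, x ∈ closure E := by
  by_contra hc
  push Not at hc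
  obtain ⟨Z, Z', hZ, hZ', hZZ, hdis, hZE, hwZ⟩ := exists_clopen_sep (avoid_compact k hE) hw
    (O := (closure E)ᶜ) isClosed_closure.isOpen_compl (fun x hx => hc x hx)
  set X := connectedComponentIn (Avoid k E) w with hXdef
  have hwX : w ∈ X := mem_connectedComponentIn hw
  have hXI : X ⊆ Avoid k E := connectedComponentIn_subset _ _
  have hXp : IsPreconnected X := isPreconnected_connectedComponentIn
  have hXcl : IsClosed X := comp_closed (avoid_compact k hE).isClosed w
  have hXc : IsCompact X := (avoid_compact k hE).of_isClosed_subset hXcl hXI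
  have hZn : Z.Nonempty := ⟨w, hwZ⟩
  have hXZ : X ⊆ Z := by
    intro x hx
    by_contra hxZ
    have hxZ' : x ∈ Z' := by
      have := hXI hx
      rw [← hZZ] at this
      exact this.resolve_left hxZ
    obtain ⟨y, -, hy1, hy2⟩ := isPreconnected_closed_iff.1 hXp Z Z' hZ.isClosed hZ'.isClosed
      (hXI.trans hZZ.ge) ⟨w, hwX, hwZ⟩ ⟨x, hx, hxZ'⟩
    exact Set.disjoint_left.1 hdis hy1 hy2
  obtain ⟨δ, hδ, hδZ⟩ : ∃ δ > 0, ∀ x, infDist x Z ≤ δ → x ∉ Z' ∧ x ∉ closure E := by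
    obtain ⟨δ, hδ, h⟩ := hZ.exists_cthickening_subset_open
      (hZ'.isClosed.union isClosed_closure).isOpen_compl (t := (Z' ∪ closure E)ᶜ) (by
        intro x hx hx2
        rcases hx2 with h | h
        · exact Set.disjoint_left.1 hdis hx h
        · exact hZE hx h)
    refine ⟨δ, hδ, fun x hx => ?_⟩
    obtain ⟨y, hy, hxy⟩ := hZ.exists_infDist_eq_dist hZn x
    have := h (mem_cthickening_of_dist_le x y δ Z hy (hxy ▸ hx))
    simpa using this
  have hid : Continuous fun x => infDist x Z := continuous_infDist_pt Z
  have hZ0 : ∀ x ∈ Z, infDist x Z = 0 := fun x hx => infDist_zero_of_mem hx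
  have hkX : ∀ (n : ℤ), ∀ x ∈ X, (k ^ n) x ∈ X := by
    intro n x hx
    have := comp_map hk n hx
    rwa [zpow_fix hkw] at this
  have hkXn : ∀ (n : ℕ), ∀ x ∈ X, (k ^ n) x ∈ X := by
    intro n x hx
    simpa using hkX n x hx
  have hD : IsPreconnected (closedBall (0:ℂ) 1) := (convex_closedBall 0 1).isPreconnected
  have hXD : X ⊆ closedBall (0:ℂ) 1 := fun x hx => by simpa using (hXI hx).1
  -- thickened continua
  let W : ℝ → Set ℂ := fun t => closedBall (0:ℂ) 1 ∩ thickening t X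
  have hWp : ∀ t > 0, IsPreconnected (W t) := by
    intro t ht
    refine isPreconnected_of_forall w ?_
    rintro y ⟨hyD, hyt⟩
    obtain ⟨x, hx, hxy⟩ := mem_thickening_iff.1 hyt
    refine ⟨X ∪ (closedBall 0 1 ∩ ball x t), ?_, Or.inl hwX, Or.inr ⟨hyD, hxy⟩, ?_⟩
    · rintro z (hz | ⟨hz1, hz2⟩)
      · exact ⟨hXD hz, self_subset_thickening ht X hz⟩
      · exact ⟨hz1, mem_thickening_iff.2 ⟨x, hx, hz2⟩⟩
    · exact IsPreconnected.union x hx ⟨hXD hx, mem_ball_self ht⟩ hXp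
        ((convex_closedBall 0 1).inter (convex_ball x t)).isPreconnected
  have hXW : ∀ t > 0, X ⊆ W t := fun t ht x hx => ⟨hXD hx, self_subset_thickening ht X hx⟩
  -- case A is impossible
  have caseA : ∀ t > 0, ∃ x ∈ W t, ∃ n : ℕ, δ ≤ infDist ((k ^ n) x) Z := by
    intro t ht
    by_contra hcon
    push Not at hcon
    have hWI : W t ⊆ Avoid k E := by
      intro x hx
      refine ⟨by simpa using hx.1, fun n => ?_⟩
      have := rec_closed hr (T := {x | infDist x Z ≤ δ}) (isClosed_le hid continuous_const)
        (fun i => (hcon x hx i).le) n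
      exact fun h => (hδZ _ this).2 (subset_closure h)
    have hWX : W t ⊆ X := (hWp t ht).subset_connectedComponentIn (hXW t ht hwX) hWI
    obtain ⟨e, he⟩ := hEn
    have heD : e ∈ closedBall (0:ℂ) 1 := by simpa using (hE1 e he).le
    have heX : e ∈ X := by
      by_contra heX
      obtain ⟨y, hyD, hy1, hy2⟩ := hD (thickening t X) Xᶜ isOpen_thickening hXcl.isOpen_compl
        (by
          intro y _
          by_cases hy : y ∈ X
          · exact Or.inl (self_subset_thickening ht X hy)
          · exact Or.inr hy) ⟨w, hXD hwX, self_subset_thickening ht X hwX⟩ ⟨e, heD, heX⟩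
      exact hy2 (hWX ⟨hyD, hy1⟩)
    have := (hXI heX).2 0
    simp at this
    exact this he
  let A : ℕ → Set ℂ := fun N => {q | ‖q‖ ≤ 1 ∧ infDist q Z = δ ∧
    ∀ i : ℕ, i ≤ N → infDist ((k⁻¹ ^ i) q) Z ≤ δ}
  have hAn : ∀ N, (A N).Nonempty := by
    intro N
    have hop : IsOpen (⋂ i ∈ Finset.range (N + 1), {x | infDist ((k ^ i) x) Z < δ}) := by
      refine isOpen_biInter_finset fun i _ => ?_
      exact isOpen_lt (hid.comp (k ^ i).continuous) continuous_const
    obtain ⟨t, ht, htX⟩ := hXc.exists_thickening_subset_open hop (by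
      intro x hx
      simp only [Set.mem_iInter]
      intro i _
      change infDist _ _ < δ
      rw [hZ0 _ (hXZ (hkXn i x hx))]; exact hδ)
    have hex : ∃ n : ℕ, ∃ x ∈ W t, δ ≤ infDist ((k ^ n) x) Z := by
      obtain ⟨x, hx, n, hn⟩ := caseA t ht
      exact ⟨n, x, hx, hn⟩
    classical
    let n := Nat.find hex
    obtain ⟨x, hx, hxn⟩ := Nat.find_spec hex
    have hmin : ∀ m < n, ∀ x ∈ W t, infDist ((k ^ m) x) Z < δ := by
      intro m hm y hy
      by_contra hcc
      exact Nat.find_min hex hm ⟨y, hy, not_lt.1 hcc⟩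
    have hnN : N < n := by
      by_contra hcc
      have h1 := htX hx.2
      simp only [Set.mem_iInter] at h1
      have h2 : infDist ((k ^ n) x) Z < δ := h1 n (Finset.mem_range.2 (by omega))
      exact absurd hxn (not_le.2 h2)
    obtain ⟨y, hy, hyδ⟩ := (hWp t ht).intermediate_value (hXW t ht hwX) hx
      ((hid.comp (k ^ n).continuous).continuousOn) (show δ ∈ Set.Icc _ _ from ⟨by
        simp only [Function.comp]
        rw [hZ0 _ (hXZ (hkXn n w hwX))]; exact hδ.le, hxn⟩)
    simp only [Function.comp] at hyδ
    refine ⟨(k ^ n) y, ?_, hyδ, ?_⟩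
    · have h1 : ‖y‖ ≤ 1 := by simpa using hy.1
      rcases h1.lt_or_eq with h | h
      · exact ((hk.pow n).lt_of_lt h).le
      · rw [hk.pow n y h.ge]; exact h1
    · intro i hi
      obtain ⟨m, hm⟩ : ∃ m, n = i + m := ⟨n - i, by omega⟩
      rcases Nat.eq_zero_or_pos i with rfl | hi0
      · simpa using hyδ.le
      · have : (k⁻¹ ^ i) ((k ^ n) y) = (k ^ m) y := by
          rw [hm, pow_add_app, inv_pow, inv_mul_app]
        rw [this]
        exact (hmin m (by omega) y hy).le
  have hAcl : ∀ N, IsClosed (A N) := by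
    intro N
    have : A N = closedBall 0 1 ∩ ({q | infDist q Z = δ} ∩
      ⋂ i ∈ Finset.range (N + 1), {q | infDist ((k⁻¹ ^ i) q) Z ≤ δ}) := by
      ext q; simp [A, Nat.lt_succ_iff]
    rw [this]
    refine isClosed_closedBall.inter ((isClosed_eq hid continuous_const).inter ?_)
    refine isClosed_biInter fun i _ => ?_
    exact isClosed_le (hid.comp (k⁻¹ ^ i).continuous) continuous_const
  obtain ⟨q, hq⟩ := IsCompact.nonempty_iInter_of_sequence_nonempty_isCompact_isClosed A
    (fun N q hq => ⟨hq.1, hq.2.1, fun i hi => hq.2.2 i (by omega)⟩) hAn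
    ((isCompact_closedBall (0:ℂ) 1).of_isClosed_subset (hAcl 0) (fun q hq => by simpa using hq.1))
    hAcl
  rw [Set.mem_iInter] at hq
  have hqI : q ∈ Avoid k E := by
    refine ⟨(hq 0).1, fun n => ?_⟩
    have := rec_closed hr.inv (T := {x | infDist x Z ≤ δ}) (isClosed_le hid continuous_const)
        (x := q) (fun i => (hq i).2.2 i le_rfl) (-n)
    rw [inv_zpow', neg_neg] at this
    exact fun h => (hδZ _ this).2 (subset_closure h)
  have h1 := (hδZ q (hq 0).2.1.le).1
  rw [← hZZ] at hqI
  have h2 := hZ0 q (hqI.resolve_right h1)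
  have h3 := (hq 0).2.1
  linarith

theorem slide_homeo {φ : ℂ → ℝ} {c : NNReal} {v : ℂ} (hφ : LipschitzWith c φ) (hc : c * ‖v‖₊ < 1) :
    ∃ T : ℂ ≃ₜ ℂ, ∀ x, T x = x + φ x * v := by
  have hA : ApproximatesLinearOn (fun x : ℂ => x + φ x * v)
      ((ContinuousLinearEquiv.refl ℝ ℂ : ℂ ≃L[ℝ] ℂ) : ℂ →L[ℝ] ℂ) Set.univ (c * ‖v‖₊) := by
    intro x _ y _
    have h1 := hφ.dist_le_mul x y
    rw [Real.dist_eq, dist_eq_norm] at h1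
    have : x + φ x * v - (y + φ y * v) - ((ContinuousLinearEquiv.refl ℝ ℂ : ℂ ≃L[ℝ] ℂ) : ℂ →L[ℝ] ℂ) (x - y)
        = ((φ x - φ y : ℝ) : ℂ) * v := by
      simp; ring
    rw [this, norm_mul, Complex.norm_real, Real.norm_eq_abs]
    push_cast
    have := mul_le_mul_of_nonneg_right h1 (norm_nonneg v)
    calc _ ≤ _ := this
      _ = _ := by ring
  refine ⟨hA.toHomeomorph _ (Or.inr ?_), fun x => rfl⟩
  have : ‖((ContinuousLinearEquiv.refl ℝ ℂ).symm : ℂ →L[ℝ] ℂ)‖₊ = 1 := by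
    have : ((ContinuousLinearEquiv.refl ℝ ℂ).symm : ℂ →L[ℝ] ℂ) = ContinuousLinearMap.id ℝ ℂ := rfl
    rw [this]; ext; simp
  rw [this]; simpa using hc

theorem slide (a b : ℂ) {ε : ℝ} (hε : 0 < ε) :
    ∃ S : ℂ ≃ₜ ℂ, S a = b ∧ ∀ x, ε ≤ infDist x (segment ℝ a b) → S x = x := by
  let φ : ℂ → ℝ := fun x => max 0 (1 - infDist x (segment ℝ a b) / ε)
  have hL : LipschitzWith (Real.toNNReal (1 / ε)) φ := by
    refine LipschitzWith.of_dist_le_mul fun x y => ?_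
    rw [Real.coe_toNNReal _ (by positivity), Real.dist_eq]
    have h1 := (lipschitz_infDist_pt (segment ℝ a b)).dist_le_mul x y
    rw [Real.dist_eq] at h1
    simp only [NNReal.coe_one, one_mul] at h1
    calc |φ x - φ y| ≤ |(1 - infDist x (segment ℝ a b) / ε) - (1 - infDist y (segment ℝ a b) / ε)| := by
          have := abs_max_sub_max_le_max 0 (1 - infDist x (segment ℝ a b) / ε) 0
            (1 - infDist y (segment ℝ a b) / ε)
          simpa [φ] using this
      _ = 1 / ε * |infDist x (segment ℝ a b) - infDist y (segment ℝ a b)| := by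
          rw [← abs_of_pos (show 0 < 1 / ε by positivity), ← abs_mul, ← abs_neg]
          congr 1; ring
      _ ≤ _ := by gcongr
  obtain ⟨n, hn⟩ := exists_nat_gt (1 / ε * ‖b - a‖)
  have hn0 : (0:ℝ) < n := lt_of_le_of_lt (by positivity) hn
  have hnC : (n : ℂ) ≠ 0 := by
    have : (n:ℝ) ≠ 0 := hn0.ne'
    exact_mod_cast this
  obtain ⟨T, hT⟩ := slide_homeo (v := (b - a) / n) hL (by
    rw [← NNReal.coe_lt_coe]
    push_cast
    rw [Real.coe_toNNReal _ (by positivity), norm_div, Complex.norm_natCast, ← mul_div_assoc,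
      div_lt_one hn0]
    exact hn)
  refine ⟨T ^ n, ?_, ?_⟩
  · have key : ∀ m : ℕ, m ≤ n → (T ^ m) a = a + (m : ℂ) * ((b - a) / n) := by
      intro m
      induction m with
      | zero => simp
      | succ m ih =>
        intro hm
        rw [pow_succ_app, ih (by omega), hT]
        have hmem : a + (m : ℂ) * ((b - a) / n) ∈ segment ℝ a b := by
          rw [segment_eq_image']
          refine ⟨(m : ℝ) / n, ⟨by positivity, ?_⟩, ?_⟩
          · rw [div_le_one hn0]; exact_mod_cast (by omega : m ≤ n)
          · simp; ring
        have : φ (a + (m : ℂ) * ((b - a) / n)) = 1 := by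
          simp [φ, infDist_zero_of_mem hmem]
        rw [this]; push_cast; ring
    rw [key n le_rfl]
    field_simp; ring
  · intro x hx
    apply pow_fix
    rw [hT]
    have : φ x = 0 := by
      simp only [φ]
      apply max_eq_left
      rw [sub_nonpos, one_le_div hε]; exact hx
    rw [this]; simp

theorem lam_supp {Ψ : ℂ ≃ₜ ℂ} (hΨ : IdOut Ψ) {F N : Set ℂ} (hF : IsClosed F) (hN : IsClosed N)
    (hFN : Disjoint F N) (hs : ∀ x, x ∉ N → Ψ x = x) {w : ℂ} (hw : w ∈ F) {L : ℂ → ℂ}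
    (hL : ContinuousOn L Fᶜ) (hLe : ∀ x, x ∉ F → Complex.exp (L x) = x - w) {x : ℂ} (hx : x ∉ F) :
    lam Ψ w x = L (Ψ x) - L x := by
  classical
  have hFf : ∀ x ∈ F, Ψ x = x := fun x hx => hs x (Set.disjoint_left.1 hFN hx)
  have hFc : ∀ x, x ∉ F → Ψ x ∉ F := by
    intro x hx h
    have := Ψ.injective (hFf _ h)
    rw [this] at h; exact hx h
  let g : ℂ → ℂ := fun x => if x ∈ F then 0 else L (Ψ x) - L x
  have hg0 : ∀ x, Ψ x = x → g x = 0 := by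
    intro x hx; simp only [g]; rw [hx]; simp
  have hgc : Continuous g := by
    rw [continuous_iff_continuousAt]
    intro x
    by_cases hx : x ∈ F
    · refine (continuousAt_const (y := (0:ℂ))).congr ?_
      filter_upwards [hN.isOpen_compl.mem_nhds (Set.disjoint_left.1 hFN hx)] with y hy
      exact (hg0 y (hs y hy)).symm
    · have hLa : ∀ y, y ∉ F → ContinuousAt L y := fun y hy =>
        hL.continuousAt (hF.isOpen_compl.mem_nhds hy)
      have : ContinuousAt (fun y => L (Ψ y) - L y) x :=
        (ContinuousAt.comp (f := Ψ) (hLa _ (hFc x hx)) Ψ.continuous.continuousAt).sub (hLa x hx)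
      refine this.congr ?_
      filter_upwards [hF.isOpen_compl.mem_nhds hx] with y hy
      simp only [g]; rw [if_neg hy]
  have hconn : IsPreconnected ({w}ᶜ : Set ℂ) :=
    (isConnected_compl_singleton_of_one_lt_rank (by simp [Complex.rank_real_complex]) w).isPreconnected
  have hne : ∀ x, x ∉ F → x - w ≠ 0 := fun x hx h => hx (by rw [sub_eq_zero.1 h]; exact hw)
  have hxw : x ∈ ({w}ᶜ : Set ℂ) := by rintro rfl; exact hx hw
  let r : ℝ := ‖w‖ + 10
  have hr0 : 0 ≤ r := by positivity
  have hrn : ‖(r:ℂ)‖ = r := by rw [Complex.norm_real, Real.norm_of_nonneg hr0]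
  have hdist : 10 ≤ ‖w - (r:ℂ)‖ := by
    have := norm_sub_norm_le (r:ℂ) w
    rw [hrn, norm_sub_rev] at this
    simp only [r] at this ⊢
    linarith
  have hrw : w ≠ (r:ℂ) := by
    intro h; rw [← h] at hdist; simp at hdist; linarith
  have hΨr : Ψ r = r := hΨ _ (by rw [hrn]; simp only [r]; linarith [norm_nonneg w])
  have hlr : lam Ψ w r = 0 := by
    rw [lam_eq_log hΨ (η := 2) (by norm_num) hΨ.disp hrw (by linarith), hFf w hw, hΨr,
      div_self (sub_ne_zero.2 hrw), Complex.log_one]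
  have := log_eq_of_eq hconn (g := fun x => lam Ψ w x) (g' := g)
    (fun y hy => (lam_contAt hΨ (Ne.symm hy)).continuousWithinAt) hgc.continuousOn (by
      intro y hy
      rw [(isLam hΨ).exp w y (Ne.symm hy), hFf w hw]
      have hyw : w - y ≠ 0 := sub_ne_zero.2 (Ne.symm hy)
      by_cases hyF : y ∈ F
      · simp only [g]; rw [if_pos hyF, hFf y hyF, div_self hyw, Complex.exp_zero]
      · simp only [g]; rw [if_neg hyF, Complex.exp_sub, hLe _ (hFc y hyF), hLe y hyF,
          ← neg_sub, ← neg_sub y w, neg_div_neg_eq]) (x := (r:ℂ)) (y := x) (Ne.symm hrw) hxw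
    (by rw [hg0 _ hΨr]; exact hlr)
  rw [this]
  simp only [g]; rw [if_neg hx]

theorem bk_abs {h : ℂ ≃ₜ ℂ} (hh : IdOut h) (hr : Recu h) {o : ℂ} {p : Fin 3 → ℂ}
    (hp : ∀ i, h (p i) = p i) {P : Fin 3 → ℝ → ℂ} (hPc : ∀ i, Continuous (P i))
    (hP0 : ∀ i, P i 0 = o) (hP1 : ∀ i, P i 1 = p i)
    (hne : ∀ i l, i ≠ l → ∀ s t, P i s ≠ h (P l t)) : False := by
  have hPp : ∀ i l, i ≠ l → ∀ s, P i s ≠ p l := by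
    intro i l hil s
    have := hne i l hil s 1
    rwa [hP1, hp] at this
  have hoo : o - h o ≠ 0 := by
    have := hne 0 1 (by decide) 0 0
    rw [hP0, hP0] at this
    exact sub_ne_zero.2 this
  have hM : ∀ i l, ∃ M : ℝ × ℝ → ℂ, i ≠ l → Continuous M ∧
      (∀ q, Complex.exp (M q) = P i q.1 - h (P l q.2)) ∧ M (0, 0) = Complex.log (o - h o) := by
    intro i l
    by_cases hil : i = l
    · exact ⟨fun _ => 0, fun h => absurd hil h⟩
    obtain ⟨g, hg, hge⟩ := exists_clog (A := ℝ × ℝ) (fun q => P i q.1 - h (P l q.2)) (by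
      have h1 := hPc i
      have h2 := hPc l
      have h3 := h.continuous
      fun_prop) (fun q => sub_ne_zero.2 (hne i l hil _ _))
    refine ⟨fun q => g q - g (0, 0) + Complex.log (o - h o), fun _ => ⟨by fun_prop, ?_, by simp⟩⟩
    intro q
    rw [Complex.exp_add, Complex.exp_sub, hge, hge, Complex.exp_log hoo]
    simp only [hP0]
    rw [div_mul_cancel₀ _ hoo]
  choose M hM using hM
  have huniv : IsPreconnected (Set.univ : Set ℝ) := isPreconnected_univ
  have hα : ∀ l i i', l ≠ i → l ≠ i' → M l i (1, 0) = M l i' (1, 0) := by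
    intro l i i' h1 h2
    refine log_eq_of_eq huniv (g := fun s => M l i (s, 0)) (g' := fun s => M l i' (s, 0))
      (x := 0) (y := 1) ?_ ?_ ?_ trivial trivial ?_
    · exact ((hM l i h1).1.comp (by fun_prop : Continuous fun s : ℝ => (s, (0:ℝ)))).continuousOn
    · exact ((hM l i' h2).1.comp (by fun_prop : Continuous fun s : ℝ => (s, (0:ℝ)))).continuousOn
    · intro s _
      rw [(hM l i h1).2.1, (hM l i' h2).2.1]
      simp only [hP0]
    · rw [(hM l i h1).2.2, (hM l i' h2).2.2]
  have hβ : ∀ l i i', i ≠ l → i' ≠ l → M i l (0, 1) = M i' l (0, 1) := by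
    intro l i i' h1 h2
    refine log_eq_of_eq huniv (g := fun s => M i l (0, s)) (g' := fun s => M i' l (0, s))
      (x := 0) (y := 1) ?_ ?_ ?_ trivial trivial ?_
    · exact ((hM i l h1).1.comp (by fun_prop : Continuous fun s : ℝ => ((0:ℝ), s))).continuousOn
    · exact ((hM i' l h2).1.comp (by fun_prop : Continuous fun s : ℝ => ((0:ℝ), s))).continuousOn
    · intro s _
      rw [(hM i l h1).2.1, (hM i' l h2).2.1]
      simp only [hP0]
    · rw [(hM i l h1).2.2, (hM i' l h2).2.2]
  have hD : ∀ i l, i ≠ l → M i l (1, 1) - M l i (1, 1) =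
      M i l (0, 1) - M l i (1, 0) + lam h (p l) o := by
    intro i l hil
    have hc1 : Continuous fun t : ℝ => M l i (1, t) - M i l (t, 1) :=
      ((hM l i hil.symm).1.comp (by fun_prop : Continuous fun s : ℝ => ((1:ℝ), s))).sub
        ((hM i l hil).1.comp (by fun_prop : Continuous fun s : ℝ => (s, (1:ℝ))))
    have hc2 : Continuous fun t : ℝ => lam h (p l) (P i t) + Complex.I * Real.pi := by
      refine Continuous.add ?_ continuous_const
      rw [continuous_iff_continuousAt]
      intro t
      exact ContinuousAt.comp (f := P i) (lam_contAt hh (hPp i l hil t).symm) (hPc i).continuousAt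
    have := log_diff_const huniv hc1.continuousOn hc2.continuousOn (by
      intro t _
      have e1 : p l - P i t ≠ 0 := sub_ne_zero.2 (hPp i l hil t).symm
      have e2 : P i t - p l ≠ 0 := sub_ne_zero.2 (hPp i l hil t)
      rw [Complex.exp_sub, (hM l i hil.symm).2.1, (hM i l hil).2.1, Complex.exp_add,
        (isLam hh).exp _ _ (hPp i l hil t).symm]
      simp only [hP1, hp]
      rw [mul_comm Complex.I,
        Complex.exp_pi_mul_I]
      field_simp
      ring) (x := 0) (y := 1) trivial trivial
    have hll : lam h (p l) (p i) = 0 := by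
      refine lam_fix_fix hh hr ?_ (hp l) (hp i)
      have := hPp i l hil 1
      rw [hP1] at this
      exact this.symm
    simp only [hP0, hP1, hll] at this
    linear_combination this
  have h01 := hD 0 1 (by decide)
  have h10 := hD 1 0 (by decide)
  have h02 := hD 0 2 (by decide)
  have h20 := hD 2 0 (by decide)
  have h12 := hD 1 2 (by decide)
  have h21 := hD 2 1 (by decide)
  rw [hβ 1 0 2 (by decide) (by decide), hα 1 0 2 (by decide) (by decide), ← h21] at h01
  rw [hβ 0 1 2 (by decide) (by decide), hα 0 1 2 (by decide) (by decide), ← h20] at h10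
  rw [hβ 2 0 1 (by decide) (by decide), hα 2 0 1 (by decide) (by decide), ← h12] at h02
  have h0 : M 0 1 (1, 1) - M 1 0 (1, 1) = 0 := by
    linear_combination (h01 - h10 + h02) / 2
  have h1 : Complex.exp (M 0 1 (1, 1) - M 1 0 (1, 1)) = 1 := by rw [h0, Complex.exp_zero]
  rw [Complex.exp_sub, (hM 0 1 (by decide)).2.1, (hM 1 0 (by decide)).2.1] at h1
  simp only [hP1, hp] at h1
  have hpp : p 0 ≠ p 1 := by
    have := hPp 0 1 (by decide) 1
    rwa [hP1] at this
  have e1 : p 1 - p 0 ≠ 0 := sub_ne_zero.2 hpp.symm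
  rw [div_eq_one_iff_eq e1] at h1
  apply hpp
  linear_combination h1 / 2

theorem bk_comp {h : ℂ ≃ₜ ℂ} (hh : IdOut h) (hr : Recu h) {z : ℂ} (hz : h z ≠ z) :
    h z ∈ connectedComponentIn {x | h x ≠ x} z := by
  by_contra hc
  set U := connectedComponentIn {x | h x ≠ x} z with hU
  have hzU : z ∈ U := mem_connectedComponentIn hz
  have hUF : ∀ x ∈ U, h x ≠ x := fun x hx => connectedComponentIn_subset {x | h x ≠ x} z hx
  have hFN : ∀ x, h x ≠ x → h (h x) ≠ h x := fun x hx h2 => hx (h.injective h2)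
  have hdis : ∀ x ∈ U, h x ∉ U := by
    intro x hx hxU
    have h1 : IsPreconnected (h '' U) :=
      isPreconnected_connectedComponentIn.image _ h.continuous.continuousOn
    have h2 := h1.subset_connectedComponentIn (F := {x | h x ≠ x}) ⟨x, hx, rfl⟩
      (by rintro _ ⟨y, hy, rfl⟩; exact hFN y (hUF y hy))
    rw [← connectedComponentIn_eq hxU] at h2
    exact hc (h2 ⟨z, hzU, rfl⟩)
  let e : Fin 3 → ℂ := ![1, Complex.I, -1]
  have he1 : ∀ i, ‖e i‖ = 1 := by intro i; fin_cases i <;> simp [e]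
  have he : ∀ i l, i ≠ l → ∀ s t : ℝ, 0 < s → 0 < t → (s:ℂ) * e i ≠ t * e l := by
    intro i l hil s t hs ht heq
    have h1 := congrArg Complex.re heq
    have h2 := congrArg Complex.im heq
    fin_cases i <;> fin_cases l <;> simp [e] at h1 h2 hil <;> linarith
  have hFixc : IsClosed {x | h x = x} := isClosed_eq h.continuous continuous_id
  have hs : ∀ i, ∃ s : ℝ, 0 < s ∧ h (z + s * e i) = z + s * e i ∧
      ∀ t : ℝ, 0 ≤ t → t < s → h (z + t * e i) ≠ z + t * e i := by
    intro i
    let R : ℝ := ‖z‖ + 1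
    have hc1 : IsCompact (Set.Icc (0:ℝ) R ∩ (fun s : ℝ => z + s * e i) ⁻¹' {x | h x = x}) :=
      isCompact_Icc.inter_right (hFixc.preimage (by fun_prop))
    have hRn : (0:ℝ) ≤ R := by positivity
    obtain ⟨s, ⟨⟨h0, h1⟩, h2⟩, h3⟩ := hc1.exists_isLeast ⟨R, ⟨by simp [hRn], by
      apply hh
      have := norm_sub_norm_le ((R:ℂ) * e i) (-z)
      rw [norm_mul, he1, Complex.norm_real, Real.norm_of_nonneg hRn, norm_neg, sub_neg_eq_add,
        add_comm ((R:ℂ) * e i)] at this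
      simp only [R] at this ⊢
      linarith⟩⟩
    have h2' : h (z + s * e i) = z + s * e i := h2
    refine ⟨s, lt_of_le_of_ne h0 ?_, h2', ?_⟩
    · rintro rfl
      simp at h2'
      exact hz h2'
    · intro t ht0 hts htf
      have := h3 ⟨⟨ht0, by linarith⟩, htf⟩
      linarith
  choose s hs0 hsf hsm using hs
  let cl : ℝ → ℝ := fun t => max 0 (min 1 t)
  have hcl0 : ∀ t, 0 ≤ cl t := fun t => le_max_left _ _
  have hcl1 : ∀ t, cl t ≤ 1 := fun t => max_le zero_le_one (min_le_left _ _)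
  let P : Fin 3 → ℝ → ℂ := fun i t => z + ((cl t * s i : ℝ) : ℂ) * e i
  have hPU : ∀ i t, cl t < 1 → P i t ∈ U := by
    intro i t ht
    let I : Set ℂ := (fun r : ℝ => z + (r : ℂ) * e i) '' Set.Icc 0 (cl t * s i)
    have hI : IsPreconnected I := isPreconnected_Icc.image _ (by fun_prop)
    have hn := mul_nonneg (hcl0 t) (hs0 i).le
    refine hI.subset_connectedComponentIn (F := {x | h x ≠ x}) ⟨0, ⟨le_rfl, hn⟩, by simp⟩ ?_
      ⟨cl t * s i, ⟨hn, le_rfl⟩, rfl⟩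
    rintro _ ⟨r, ⟨hr0, hr1⟩, rfl⟩
    refine hsm i r hr0 (hr1.trans_lt ?_)
    have := hs0 i
    nlinarith
  have hP1' : ∀ i t, ¬ cl t < 1 → P i t = z + s i * e i := by
    intro i t ht
    have : cl t = 1 := le_antisymm (hcl1 t) (not_lt.1 ht)
    simp only [P, this, one_mul]
  refine bk_abs hh hr (o := z) (p := fun i => z + s i * e i) (P := P) hsf ?_ ?_ ?_ ?_
  · intro i; simp only [P, cl]; fun_prop
  · intro i; simp [P, cl]
  · intro i; simp [P, cl]
  · intro i l hil a b hab
    by_cases ha : cl a < 1 <;> by_cases hb : cl b < 1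
    · have h1 := hPU i a ha
      rw [hab] at h1
      exact hdis _ (hPU l b hb) h1
    · rw [hP1' l b hb, hsf] at hab
      have h1 := hUF _ (hPU i a ha)
      rw [hab] at h1
      exact h1 (hsf l)
    · have h1 := hFN _ (hUF _ (hPU l b hb))
      rw [← hab, hP1' i a ha] at h1
      exact h1 (hsf i)
    · rw [hP1' i a ha, hP1' l b hb, hsf] at hab
      exact he i l hil _ _ (hs0 i) (hs0 l) (add_left_cancel hab)

theorem slide_local {h : ℂ ≃ₜ ℂ} {z y y' : ℂ} {ρ : ℝ} (hρ : 0 < ρ)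
    (hb : ∀ x, dist x y < 2 * ρ → h x ≠ x ∧ x ≠ z) {a b : ℂ} (ha : dist a y < ρ) (hb' : dist b y < ρ) :
    ∃ S : ℂ ≃ₜ ℂ, (∀ x, h x = x → S x = x) ∧ S z = z ∧ S a = b := by
  obtain ⟨S, hS, hSs⟩ := slide a b hρ
  have key : ∀ x, ¬ dist x y < 2 * ρ → S x = x := by
    intro x hx
    apply hSs
    refine (le_infDist ⟨a, left_mem_segment ℝ a b⟩).2 ?_
    intro u hu
    have hu' : u ∈ ball y ρ := (convex_ball y ρ).segment_subset ha hb' hu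
    have := dist_triangle x u y
    rw [mem_ball] at hu'
    linarith
  refine ⟨S, fun x hx => key x ?_, key z ?_, hS⟩
  · intro hd; exact (hb x hd).1 hx
  · intro hd; exact (hb z hd).2 rfl

theorem reduce {h : ℂ ≃ₜ ℂ} (hh : IdOut h) (hr : Recu h) {z : ℂ} (hz : h z ≠ z) :
    ∃ g : ℂ ≃ₜ ℂ, IdOut g ∧ Recu g ∧ g z ≠ z ∧ ∀ x, g x = x → ‖g z - z‖ < ‖x - z‖ := by
  have hUo : IsOpen {x | h x ≠ x} := isOpen_ne_fun h.continuous continuous_id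
  obtain ⟨r, hr0, hrU⟩ := Metric.isOpen_iff.1 hUo z hz
  have hUc : IsPreconnected (connectedComponentIn {x | h x ≠ x} z) :=
    isPreconnected_connectedComponentIn
  let Q : ℂ → Prop := fun y => ∃ ψ : ℂ ≃ₜ ℂ, (∀ x, h x = x → ψ x = x) ∧ ψ z = z ∧ dist (ψ y) z < r
  have hQ : Q (h z) := by
    refine preconn_pred hUc Q ?_ (mem_connectedComponentIn hz) (bk_comp hh hr hz)
      ⟨1, fun _ _ => rfl, rfl, by simpa using hr0⟩
    intro y hy
    have hyU : h y ≠ y := connectedComponentIn_subset {x | h x ≠ x} z hy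
    by_cases hyz : dist y z < r
    · filter_upwards [isOpen_ball.mem_nhds (show y ∈ ball z r from hyz)] with y' hy'
      exact ⟨fun _ => ⟨1, fun _ _ => rfl, rfl, hyz⟩, fun _ => ⟨1, fun _ _ => rfl, rfl, hy'⟩⟩
    · obtain ⟨ρ, hρ, hρU⟩ := Metric.isOpen_iff.1 hUo y hyU
      obtain ⟨σ, hσ, hσr, hσρ⟩ : ∃ σ > 0, 2 * σ ≤ r ∧ 2 * σ ≤ ρ :=
        ⟨min r ρ / 2, by positivity, by linarith [min_le_left r ρ], by linarith [min_le_right r ρ]⟩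
      have hb : ∀ x, dist x y < 2 * σ → h x ≠ x ∧ x ≠ z := by
        intro x hx
        refine ⟨hρU (show dist x y < ρ by linarith), ?_⟩
        rintro rfl
        rw [dist_comm] at hx
        linarith
      filter_upwards [isOpen_ball.mem_nhds (mem_ball_self hσ : y ∈ ball y σ)] with y' hy'
      constructor
      · rintro ⟨ψ, h1, h2, h3⟩
        obtain ⟨S, hS1, hS2, hS3⟩ := slide_local (h := h) (y' := y') hσ hb
          (show dist y y < σ by simpa using hσ) hy'
        refine ⟨ψ * S, fun x hx => ?_, ?_, ?_⟩
        · rw [Homeomorph.mul_apply, hS1 x hx, h1 x hx]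
        · rw [Homeomorph.mul_apply, hS2, h2]
        · rw [Homeomorph.mul_apply, hS3]; exact h3
      · rintro ⟨ψ, h1, h2, h3⟩
        obtain ⟨S, hS1, hS2, hS3⟩ := slide_local (h := h) (y' := y') hσ hb
          hy' (show dist y y < σ by simpa using hσ)
        refine ⟨ψ * S, fun x hx => ?_, ?_, ?_⟩
        · rw [Homeomorph.mul_apply, hS1 x hx, h1 x hx]
        · rw [Homeomorph.mul_apply, hS2, h2]
        · rw [Homeomorph.mul_apply, hS3]; exact h3
  obtain ⟨ψ, h1, h2, h3⟩ := hQ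
  have hψ : IdOut ψ := fun x hx => h1 x (hh x hx)
  have happ : ∀ x, (ψ * h * ψ⁻¹) x = ψ (h (ψ⁻¹ x)) := fun x => rfl
  have hψz : ψ⁻¹ z = z := inv_fix h2
  refine ⟨ψ * h * ψ⁻¹, (hψ.mul hh).mul hψ.inv, hr.conj hψ, ?_, ?_⟩
  · rw [happ, hψz]
    intro he
    rw [← h2] at he
    have := ψ.injective he
    rw [h2] at this
    exact hz this
  · intro x hx
    rw [happ] at hx
    have h4 : h (ψ⁻¹ x) = ψ⁻¹ x := by
      apply ψ.injective
      rw [hx, mul_inv_app]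
    have h5 : ψ⁻¹ x = x := by
      have := h1 _ h4
      rw [mul_inv_app] at this
      exact this.symm
    rw [h5] at h4
    rw [happ, hψz, ← dist_eq_norm, ← dist_eq_norm]
    by_contra hcon
    have : x ∈ ball z r := by rw [mem_ball]; linarith
    exact hrU this h4

/-- the outer continuum -/
def Outer (h : ℂ ≃ₜ ℂ) (E : Set ℂ) : Set ℂ := connectedComponentIn (Avoid h E) 1 ∪ {x | 1 ≤ ‖x‖}

theorem one_avoid {h : ℂ ≃ₜ ℂ} (hh : IdOut h) {E : Set ℂ} (hE1 : ∀ x ∈ E, ‖x‖ < 1) {x : ℂ}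
    (hx : ‖x‖ = 1) : x ∈ Avoid h E := by
  refine ⟨hx.le, fun n hn => ?_⟩
  rw [hh.zpow n x hx.ge] at hn
  have := hE1 x hn
  linarith

theorem circle_comp {h : ℂ ≃ₜ ℂ} (hh : IdOut h) {E : Set ℂ} (hE1 : ∀ x ∈ E, ‖x‖ < 1) {x : ℂ}
    (hx : ‖x‖ = 1) : x ∈ connectedComponentIn (Avoid h E) 1 := by
  have h1 : IsPreconnected (sphere (0:ℂ) 1) :=
    isPreconnected_sphere (by simp [Complex.rank_real_complex]) 0 1
  refine h1.subset_connectedComponentIn (by simp) ?_ (by simpa using hx)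
  intro y hy
  exact one_avoid hh hE1 (by simpa using hy)

theorem outer_closed (h : ℂ ≃ₜ ℂ) {E : Set ℂ} (hE : IsOpen E) : IsClosed (Outer h E) :=
  (comp_closed (avoid_compact h hE).isClosed 1).union (isClosed_le continuous_const continuous_norm)

theorem preconn_out : IsPreconnected {x : ℂ | 1 ≤ ‖x‖} := by
  have h1 : IsPreconnected {x : ℂ | 0 ≤ x.re} := (convex_halfSpace_re_ge 0).isPreconnected
  have h2 : {x : ℂ | 1 ≤ ‖x‖} = Complex.exp '' {x : ℂ | 0 ≤ x.re} := by
    ext x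
    constructor
    · intro hx
      have hx' : 1 ≤ ‖x‖ := hx
      have h0 : x ≠ 0 := by rintro rfl; simp at hx'; linarith
      refine ⟨Complex.log x, ?_, Complex.exp_log h0⟩
      change 0 ≤ (Complex.log x).re
      rw [Complex.log_re]; exact Real.log_nonneg hx'
    · rintro ⟨y, hy, rfl⟩
      change 1 ≤ ‖Complex.exp y‖
      rw [Complex.norm_exp]; exact Real.one_le_exp hy
  rw [h2]
  exact h1.image _ Complex.continuous_exp.continuousOn

theorem outer_preconn {h : ℂ ≃ₜ ℂ} (hh : IdOut h) {E : Set ℂ} (hE1 : ∀ x ∈ E, ‖x‖ < 1) :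
    IsPreconnected (Outer h E) :=
  IsPreconnected.union 1 (circle_comp hh hE1 (by simp)) (by simp)
    isPreconnected_connectedComponentIn preconn_out

theorem outer_map {h : ℂ ≃ₜ ℂ} (hh : IdOut h) {E : Set ℂ} (m : ℤ) {x : ℂ} (hx : x ∈ Outer h E) :
    (h ^ m) x ∈ Outer h E := by
  rcases hx with hx | hx
  · left
    have := comp_map hh m hx
    rwa [hh.zpow m 1 (by simp)] at this
  · right; rw [hh.zpow m x hx]; exact hx

theorem outer_iff {h : ℂ ≃ₜ ℂ} (hh : IdOut h) {E : Set ℂ} (m : ℤ) (x : ℂ) :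
    (h ^ m) x ∈ Outer h E ↔ x ∈ Outer h E := by
  refine ⟨fun hx => ?_, outer_map hh m⟩
  have := outer_map hh (-m) hx
  rw [← zpow_add_app] at this
  simpa using this

theorem outer_disj {h : ℂ ≃ₜ ℂ} (hh : IdOut h) {E : Set ℂ} (hE1 : ∀ x ∈ E, ‖x‖ < 1) {x : ℂ}
    (hx : x ∈ Outer h E) (n : ℤ) : (h ^ n) x ∉ E := by
  rcases hx with hx | hx
  · exact (connectedComponentIn_subset _ _ hx).2 n
  · rw [hh.zpow n x hx]
    intro h2
    have h3 := hE1 x h2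
    have h4 : 1 ≤ ‖x‖ := hx
    linarith

theorem touch_pow {h : ℂ ≃ₜ ℂ} (hh : IdOut h) (hr : Recu h) {i : ℕ} (hi : 0 < i) {E : Set ℂ}
    (hE : IsOpen E) (hEn : E.Nonempty) (hE1 : ∀ x ∈ E, ‖x‖ < 1) {w : ℂ} (hw : w ∈ Avoid h E)
    (hkw : (h ^ i) w = w) :
    ∃ m : ℤ, ∃ x ∈ connectedComponentIn (Avoid h E) ((h ^ m) w), x ∈ closure E := by
  let E' : Set ℂ := ⋃ a ∈ Finset.range i, (h ^ a) '' E
  have hE' : IsOpen E' := isOpen_biUnion fun a _ => (h ^ a).isOpenMap _ hE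
  have hA : Avoid (h ^ i) E' = Avoid h E := by
    ext x
    constructor
    · rintro ⟨h1, h2⟩
      refine ⟨h1, fun n hn => ?_⟩
      -- n = i * q - a
      let q : ℤ := n / i + 1
      let a : ℤ := i - n % i
      have hi' : (0:ℤ) < i := by exact_mod_cast hi
      have hm0 := Int.emod_nonneg n hi'.ne'
      have hm1 := Int.emod_lt_of_pos n hi'
      by_cases hz : n % i = 0
      · apply h2 (n / i)
        simp only [E', Set.mem_iUnion, Finset.mem_range]
        refine ⟨0, hi, (h ^ n) x, hn, ?_⟩
        rw [pow_zero, Homeomorph.one_apply, ← zpow_natCast h i, ← zpow_mul]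
        have := Int.mul_ediv_add_emod n i
        rw [hz, add_zero] at this
        rw [this]
      · apply h2 q
        simp only [E', Set.mem_iUnion, Finset.mem_range]
        refine ⟨a.toNat, by omega, (h ^ n) x, hn, ?_⟩
        rw [← zpow_natCast h a.toNat, Int.toNat_of_nonneg (by omega), ← zpow_add_app,
          ← zpow_natCast h i, ← zpow_mul]
        congr 2
        have := Int.mul_ediv_add_emod n i
        simp only [q, a]
        linarith
    · rintro ⟨h1, h2⟩
      refine ⟨h1, fun n hn => ?_⟩
      simp only [E', Set.mem_iUnion, Finset.mem_range] at hn
      obtain ⟨a, ha, y, hy, hyx⟩ := hn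
      apply h2 (-a + i * n)
      rw [zpow_add_app, zpow_mul, zpow_natCast, ← hyx, zpow_neg, zpow_natCast, inv_mul_app]
      exact hy
  obtain ⟨e, he⟩ := hEn
  obtain ⟨u, hu, huE⟩ := touch (hh.pow i) (hr.pow hi) hE' (E := E')
    ⟨e, by
      simp only [E', Set.mem_iUnion, Finset.mem_range]
      exact ⟨0, hi, e, he, rfl⟩⟩
    (by
      intro x hx
      simp only [E', Set.mem_iUnion, Finset.mem_range] at hx
      obtain ⟨a, ha, y, hy, rfl⟩ := hx
      exact (hh.pow a).lt_of_lt (hE1 y hy)) (by rw [hA]; exact hw) hkw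
  rw [hA] at hu
  simp only [E'] at huE
  rw [Finset.closure_biUnion] at huE
  simp only [Set.mem_iUnion, Finset.mem_range] at huE
  obtain ⟨a, ha, hua⟩ := huE
  rw [← Homeomorph.image_closure] at hua
  obtain ⟨y, hy, rfl⟩ := hua
  refine ⟨-a, y, ?_, hy⟩
  have := comp_map hh (-a) hu
  rw [zpow_neg, zpow_natCast] at this ⊢
  rwa [inv_mul_app] at this

/-- pairs whose joining segment is not free -/
def NF (k : ℂ ≃ₜ ℂ) : Set (ℂ × ℂ) := {p | ∃ s ∈ segment ℝ p.1 p.2, k s ∈ segment ℝ p.1 p.2}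

theorem nf_closed (k : ℂ ≃ₜ ℂ) : IsClosed (NF k) := by
  let T : Set ((Set.Icc (0:ℝ) 1 × Set.Icc (0:ℝ) 1) × (ℂ × ℂ)) := {q | k (q.2.1 + ((q.1.1 : ℝ) : ℂ) * (q.2.2 - q.2.1)) =
    q.2.1 + ((q.1.2 : ℝ) : ℂ) * (q.2.2 - q.2.1)}
  have hT : IsClosed T := by
    have := k.continuous
    exact isClosed_eq (by fun_prop) (by fun_prop)
  have : NF k = Prod.snd '' T := by
    ext p
    constructor
    · rintro ⟨s, hs, hks⟩
      rw [segment_eq_image'] at hs hks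
      obtain ⟨t, ht, rfl⟩ := hs
      obtain ⟨t', ht', he⟩ := hks
      refine ⟨((⟨t, ht⟩, ⟨t', ht'⟩), p), ?_, rfl⟩
      simp only [T, Set.mem_ofPred_eq]
      simp only [Complex.real_smul] at he
      exact he.symm
    · rintro ⟨⟨⟨t, t'⟩, p'⟩, hq, rfl⟩
      have hq' : k (p'.1 + ((t : ℝ) : ℂ) * (p'.2 - p'.1)) =
        p'.1 + ((t' : ℝ) : ℂ) * (p'.2 - p'.1) := hq
      refine ⟨p'.1 + ((t : ℝ) : ℂ) * (p'.2 - p'.1), ?_, ?_⟩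
      · rw [segment_eq_image']; exact ⟨t, t.2, by simp⟩
      · rw [hq', segment_eq_image']; exact ⟨t', t'.2, by simp⟩
  rw [this]
  exact isClosedMap_snd_of_compactSpace _ hT

theorem pair_nf {h : ℂ ≃ₜ ℂ} (hh : IdOut h) (hr : Recu h) {i : ℕ} (hi : 0 < i) {E : Set ℂ}
    (hE : IsOpen E) (hEn : E.Nonempty) (hE1 : ∀ x ∈ E, ‖x‖ < 1)
    (hEf : ∀ x ∈ E, (h ^ i) x ≠ x) {w : ℂ} (hkw : (h ^ i) w = w) (hwO : w ∉ Outer h E) :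
    ∃ u ∈ closure E, ∃ v ∈ closure E, (u, v) ∈ NF (h ^ i) ∧
      (i = 1 → (h u, v) ∈ NF (h ^ i) ∧ (u, h v) ∈ NF (h ^ i)) := by
  have hfixm : ∀ m : ℤ, (h ^ i) ((h ^ m) w) = (h ^ m) w := by
    intro m
    rw [← zpow_natCast h i, ← zpow_add_app, add_comm, zpow_add_app, zpow_natCast, hkw]
  have hwA : w ∈ Avoid h E := by
    refine ⟨?_, fun n hn => hEf _ hn (hfixm n)⟩
    by_contra hc
    exact hwO (Or.inr (not_le.1 hc).le)
  obtain ⟨m, u, hu, huE⟩ := touch_pow hh hr hi hE hEn hE1 hwA hkw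
  have h1A : (1:ℂ) ∈ Avoid h E := one_avoid hh hE1 (by simp)
  obtain ⟨v, hv, hvE⟩ := touch hh hr hE hEn hE1 h1A (hh 1 (by simp))
  set w' := (h ^ m) w with hw'
  have hw'A : w' ∈ Avoid h E := (avoid_app hh m w).2 hwA
  have hw'O : w' ∉ Outer h E := fun hc => hwO ((outer_iff hh m w).1 hc)
  set K := connectedComponentIn (Avoid h E) w' with hK
  have hw'K : w' ∈ K := mem_connectedComponentIn hw'A
  have hKF : Disjoint K (Outer h E) := by
    rw [Set.disjoint_left]
    intro x hxK hxO
    apply hw'O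
    have h2 : x ∈ connectedComponentIn (Avoid h E) 1 := by
      rcases hxO with h2 | h2
      · exact h2
      · have h3 := (connectedComponentIn_subset _ _ hxK).1
        exact circle_comp hh hE1 (le_antisymm h3 h2)
    left
    rw [connectedComponentIn_eq h2, ← connectedComponentIn_eq hxK]
    exact hw'K
  have hKcomp : IsCompact K :=
    (avoid_compact h hE).of_isClosed_subset (comp_closed (avoid_compact h hE).isClosed _)
      (connectedComponentIn_subset _ _)
  have hkK : ∀ x, (h ^ i) x ∈ K ↔ x ∈ K := by
    intro x
    constructor
    · intro hx
      have := comp_map hh (-i) hx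
      rw [zpow_neg, zpow_natCast, inv_mul_app, inv_fix (hfixm m)] at this
      exact this
    · intro hx
      have := comp_map hh i hx
      rw [zpow_natCast, hfixm m] at this
      exact this
  have hkF : ∀ x, (h ^ i) x ∈ Outer h E ↔ x ∈ Outer h E := by
    intro x
    have := outer_iff hh (E := E) i x
    rwa [zpow_natCast] at this
  have key : ∀ u ∈ K, ∀ v ∈ Outer h E, (u, v) ∈ NF (h ^ i) := by
    intro u hu v hv
    by_contra hc
    refine no_free_segment (hh.pow i) (hr.pow hi) hKcomp isPreconnected_connectedComponentIn
      (outer_closed h hE) (outer_preconn hh hE1) (fun x hx => Or.inr hx) hKF hw'K (hfixm m)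
      hkK hkF hu hv ?_
    intro x hx hkx
    exact hc ⟨x, hx, hkx⟩
  refine ⟨u, huE, v, hvE, key u hu v (Or.inl hv), ?_⟩
  intro hi1
  subst hi1
  rw [pow_one] at hkK hkF
  exact ⟨key _ ((hkK u).2 hu) v (Or.inl hv), key u hu _ ((hkF v).2 (Or.inl hv))⟩

theorem exists_eps {h : ℂ ≃ₜ ℂ} (hh : IdOut h) (hr : Recu h) {i : ℕ} (hi : 0 < i) {Q : Set ℂ}
    (hQ : IsCompact Q) (hQc : Convex ℝ Q) {x y : ℂ} (hx : x ∈ Q) (hxy : h x = y)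
    (D1 : ∀ q ∈ Q, (h ^ i) q ∈ Q → i = 1 ∧ (q = x ∨ q = y) ∧ (h q = x ∨ h q = y))
    (D2 : ∀ q ∈ Q, (h ^ i) q ≠ q)
    (ext : ∀ a ∈ Q, ∀ b ∈ Q, x ∈ segment ℝ a b → y ∈ segment ℝ a b →
      (a = x ∧ b = y) ∨ (a = y ∧ b = x)) :
    ∃ ε > 0, (∀ u ∈ thickening ε Q, ‖u‖ < 1) ∧
      ∀ w, (h ^ i) w = w → w ∈ Outer h (thickening ε Q) := by
  have hfc : IsClosed {u | (h ^ i) u = u} := isClosed_eq (h ^ i).continuous continuous_id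
  obtain ⟨ε0, hε0, hd⟩ := (hfc.isOpen_compl.mem_nhdsSet.2
    (fun q hq => D2 q hq) |> fun H => hQ.exists_thickening_subset_open hfc.isOpen_compl
      (fun q hq => D2 q hq))
  have hd' : ∀ u ∈ thickening ε0 Q, (h ^ i) u ≠ u := fun u hu => hd hu
  have hd1 : ∀ u ∈ thickening ε0 Q, ‖u‖ < 1 := by
    intro u hu
    by_contra hc
    exact hd' u hu (hh.pow i u (not_lt.1 hc))
  by_contra hc
  push Not at hc
  let e : ℕ → ℝ := fun n => ε0 / (n + 1)
  have he0 : ∀ n, 0 < e n := fun n => by positivity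
  have hele : ∀ n, e n ≤ ε0 := fun n => div_le_self hε0.le (by simp)
  have hsub : ∀ n, thickening (e n) Q ⊆ thickening ε0 Q := fun n => thickening_mono (hele n) Q
  have hlim : Tendsto e atTop (𝓝 0) := by
    have := (tendsto_one_div_add_atTop_nhds_zero_nat (𝕜 := ℝ)).const_mul ε0
    simpa [e, div_eq_mul_inv] using this
  have hex : ∀ n, ∃ p : ℂ × ℂ, p.1 ∈ cthickening (e n) Q ∧ p.2 ∈ cthickening (e n) Q ∧
      p ∈ NF (h ^ i) ∧ (i = 1 → (h p.1, p.2) ∈ NF (h ^ i) ∧ (p.1, h p.2) ∈ NF (h ^ i)) := by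
    intro n
    obtain ⟨w, hw, hwO⟩ := hc (e n) (he0 n) (fun u hu => hd1 u (hsub n hu))
    obtain ⟨u, hu, v, hv, h1, h2⟩ := pair_nf hh hr hi isOpen_thickening
      ⟨x, self_subset_thickening (he0 n) Q hx⟩ (fun u hu => hd1 u (hsub n hu))
      (fun u hu => hd' u (hsub n hu)) hw hwO
    exact ⟨(u, v), closure_thickening_subset_cthickening _ _ hu,
      closure_thickening_subset_cthickening _ _ hv, h1, h2⟩
  choose p hp1 hp2 hp3 hp4 using hex
  have hcc : IsCompact (cthickening ε0 Q ×ˢ cthickening ε0 Q) := hQ.cthickening.prod hQ.cthickening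
  obtain ⟨⟨a, b⟩, -, φ, hφ, hlimp⟩ := hcc.tendsto_subseq (x := p) (fun n =>
    ⟨cthickening_mono (hele n) Q (hp1 n), cthickening_mono (hele n) Q (hp2 n)⟩)
  have hQne : Q.Nonempty := ⟨x, hx⟩
  have memQ : ∀ (s : ℕ → ℂ) (c : ℂ), Tendsto s atTop (𝓝 c) →
      (∀ n, s n ∈ cthickening (e (φ n)) Q) → c ∈ Q := by
    intro s c hs hm
    rw [hQ.isClosed.mem_iff_infDist_zero hQne]
    have h1 : Tendsto (fun n => infDist (s n) Q) atTop (𝓝 (infDist c Q)) :=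
      (continuous_infDist_pt Q).continuousAt.tendsto.comp hs
    have h2 : Tendsto (fun n => e (φ n)) atTop (𝓝 0) := hlim.comp hφ.tendsto_atTop
    refine le_antisymm (le_of_tendsto_of_tendsto' h1 h2 fun n => ?_) infDist_nonneg
    have := hm n
    rw [cthickening_eq_preimage_infEDist] at this
    exact ENNReal.toReal_le_of_le_ofReal (he0 _).le this
  have hla : Tendsto (fun n => (p (φ n)).1) atTop (𝓝 a) :=
    (continuous_fst.tendsto (a, b)).comp hlimp
  have hlb : Tendsto (fun n => (p (φ n)).2) atTop (𝓝 b) :=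
    (continuous_snd.tendsto (a, b)).comp hlimp
  have haQ : a ∈ Q := memQ _ a hla fun n => hp1 _
  have hbQ : b ∈ Q := memQ _ b hlb fun n => hp2 _
  have hnf : (a, b) ∈ NF (h ^ i) := (nf_closed _).mem_of_tendsto hlimp
    (Eventually.of_forall fun n => hp3 _)
  obtain ⟨s, hs, hks⟩ := hnf
  have hsQ := hQc.segment_subset haQ hbQ hs
  have hksQ := hQc.segment_subset haQ hbQ hks
  obtain ⟨hi1, hq1, hq2⟩ := D1 s hsQ hksQ
  subst hi1
  rw [pow_one] at *
  have hne := D2 s hsQ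
  have hboth : x ∈ segment ℝ a b ∧ y ∈ segment ℝ a b := by
    rcases hq1 with rfl | rfl
    · exact ⟨hs, hxy ▸ hks⟩
    · rcases hq2 with h2 | h2
      · exact ⟨h2 ▸ hks, hs⟩
      · exact absurd h2 hne
  have hyy : (y, y) ∈ NF h := by
    rcases ext a haQ b hbQ hboth.1 hboth.2 with ⟨rfl, rfl⟩ | ⟨rfl, rfl⟩
    · have h1 : Tendsto (fun n => (h (p (φ n)).1, (p (φ n)).2)) atTop (𝓝 (h a, b)) :=
        ((h.continuous.tendsto a).comp hla).prodMk_nhds hlb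
      rw [hxy] at h1
      exact (nf_closed h).mem_of_tendsto h1 (Eventually.of_forall fun n => (hp4 _ rfl).1)
    · have h1 : Tendsto (fun n => ((p (φ n)).1, h (p (φ n)).2)) atTop (𝓝 (a, h b)) :=
        hla.prodMk_nhds ((h.continuous.tendsto b).comp hlb)
      rw [hxy] at h1
      exact (nf_closed h).mem_of_tendsto h1 (Eventually.of_forall fun n => (hp4 _ rfl).2)
  obtain ⟨s', hs', hks'⟩ := hyy
  simp only [segment_same, Set.mem_singleton_iff] at hs' hks'
  subst hs'
  have hyQ : s' ∈ Q := hQc.segment_subset haQ hbQ hboth.2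
  exact D2 s' hyQ hks'

theorem lam_branch {k : ℂ ≃ₜ ℂ} (hk : IdOut k) (hr : Recu k) {F G : Set ℂ} (hF : IsClosed F)
    (hG : IsPreconnected G) (hGF : Disjoint G F) (hkG : ∀ x ∈ G, k x ∈ G) {w : ℂ} (hw : w ∈ F)
    (hkw : k w = w) {L : ℂ → ℂ} (hL : ContinuousOn L Fᶜ)
    (hLe : ∀ x, x ∉ F → Complex.exp (L x) = x - w) {x : ℂ} (hx : x ∈ G) :
    lam k w x = L (k x) - L x := by
  have hGc : ∀ y ∈ G, y ∉ F := fun y hy => Set.disjoint_left.1 hGF hy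
  have hne : ∀ y ∈ G, w ≠ y := fun y hy he => hGc y hy (he ▸ hw)
  have hLc : ∀ y ∈ G, ContinuousAt L y := fun y hy =>
    hL.continuousAt (hF.isOpen_compl.mem_nhds (hGc y hy))
  have hconst : ∀ y ∈ G, ∀ y' ∈ G, (L (k y) - L y) - lam k w y = (L (k y') - L y') - lam k w y' := by
    intro y hy y' hy'
    refine log_diff_const (g := fun y => L (k y) - L y) (g' := fun y => lam k w y) hG ?_ ?_ ?_ hy hy'
    · intro u hu
      refine ContinuousAt.continuousWithinAt (ContinuousAt.sub ?_ (hLc u hu))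
      exact ContinuousAt.comp (f := k) (g := L) (hLc _ (hkG u hu)) k.continuous.continuousAt
    · intro u hu
      exact (lam_contAt hk (hne u hu)).continuousWithinAt
    · intro u hu
      rw [Complex.exp_sub, hLe _ (hGc _ (hkG u hu)), hLe _ (hGc u hu), (isLam hk).exp _ _ (hne u hu),
        hkw, ← neg_sub w (k u), ← neg_sub w u, neg_div_neg_eq]
  set C := (L (k x) - L x) - lam k w x with hC
  have hpG : ∀ n : ℕ, (k ^ n) x ∈ G := by
    intro n
    induction n with
    | zero => simpa using hx
    | succ n ih => rw [pow_succ_app]; exact hkG _ ih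
  have hn : ∀ n : ℕ, lam (k ^ (n + 1)) w x = L ((k ^ (n + 1)) x) - L x - (n + 1) * C := by
    intro n
    induction n with
    | zero => simp only [zero_add, pow_one, Nat.cast_zero, one_mul, hC]; ring
    | succ n ih =>
      have h1 := hconst _ (hpG (n + 1)) _ hx
      rw [← pow_succ_app, ← hC] at h1
      rw [pow_succ', lam_mul hk (hk.pow _) (hne x hx), ih, pow_fix hkw, ← pow_succ']
      push_cast
      linear_combination -h1
  have hC0 : C = 0 := by
    by_contra hc
    have hCp : 0 < ‖C‖ := norm_pos_iff.2 hc
    obtain ⟨η, hη, hs⟩ := lam_small (hne x hx) (half_pos hCp)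
    obtain ⟨δ, hδ, hd⟩ := Metric.continuousAt_iff.1 (hLc x hx) (‖C‖ / 2) (half_pos hCp)
    obtain ⟨n, hn1, hdn⟩ := hr (min η δ) (lt_min hη hδ) 1
    obtain ⟨m, rfl⟩ : ∃ m, n = m + 1 := ⟨n - 1, by omega⟩
    have h1 := hs (k ^ (m + 1)) (hk.pow _) fun z => (hdn z).trans_le (min_le_left _ _)
    have h2 := @hd ((k ^ (m + 1)) x)
      (by rw [dist_eq_norm]; exact (hdn x).trans_le (min_le_right _ _))
    rw [dist_eq_norm] at h2
    have h3 : ((m:ℂ) + 1) * C = (L ((k ^ (m + 1)) x) - L x) - lam (k ^ (m + 1)) w x := by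
      rw [hn m]; ring
    have h4 : ‖((m:ℂ) + 1) * C‖ = (m + 1) * ‖C‖ := by
      rw [norm_mul]
      congr 1
      have : ((m:ℂ) + 1) = ((m + 1 : ℕ) : ℂ) := by push_cast; rfl
      rw [this, Complex.norm_natCast]; push_cast; rfl
    have h5 := norm_sub_le (L ((k ^ (m + 1)) x) - L x) (lam (k ^ (m + 1)) w x)
    rw [← h3, h4] at h5
    have : 0 ≤ (m:ℝ) * ‖C‖ := by positivity
    linarith
  linear_combination -hC.symm.trans hC0

theorem supp_mem {S : ℂ ≃ₜ ℂ} {N : Set ℂ} (hs : ∀ x, x ∉ N → S x = x) (x : ℂ) : S x ∈ N ↔ x ∈ N := by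
  constructor
  · intro h
    by_contra hc
    rw [hs x hc] at h
    exact hc h
  · intro h
    by_contra hc
    have := S.injective (hs _ hc)
    rw [this] at hc
    exact hc h

theorem final_abs {k S0 S1 τ : ℂ ≃ₜ ℂ} (hk : IdOut k) (hr : Recu k) {F G N0 N1 C : Set ℂ}
    (hF : IsClosed F) (hFc : IsPreconnected F) (hout : ∀ x : ℂ, 1 ≤ ‖x‖ → x ∈ F)
    (hfixF : ∀ w, k w = w → w ∈ F)
    (hG : IsPreconnected G) (hGF : Disjoint G F) (hkG : ∀ x ∈ G, k x ∈ G)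
    (hN0 : IsClosed N0) (hN1 : IsClosed N1) (hC : IsClosed C)
    (hF0 : Disjoint F N0) (hF1 : Disjoint F N1) (hFC : Disjoint F C)
    (s0 : ∀ x, x ∉ N0 → S0 x = x) (s1 : ∀ x, x ∉ N1 → S1 x = x) (sC : ∀ x, x ∉ C → τ x = x)
    (hCC : ∀ x ∈ C, k x ∉ C) (h0C : ∀ x ∈ N0, k x ∉ C) (h1C : ∀ x ∈ N1, k x ∉ C)
    (h00 : ∀ x ∈ N0, k x ∉ N0) (h11 : ∀ x ∈ N1, k x ∉ N1) (h10 : ∀ x ∈ N1, k x ∉ N0)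
    {z1 z2 a : ℂ} (hz1 : z1 ∈ G) (haG : a ∈ G) (hz2 : z2 ∈ G)
    (hz20 : z2 ∉ N0) (hz21 : z2 ∉ N1) (hz2C : z2 ∉ C) (hne : z1 ≠ z2)
    (ha : S1 (S0 z1) = a) (hka : k a = z2) (hτ : τ (k z2) = z1) : False := by
  have out : ∀ {N : Set ℂ} {S : ℂ ≃ₜ ℂ}, Disjoint F N → (∀ x, x ∉ N → S x = x) → IdOut S := by
    intro N S hd hs x hx
    exact hs x (Set.disjoint_left.1 hd (hout x hx))
  have i0 := out hF0 s0
  have i1 := out hF1 s1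
  have iC := out hFC sC
  have e1 : S0 z2 = z2 := s0 _ hz20
  have e2 : S1 z2 = z2 := s1 _ hz21
  have hGn : ∀ y ∈ G, y ∉ F := fun y hy => Set.disjoint_left.1 hGF hy
  have hS0F : S0 z1 ∉ F := by
    intro hc
    have := S0.injective (s0 _ (Set.disjoint_left.1 hF0 hc))
    rw [this] at hc
    exact hGn _ hz1 hc
  refine swap_contra (g := τ * (k * (S1 * S0))) (iC.mul (hk.mul (i1.mul i0))) hne
    (by simp only [Homeomorph.mul_apply]; rw [ha, hka, sC _ hz2C])
    (by simp only [Homeomorph.mul_apply]; rw [e1, e2, hτ]) ?_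
  intro w hw
  simp only [Homeomorph.mul_apply] at hw
  have hkw : k w = w := by
    by_cases h3 : k (S1 (S0 w)) ∈ C
    · exfalso
      have hx2 : S1 (S0 w) ∉ N1 := fun h => h1C _ h h3
      have hx1 : S1 (S0 w) = S0 w := s1 _ (fun h => hx2 ((supp_mem s1 _).2 h))
      rw [hx1] at h3
      have hx0 : S0 w ∉ N0 := fun h => h0C _ h h3
      have hx0' : S0 w = w := s0 _ (fun h => hx0 ((supp_mem s0 _).2 h))
      rw [hx0'] at h3 hx1
      rw [hx0', hx1] at hw
      exact hCC w (by rw [← hw]; exact (supp_mem sC _).2 h3) h3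
    · rw [sC _ h3] at hw
      have hx2 : S1 (S0 w) ∉ N1 := by
        intro h2
        have a0 := h10 _ h2
        have a1 := h11 _ h2
        rw [hw] at a0 a1
        rw [s0 w a0, s1 w a1] at h2
        exact a1 h2
      have hx1 : S1 (S0 w) = S0 w := s1 _ (fun h => hx2 ((supp_mem s1 _).2 h))
      rw [hx1] at hw
      have hx0 : w ∉ N0 := by
        intro h2
        have := h00 _ ((supp_mem s0 _).2 h2)
        rw [hw] at this
        exact this h2
      rwa [s0 w hx0] at hw
  have hwF := hfixF w hkw
  have w0 : S0 w = w := s0 _ (Set.disjoint_left.1 hF0 hwF)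
  have w1 : S1 w = w := s1 _ (Set.disjoint_left.1 hF1 hwF)
  obtain ⟨L, hL, hLe⟩ := branch_sub hF hFc hout hwF
  have hn1 : w ≠ z1 := fun he => hGn _ hz1 (he ▸ hwF)
  have hn2 : w ≠ z2 := fun he => hGn _ hz2 (he ▸ hwF)
  have hkz2 := hkG _ hz2
  rw [lam_mul iC (hk.mul (i1.mul i0)) hn1, lam_mul hk (i1.mul i0) hn1, lam_mul i1 i0 hn1,
    lam_mul iC (hk.mul (i1.mul i0)) hn2, lam_mul hk (i1.mul i0) hn2, lam_mul i1 i0 hn2]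
  simp only [Homeomorph.mul_apply]
  rw [ha, e1, e2, w0, w1, hkw, hka]
  rw [lam_supp i0 hF hN0 hF0 s0 hwF hL hLe (hGn _ hz1), lam_supp i1 hF hN1 hF1 s1 hwF hL hLe hS0F,
    lam_supp i0 hF hN0 hF0 s0 hwF hL hLe (hGn _ hz2), lam_supp i1 hF hN1 hF1 s1 hwF hL hLe (hGn _ hz2),
    lam_supp iC hF hC hFC sC hwF hL hLe (hGn _ hz2), lam_supp iC hF hC hFC sC hwF hL hLe (hGn _ hkz2),
    lam_branch hk hr hF hG hGF hkG hwF hkw hL hLe haG,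
    lam_branch hk hr hF hG hGF hkG hwF hkw hL hLe hz2, ha, hka, hτ, e1, e2, sC _ hz2C]
  ring

theorem thin_open {A U : Set ℂ} (hA : IsCompact A) (hU : IsOpen U) (hAU : A ⊆ U) :
    ∀ᶠ δ in 𝓝[>] (0:ℝ), cthickening δ A ⊆ U := by
  obtain ⟨ε, hε, h⟩ := hA.exists_cthickening_subset_open hU hAU
  filter_upwards [Ioc_mem_nhdsGT hε] with δ hδ
  exact (cthickening_mono hδ.2 A).trans h

theorem thin_pt {A : Set ℂ} (hA : IsCompact A) {z : ℂ} (hz : z ∉ A) :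
    ∀ᶠ δ in 𝓝[>] (0:ℝ), z ∉ cthickening δ A := by
  filter_upwards [thin_open hA (U := {z}ᶜ) isOpen_compl_singleton
    (fun a ha he => hz (by rw [← Set.mem_singleton_iff.1 he]; exact ha))] with δ hδ hc
  exact hδ hc rfl

theorem thin {k : ℂ ≃ₜ ℂ} {A B : Set ℂ} (hA : IsCompact A) (hB : IsCompact B)
    (hd : ∀ x ∈ A, k x ∉ B) :
    ∀ᶠ δ in 𝓝[>] (0:ℝ), ∀ x ∈ cthickening δ A, k x ∉ cthickening δ B := by
  have hdis : Disjoint (k '' A) B := by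
    rw [Set.disjoint_left]
    rintro _ ⟨x, hx, rfl⟩
    exact hd x hx
  obtain ⟨U, V, hU, hV, hAU, hBV, hUV⟩ :=
    SeparatedNhds.of_isCompact_isCompact (hA.image k.continuous) hB hdis
  filter_upwards [thin_open hA (hU.preimage k.continuous) (fun x hx => hAU ⟨x, hx, rfl⟩),
    thin_open hB hV hBV] with δ h1 h2 x hx hc
  exact Set.disjoint_left.1 hUV (h1 hx) (h2 hc)

theorem seg_compact (a b : ℂ) : IsCompact (segment ℝ a b) := by
  rw [segment_eq_image_lineMap]
  exact isCompact_Icc.image AffineMap.lineMap_continuous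

/-- full orbit of a set -/
def Orb (h : ℂ ≃ₜ ℂ) (E : Set ℂ) : Set ℂ := ⋃ n : ℤ, (h ^ n) '' E

theorem orb_preconn (h : ℂ ≃ₜ ℂ) {E : Set ℂ} (hE : IsPreconnected E) {x : ℂ} (hx : x ∈ E)
    (hhx : h x ∈ E) : IsPreconnected (Orb h E) := by
  refine IsPreconnected.iUnion_of_chain (fun n => hE.image _ (h ^ n).continuous.continuousOn) ?_
  intro n
  refine ⟨(h ^ n) (h x), ⟨h x, hhx, rfl⟩, ⟨x, hx, ?_⟩⟩
  rw [Order.succ_eq_add_one, zpow_add_app, zpow_one]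

theorem orb_app {h : ℂ ≃ₜ ℂ} {E : Set ℂ} (m : ℕ) {x : ℂ} (hx : x ∈ Orb h E) :
    (h ^ m) x ∈ Orb h E := by
  obtain ⟨n, y, hy, rfl⟩ := Set.mem_iUnion.1 hx
  refine Set.mem_iUnion.2 ⟨m + n, y, hy, ?_⟩
  rw [zpow_add_app, zpow_natCast]

theorem orb_self {h : ℂ ≃ₜ ℂ} {E : Set ℂ} {x : ℂ} (hx : x ∈ E) : x ∈ Orb h E :=
  Set.mem_iUnion.2 ⟨0, x, hx, rfl⟩

theorem orb_disj {h : ℂ ≃ₜ ℂ} (hh : IdOut h) {E : Set ℂ} (hE1 : ∀ x ∈ E, ‖x‖ < 1) :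
    Disjoint (Orb h E) (Outer h E) := by
  rw [Set.disjoint_left]
  intro x hx hxO
  obtain ⟨n, y, hy, rfl⟩ := Set.mem_iUnion.1 hx
  exact outer_disj hh hE1 ((outer_iff hh n y).1 hxO) 0 hy

theorem slide' (a b : ℂ) {ε : ℝ} (hε : 0 < ε) :
    ∃ S : ℂ ≃ₜ ℂ, S a = b ∧ ∀ x, x ∉ cthickening ε (segment ℝ a b) → S x = x := by
  obtain ⟨S, h1, h2⟩ := slide a b hε
  refine ⟨S, h1, fun x hx => h2 x ?_⟩
  by_contra hc
  apply hx
  apply thickening_subset_cthickening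
  rw [mem_thickening_iff_infDist_lt ⟨a, left_mem_segment ℝ a b⟩]
  exact not_le.1 hc

theorem final_even {h : ℂ ≃ₜ ℂ} (hh : IdOut h) (hr : Recu h) {i : ℕ} (hi : 0 < i) {E : Set ℂ}
    (hE : IsOpen E) (hEc : Convex ℝ E) (hE1 : ∀ x ∈ E, ‖x‖ < 1)
    (hfix : ∀ w, (h ^ i) w = w → w ∈ Outer h E) {x y p p' : ℂ} (hx : x ∈ E) (hy : y ∈ E)
    (hp : p ∈ E) (hp' : p' ∈ E) (hxy : h x = y) (hpp : (h ^ (2 * i)) p = p')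
    (c1 : ∀ q ∈ segment ℝ p' p, (h ^ i) q ∉ segment ℝ p' p) : False := by
  have hGF := orb_disj hh hE1
  have hsE : ∀ a ∈ E, ∀ b ∈ E, segment ℝ a b ⊆ E := fun a ha b hb => hEc.segment_subset ha hb
  have hz2C : (h ^ i) p ∉ segment ℝ p' p := c1 p (right_mem_segment ℝ _ _)
  obtain ⟨δ, ⟨t1, t2, t3⟩, hδ⟩ := ((((thin_open (seg_compact p' p) hE (hsE _ hp' _ hp)).and
    ((thin_pt (seg_compact p' p) hz2C).and (thin (seg_compact p' p) (seg_compact p' p) c1)))).and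
      self_mem_nhdsWithin).exists
  have hδ' : 0 < δ := hδ
  obtain ⟨τ, hτ, sC⟩ := slide' p' p hδ'
  have hne : p ≠ (h ^ i) p := by
    intro he; rw [← he] at hz2C; exact hz2C (right_mem_segment ℝ _ _)
  refine final_abs (k := h ^ i) (S0 := 1) (S1 := 1) (τ := τ) (N0 := ∅) (N1 := ∅) (z1 := p) (a := p)
    (z2 := (h ^ i) p) (hh.pow i) (hr.pow hi)
    (outer_closed h hE) (outer_preconn hh hE1) (fun x hx => Or.inr hx) hfix
    (orb_preconn h hEc.isPreconnected hx (hxy ▸ hy)) hGF (fun x hx => orb_app i hx)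
    isClosed_empty isClosed_empty (isClosed_cthickening (δ := δ) (E := segment ℝ p' p)) (by simp) (by simp) ?_
    (fun _ _ => rfl) (fun _ _ => rfl) sC t3 (by simp) (by simp) (by simp) (by simp) (by simp)
    (orb_self hp) (orb_self hp) (orb_app i (orb_self hp)) (by simp) (by simp) t2 hne rfl rfl ?_
  · rw [Set.disjoint_left]
    intro u hu hu2
    exact Set.disjoint_left.1 hGF (orb_self (t1 hu2)) hu
  · rw [← pow_add_app, ← two_mul, hpp, hτ]

theorem final_odd {h : ℂ ≃ₜ ℂ} (hh : IdOut h) (hr : Recu h) {i : ℕ} (hi : 0 < i) {E : Set ℂ}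
    (hE : IsOpen E) (hEc : Convex ℝ E) (hE1 : ∀ x ∈ E, ‖x‖ < 1)
    (hfix : ∀ w, (h ^ i) w = w → w ∈ Outer h E) {x y p p' : ℂ} (hx : x ∈ E) (hy : y ∈ E)
    (hp : p ∈ E) (hp' : p' ∈ E) (hxy : h x = y) (hpp : (h ^ (2 * i + 1)) p = p')
    (c1 : ∀ q ∈ segment ℝ p' p, (h ^ i) q ∉ segment ℝ p' p)
    (c2 : ∀ q ∈ segment ℝ p y, (h ^ i) q ∉ segment ℝ p' p)
    (c3 : ∀ q ∈ segment ℝ x p, (h ^ (i + 1)) q ∉ segment ℝ p' p)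
    (c4 : ∀ q ∈ segment ℝ p y, (h ^ i) q ∉ segment ℝ p y)
    (c5 : ∀ q ∈ segment ℝ x p, (h ^ i) q ∉ segment ℝ x p)
    (c6 : ∀ q ∈ segment ℝ x p, (h ^ (i + 1)) q ∉ segment ℝ p y) : False := by
  have hGF := orb_disj hh hE1
  have hsE : ∀ a ∈ E, ∀ b ∈ E, segment ℝ a b ⊆ E := fun a ha b hb => hEc.segment_subset ha hb
  have hz2C : (h ^ (i + 1)) p ∉ segment ℝ p' p := c3 p (right_mem_segment ℝ _ _)
  have hz20 : (h ^ (i + 1)) p ∉ segment ℝ p y := c6 p (right_mem_segment ℝ _ _)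
  have hz21 : (h ^ i) p ∉ segment ℝ x p := c5 p (right_mem_segment ℝ _ _)
  have K1 := seg_compact p' p
  have K2 := seg_compact p y
  have K3 := seg_compact x p
  obtain ⟨δ, ⟨t1, t2, t3, t4, t5, t6, t7, t8, t9, t10, t11, t12⟩, hδ⟩ :=
    ((((thin_open K1 hE (hsE _ hp' _ hp)).and <| (thin_open K2 hE (hsE _ hp _ hy)).and <|
      (thin_open K3 hE (hsE _ hx _ hp)).and <| (thin_pt K1 hz2C).and <| (thin_pt K2 hz20).and <|
      (thin_pt K3 hz21).and <| (thin K1 K1 c1).and <| (thin K2 K1 c2).and <| (thin K3 K1 c3).and <|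
      (thin K2 K2 c4).and <| (thin K3 K3 c5).and <| (thin K3 K2 c6))).and
      self_mem_nhdsWithin).exists
  have hδ' : 0 < δ := hδ
  obtain ⟨τ, hτ, sC⟩ := slide' p' p hδ'
  obtain ⟨S0, hS0, s0⟩ := slide' p y hδ'
  obtain ⟨S, hS, s1⟩ := slide' x p hδ'
  have hne : p ≠ (h ^ (i + 1)) p := by
    intro he; rw [← he] at hz2C; exact hz2C (right_mem_segment ℝ _ _)
  have hNm : ∀ q, q ∈ h '' cthickening δ (segment ℝ x p) →
      ∃ q' ∈ cthickening δ (segment ℝ x p), h q' = q := fun q hq => hq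
  refine final_abs (k := h ^ i) (S0 := S0) (S1 := h * (S * h⁻¹)) (τ := τ)
    (N0 := cthickening δ (segment ℝ p y)) (N1 := h '' cthickening δ (segment ℝ x p))
    (C := cthickening δ (segment ℝ p' p)) (F := Outer h E) (G := Orb h E) (z1 := p) (a := h p)
    (z2 := (h ^ (i + 1)) p) (hh.pow i) (hr.pow hi)
    (outer_closed h hE) (outer_preconn hh hE1) (fun x hx => Or.inr hx) hfix
    (orb_preconn h hEc.isPreconnected hx (hxy ▸ hy)) hGF (fun x hx => orb_app i hx)
    isClosed_cthickening (h.isClosedMap _ isClosed_cthickening) isClosed_cthickening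
    ?_ ?_ ?_ s0 ?_ sC t7 t8 ?_ t10 ?_ ?_
    (orb_self hp) (by simpa using orb_app 1 (orb_self hp)) (orb_app (i + 1) (orb_self hp)) t5 ?_ t4
    hne ?_ ?_ ?_
  · rw [Set.disjoint_left]
    intro u hu hu2
    exact Set.disjoint_left.1 hGF (orb_self (t2 hu2)) hu
  · rw [Set.disjoint_left]
    rintro u hu ⟨v, hv, rfl⟩
    exact Set.disjoint_left.1 hGF (by simpa using orb_app 1 (orb_self (t3 hv))) hu
  · rw [Set.disjoint_left]
    intro u hu hu2
    exact Set.disjoint_left.1 hGF (orb_self (t1 hu2)) hu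
  · intro u hu
    simp only [Homeomorph.mul_apply]
    rw [s1, mul_inv_app]
    intro hc
    exact hu ⟨_, hc, mul_inv_app h u⟩
  · rintro _ ⟨u, hu, rfl⟩
    rw [← pow_succ_app']
    exact t9 u hu
  · rintro _ ⟨u, hu, rfl⟩ ⟨v, hv, he⟩
    rw [← pow_succ_app', pow_succ_app] at he
    rw [h.injective he] at hv
    exact t11 u hu hv
  · rintro _ ⟨u, hu, rfl⟩
    rw [← pow_succ_app']
    exact t12 u hu
  · rintro ⟨v, hv, he⟩
    rw [pow_succ_app] at he
    rw [h.injective he] at hv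
    exact t6 hv
  · simp only [Homeomorph.mul_apply]
    rw [hS0, ← hxy, inv_mul_app, hS]
  · rw [← pow_succ_app']
  · rw [← pow_add_app, show i + (i + 1) = 2 * i + 1 by ring, hpp, hτ]

/-- the first contact of a ball with its image -/
theorem contact {h : ℂ ≃ₜ ℂ} (hh : IdOut h) {z : ℂ} (hz : h z ≠ z)
    (hfar : ∀ x, h x = x → ‖h z - z‖ < ‖x - z‖) :
    ∃ r > 0, ∃ x, dist x z = r ∧ dist (h x) z = r ∧ (∀ u ∈ ball z r, h u ∉ ball z r) ∧
      ∀ u ∈ closedBall z r, h u ≠ u := by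
  let m : ℂ → ℝ := fun u => max (dist u z) (dist (h u) z)
  have hm : Continuous m := by have := h.continuous; fun_prop
  obtain ⟨x, -, hxm⟩ := (isCompact_closedBall z (dist (h z) z)).exists_isMinOn
    ⟨z, by simp⟩ hm.continuousOn
  have hmin : ∀ u, m x ≤ m u := by
    intro u
    by_cases hu : u ∈ closedBall z (dist (h z) z)
    · exact hxm hu
    · have h1 : m x ≤ m z := hxm (mem_closedBall_self dist_nonneg)
      have h2 : m z = dist (h z) z := by simp [m]
      have h3 : dist (h z) z < dist u z := by simpa using hu
      exact h1.trans (h2.le.trans (h3.le.trans (le_max_left _ _)))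
  set r := m x with hr
  have hrle : r ≤ dist (h z) z := by
    have := hmin z
    simpa [m] using this
  have hnf : ∀ u ∈ closedBall z r, h u ≠ u := by
    intro u hu he
    have := hfar u he
    rw [← dist_eq_norm, ← dist_eq_norm] at this
    have h2 : dist u z ≤ r := hu
    linarith
  have hfree : ∀ u ∈ ball z r, h u ∉ ball z r := by
    intro u hu hu2
    have : m u < r := max_lt hu hu2
    exact absurd (hmin u) (not_le.2 this)
  have hr0 : 0 < r := by
    by_contra hc
    have h1 : dist x z ≤ 0 := (le_max_left _ _).trans (not_lt.1 hc)
    have h2 : dist (h x) z ≤ 0 := (le_max_right _ _).trans (not_lt.1 hc)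
    have h3 : x = z := dist_le_zero.1 h1
    have h4 : h x = z := dist_le_zero.1 h2
    rw [h3] at h4
    exact hz h4
  have hcl : ∀ u, dist u z ≤ r → u ∈ closure (ball z r) := by
    intro u hu
    rw [closure_ball z hr0.ne']; exact hu
  have h1 : dist x z ≤ r := le_max_left _ _
  have h2 : dist (h x) z ≤ r := le_max_right _ _
  refine ⟨r, hr0, x, ?_, ?_, hfree, hnf⟩
  · refine h1.lt_or_eq.resolve_left fun hlt => ?_
    -- `h` maps a neighborhood of `x` onto a neighborhood of `h x`
    have hO : IsOpen (h '' ball z r) := h.isOpenMap _ isOpen_ball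
    obtain ⟨v, hv, hvB⟩ := mem_closure_iff.1 (hcl _ h2) _ hO ⟨x, hlt, rfl⟩
    obtain ⟨u, hu, rfl⟩ := hv
    exact hfree u hu hvB
  · refine h2.lt_or_eq.resolve_left fun hlt => ?_
    have hO : IsOpen (h ⁻¹' ball z r) := isOpen_ball.preimage h.continuous
    obtain ⟨v, hv, hvB⟩ := mem_closure_iff.1 (hcl _ h1) _ hO hlt
    exact hfree v hvB hv

/-- the combinatorial structure of returns -/
structure Ret (h : ℂ ≃ₜ ℂ) (z : ℂ) (r : ℝ) (x y : ℂ) (j : ℕ) : Prop where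
  pos : 0 < r
  hxy : h x = y
  dx : dist x z = r
  dy : dist y z = r
  free : ∀ u ∈ ball z r, h u ∉ ball z r
  nf : ∀ u ∈ closedBall z r, h u ≠ u
  two : 2 ≤ j
  mini : ∀ m, 1 ≤ m → m < j → ∀ q, (q ∈ ball z r ∨ q = y) → ¬ ((h ^ m) q ∈ ball z r ∨ (h ^ m) q = y)

theorem ret_exists {h : ℂ ≃ₜ ℂ} (hr : Recu h) {z x : ℂ} {r : ℝ} (pos : 0 < r)
    (dx : dist x z = r) (dy : dist (h x) z = r) (free : ∀ u ∈ ball z r, h u ∉ ball z r)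
    (nf : ∀ u ∈ closedBall z r, h u ≠ u) :
    ∃ j, Ret h z r x (h x) j ∧ ((∃ p ∈ ball z r, (h ^ j) p ∈ ball z r) ∨ (h ^ j) (h x) = h x) := by
  have hcl : ∀ u, dist u z ≤ r → u ∈ closure (ball z r) := by
    intro u hu
    rw [closure_ball z pos.ne']; exact hu
  let P : ℕ → Prop := fun m => 1 ≤ m ∧ ∃ q, (q ∈ ball z r ∨ q = h x) ∧
    ((h ^ m) q ∈ ball z r ∨ (h ^ m) q = h x)
  have hP : ∃ m, P m := by
    obtain ⟨n, hn, hd⟩ := hr r pos 1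
    refine ⟨n, hn, z, Or.inl (mem_ball_self pos), Or.inl ?_⟩
    rw [mem_ball, dist_eq_norm]
    exact hd z
  classical
  let j := Nat.find hP
  have hj : P j := Nat.find_spec hP
  have hmin : ∀ m, m < j → ¬ P m := fun m hm => Nat.find_min hP hm
  refine ⟨j, ⟨pos, rfl, dx, dy, free, nf, ?_, ?_⟩, ?_⟩
  · obtain ⟨h1, q, hq, hq'⟩ := hj
    by_contra hc
    have hj1 : j = 1 := by omega
    rw [hj1, pow_one] at hq'
    rcases hq with hq | rfl
    · rcases hq' with hq' | hq'
      · exact free q hq hq'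
      · have := h.injective hq'
        rw [this] at hq
        exact absurd dx (ne_of_lt hq)
    · rcases hq' with hq' | hq'
      · obtain ⟨v, hv, hvB⟩ := mem_closure_iff.1 (hcl _ dy.le) _
          (isOpen_ball.preimage h.continuous) hq'
        exact free v hvB hv
      · exact nf _ (by rw [mem_closedBall]; exact dy.le) hq'
  · intro m hm1 hmj q hq hc
    exact hmin m hmj ⟨hm1, q, hq, hc⟩
  · obtain ⟨h1, q, hq, hq'⟩ := hj
    rcases hq with hq | rfl
    · rcases hq' with hq' | hq'
      · exact Or.inl ⟨q, hq, hq'⟩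
      · obtain ⟨v, ⟨u, hu, rfl⟩, hvB⟩ := mem_closure_iff.1 (hcl _ dy.le) _
          ((h ^ j).isOpenMap _ isOpen_ball) ⟨q, hq, hq'⟩
        exact Or.inl ⟨u, hu, hvB⟩
    · rcases hq' with hq' | hq'
      · obtain ⟨v, hv, hvB⟩ := mem_closure_iff.1 (hcl _ dy.le) _
          (isOpen_ball.preimage (h ^ j).continuous) hq'
        exact Or.inl ⟨v, hvB, hv⟩
      · exact Or.inr hq'

namespace Ret
variable {h : ℂ ≃ₜ ℂ} {z x y : ℂ} {r : ℝ} {j : ℕ}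

theorem ne (R : Ret h z r x y j) : x ≠ y := by
  intro he
  exact R.nf x (by rw [mem_closedBall]; exact R.dx.le) (R.hxy.trans he.symm)

theorem nx (R : Ret h z r x y j) : x ∉ ball z r := by
  rw [mem_ball, R.dx]; exact lt_irrefl _

theorem ny (R : Ret h z r x y j) : y ∉ ball z r := by
  rw [mem_ball, R.dy]; exact lt_irrefl _

theorem D1 (R : Ret h z r x y j) {i : ℕ} (hi : 0 < i) (hij : i < j) (hi2 : i + 1 < j ∨ i = 1)
    {q : ℂ} (hq : q ∈ ball z r ∨ q = x ∨ q = y)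
    (hq' : (h ^ i) q ∈ ball z r ∨ (h ^ i) q = x ∨ (h ^ i) q = y) :
    i = 1 ∧ (q = x ∨ q = y) ∧ (h q = x ∨ h q = y) := by
  have hstar : ∀ q, (q ∈ ball z r ∨ q = y) →
      ((h ^ i) q ∈ ball z r ∨ (h ^ i) q = x ∨ (h ^ i) q = y) → (h ^ i) q = x := by
    intro q hq hq'
    have := R.mini i hi hij q hq
    tauto
  by_cases hqx : q = x
  · subst hqx
    have hi1 : i = 1 := by
      by_contra hne
      obtain ⟨l, rfl⟩ : ∃ l, i = l + 1 := ⟨i - 1, by omega⟩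
      rw [pow_succ_app', R.hxy] at hq'
      have := R.mini l (by omega) (by omega) y (Or.inr rfl)
      have h3 : (h ^ l) y = q := by tauto
      have h4 := R.mini (l + 1) (by omega) (by omega) y (Or.inr rfl)
      rw [pow_succ_app, h3, R.hxy] at h4
      exact h4 (Or.inr rfl)
    exact ⟨hi1, Or.inl rfl, Or.inr R.hxy⟩
  · have hqs : q ∈ ball z r ∨ q = y := by tauto
    have hx := hstar q hqs hq'
    have h1 : ¬ i + 1 < j := by
      intro hlt
      apply R.mini (i + 1) (by omega) hlt q hqs
      rw [pow_succ_app, hx, R.hxy]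
      exact Or.inr rfl
    have hi1 : i = 1 := by tauto
    subst hi1
    rw [pow_one] at hx
    refine ⟨rfl, ?_, Or.inl hx⟩
    rcases hqs with hq | hq
    · exfalso
      have hcl : x ∈ closure (ball z r) := by
        rw [closure_ball z R.pos.ne', mem_closedBall]; exact R.dx.le
      obtain ⟨v, ⟨u, hu, rfl⟩, hvB⟩ := mem_closure_iff.1 hcl _
          (h.isOpenMap _ isOpen_ball) ⟨q, hq, hx⟩
      exact R.free u hu hvB
    · exact Or.inr hq

theorem convS (R : Ret h z r x y j) (T : Set ℂ) (hT : ∀ q ∈ T, dist q z = r) :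
    Convex ℝ (ball z r ∪ T) := by
  intro a ha b hb s t hs ht hst
  by_cases hab : a = b
  · subst hab
    rw [← add_smul, hst, one_smul]; exact ha
  rcases hs.eq_or_lt with rfl | hs
  · rw [zero_add] at hst; subst hst; simpa using hb
  rcases ht.eq_or_lt with rfl | ht
  · rw [add_zero] at hst; subst hst; simpa using ha
  have hle : ∀ a ∈ ball z r ∪ T, a ∈ closedBall z r := by
    rintro a (ha | ha)
    · exact ball_subset_closedBall ha
    · rw [mem_closedBall]; exact (hT a ha).le
  left
  have := strictConvex_closedBall ℝ z r (hle a ha) (hle b hb) hab hs ht hst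
  rwa [interior_closedBall z R.pos.ne'] at this

theorem extr {a b q : ℂ} (ha : a ∈ closedBall z r) (hb : b ∈ closedBall z r) (hr : 0 < r)
    (hq : q ∈ segment ℝ a b) (hqr : dist q z = r) : q = a ∨ q = b := by
  by_contra hc
  push Not at hc
  have hab : a ≠ b := by
    rintro rfl
    rw [segment_same] at hq
    exact hc.1 hq
  obtain ⟨s, t, hs, ht, hst, rfl⟩ := hq
  rcases hs.eq_or_lt with rfl | hs
  · rw [zero_add] at hst; subst hst; simp at hc
  rcases ht.eq_or_lt with rfl | ht
  · rw [add_zero] at hst; subst hst; simp at hc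
  have := strictConvex_closedBall ℝ z r ha hb hab hs ht hst
  rw [interior_closedBall z hr.ne'] at this
  exact absurd hqr (ne_of_lt this)

end Ret

namespace Ret
variable {h : ℂ ≃ₜ ℂ} {z x y : ℂ} {r : ℝ} {j : ℕ}

theorem eps (R : Ret h z r x y j) (hh : IdOut h) (hr : Recu h) {i : ℕ} (hi : 0 < i) (hij : i < j)
    (hi2 : i + 1 < j ∨ i = 1) {Q : Set ℂ} (hQ : IsCompact Q) (hQc : Convex ℝ Q)
    (hQs : Q ⊆ ball z r ∪ {x, y}) (hx : x ∈ Q) :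
    ∃ ε > 0, (∀ u ∈ thickening ε Q, ‖u‖ < 1) ∧
      ∀ w, (h ^ i) w = w → w ∈ Outer h (thickening ε Q) := by
  have D1 : ∀ q ∈ Q, (h ^ i) q ∈ Q → i = 1 ∧ (q = x ∨ q = y) ∧ (h q = x ∨ h q = y) :=
    fun q hq hq' => R.D1 hi hij hi2 (hQs hq) (hQs hq')
  have hQb : Q ⊆ closedBall z r := by
    intro q hq
    rcases hQs hq with h1 | rfl | rfl
    · exact ball_subset_closedBall h1
    · rw [mem_closedBall]; exact R.dx.le
    · rw [mem_closedBall]; exact R.dy.le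
  refine exists_eps hh hr hi hQ hQc hx R.hxy D1 ?_ ?_
  · intro q hq he
    have h1 := D1 q hq (by rw [he]; exact hq)
    obtain ⟨rfl, -⟩ := h1
    rw [pow_one] at he
    exact R.nf q (hQb hq) he
  · intro a ha b hb h1 h2
    have h1' := extr (hQb ha) (hQb hb) R.pos h1 R.dx
    have h2' := extr (hQb ha) (hQb hb) R.pos h2 R.dy
    have := R.ne
    rcases h1' with h1' | h1' <;> rcases h2' with h2' | h2'
    · exact absurd (h1'.trans h2'.symm) this
    · exact Or.inl ⟨h1'.symm, h2'.symm⟩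
    · exact Or.inr ⟨h2'.symm, h1'.symm⟩
    · exact absurd (h1'.trans h2'.symm) this

theorem close (R : Ret h z r x y j) (hh : IdOut h) (hr : Recu h) {i : ℕ} (hi : 0 < i)
    (hij : j = 2 * i ∨ j = 2 * i + 1) {E : Set ℂ}
    (hE : IsOpen E) (hEc : Convex ℝ E) (hE1 : ∀ x ∈ E, ‖x‖ < 1)
    (hfix : ∀ w, (h ^ i) w = w → w ∈ Outer h E) {p p' : ℂ} (hx : x ∈ E) (hy : y ∈ E)
    (hp : p ∈ E) (hp' : p' ∈ E) (hpp : (h ^ j) p = p') (hpB : p ∈ ball z r)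
    (c1 : ∀ q ∈ segment ℝ p' p, (h ^ i) q ∉ segment ℝ p' p)
    (c2 : ∀ q ∈ segment ℝ p y, (h ^ i) q ∉ segment ℝ p' p)
    (c3 : i + 1 < j → ∀ q ∈ segment ℝ x p, (h ^ (i + 1)) q ∉ segment ℝ p' p) : False := by
  rcases hij with rfl | rfl
  · exact final_even hh hr hi hE hEc hE1 hfix hx hy hp hp' R.hxy hpp c1
  · have s1 : segment ℝ p y ⊆ ball z r ∪ {y} :=
      (R.convS {y} (by rintro q rfl; exact R.dy)).segment_subset (Or.inl hpB) (Or.inr rfl)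
    have s2 : segment ℝ x p ⊆ ball z r ∪ {x} :=
      (R.convS {x} (by rintro q rfl; exact R.dx)).segment_subset (Or.inr rfl) (Or.inl hpB)
    refine final_odd hh hr hi hE hEc hE1 hfix hx hy hp hp' R.hxy hpp c1 c2 (c3 (by omega)) ?_ ?_ ?_
    · intro q hq hq'
      exact R.mini i hi (by omega) q (s1 hq) (s1 hq')
    · intro q hq hq'
      have h1 := s2 hq
      have h2 := s2 hq'
      obtain ⟨rfl, h3, h4⟩ := R.D1 hi (by omega) (Or.inl (by omega)) (q := q)
        (by rcases h1 with h1 | h1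
            · exact Or.inl h1
            · exact Or.inr (Or.inl h1))
        (by rcases h2 with h2 | h2
            · exact Or.inl h2
            · exact Or.inr (Or.inl h2))
      rw [pow_one] at h2
      have hyn : ∀ {u}, u ∈ ball z r ∪ {x} → u ≠ y := by
        rintro u (hu | hu) he
        · rw [he] at hu; exact R.ny hu
        · exact R.ne (hu.symm.trans he)
      have h5 := h3.resolve_right (hyn h1)
      have h6 := h4.resolve_right (hyn h2)
      rw [h5, R.hxy] at h6
      exact R.ne h6.symm
    · intro q hq hq'
      have h2 := s1 hq'
      rcases s2 hq with h1 | h1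
      · exact R.mini (i + 1) (by omega) (by omega) q (Or.inl h1) h2
      · have h1' : q = x := h1
        rw [h1', pow_succ_app', R.hxy] at h2
        exact R.mini i (by omega) (by omega) y (Or.inr rfl) h2

theorem caseI (R : Ret h z r x y j) (hh : IdOut h) (hr : Recu h) {p : ℂ} (hpB : p ∈ ball z r)
    (hpB' : (h ^ j) p ∈ ball z r) : False := by
  obtain ⟨i, hi⟩ : ∃ i, i = j / 2 := ⟨_, rfl⟩
  have h2 := R.two
  let V : Set ℂ := {x, y, p, (h ^ j) p}
  have hVf : V.Finite := by simp [V]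
  have hVs : V ⊆ ball z r ∪ {x, y} := by
    rintro q (rfl | rfl | rfl | rfl)
    · right; simp
    · right; simp
    · left; exact hpB
    · left; exact hpB'
  have hQs : convexHull ℝ V ⊆ ball z r ∪ {x, y} := convexHull_min hVs
    (R.convS _ (by rintro q (rfl | rfl); exacts [R.dx, R.dy]))
  have hsub : V ⊆ convexHull ℝ V := subset_convexHull ℝ V
  obtain ⟨ε, hε, hE1, hfix⟩ := R.eps hh hr (i := i) (by omega) (by omega) (by omega)
    (hVf.isCompact_convexHull ℝ) (convex_convexHull ℝ V) hQs (hsub (by simp [V]))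
  have hE : ∀ q ∈ V, q ∈ thickening ε (convexHull ℝ V) := fun q hq =>
    self_subset_thickening hε _ (hsub hq)
  have sB : segment ℝ ((h ^ j) p) p ⊆ ball z r := (convex_ball z r).segment_subset hpB' hpB
  have s1 : segment ℝ p y ⊆ ball z r ∪ {y} :=
    (R.convS {y} (by rintro q rfl; exact R.dy)).segment_subset (Or.inl hpB) (Or.inr rfl)
  have s2 : segment ℝ x p ⊆ ball z r ∪ {x} :=
    (R.convS {x} (by rintro q rfl; exact R.dx)).segment_subset (Or.inr rfl) (Or.inl hpB)
  refine R.close hh hr (i := i) (by omega) (by omega) isOpen_thickening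
    ((convex_convexHull ℝ V).thickening ε) hE1 hfix (hE x (by simp [V])) (hE y (by simp [V]))
    (hE p (by simp [V])) (hE _ (by simp [V])) rfl hpB ?_ ?_ ?_
  · intro q hq hq'
    exact R.mini i (by omega) (by omega) q (Or.inl (sB hq)) (Or.inl (sB hq'))
  · intro q hq hq'
    exact R.mini i (by omega) (by omega) q (s1 hq) (Or.inl (sB hq'))
  · intro hij q hq hq'
    have h3 := sB hq'
    rcases s2 hq with h1 | h1
    · exact R.mini (i + 1) (by omega) (by omega) q (Or.inl h1) (Or.inl h3)
    · have h1' : q = x := h1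
      rw [h1', pow_succ_app', R.hxy] at h3
      exact R.mini i (by omega) (by omega) y (Or.inr rfl) (Or.inl h3)

theorem caseII (R : Ret h z r x y j) (hh : IdOut h) (hr : Recu h) (hjy : (h ^ j) y = y) : False := by
  obtain ⟨i, hi⟩ : ∃ i, i = j / 2 := ⟨_, rfl⟩
  have h2 := R.two
  have hQs : segment ℝ x y ⊆ ball z r ∪ {x, y} :=
    (R.convS _ (by rintro q (rfl | rfl); exacts [R.dx, R.dy])).segment_subset
      (Or.inr (by simp)) (Or.inr (by simp))
  obtain ⟨ε, hε, hE1, hfix⟩ := R.eps hh hr (i := i) (by omega) (by omega) (by omega)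
    (seg_compact x y) (convex_segment x y) hQs (left_mem_segment ℝ x y)
  have hiy : (h ^ i) y ≠ y := by
    intro he
    exact R.mini i (by omega) (by omega) y (Or.inr rfl) (Or.inr he)
  -- a small ball around `y`
  have hKc : IsClosed ((h ^ (i + 1)) '' segment ℝ x y) :=
    ((seg_compact x y).image (h ^ (i + 1)).continuous).isClosed
  have hKy : i + 1 < j → y ∉ (h ^ (i + 1)) '' segment ℝ x y := by
    rintro hij ⟨q, hq, he⟩
    rcases hQs hq with h1 | rfl | rfl
    · exact R.mini (i + 1) (by omega) hij q (Or.inl h1) (Or.inr he)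
    · rw [pow_succ_app', R.hxy] at he
      exact hiy he
    · exact R.mini (i + 1) (by omega) hij q (Or.inr rfl) (Or.inr he)
  have hW : ∃ ρ > 0, ρ ≤ ε ∧ (∀ q ∈ ball y ρ, (h ^ i) q ∉ ball y ρ) ∧
      (i + 1 < j → ∀ q ∈ ball y ρ, q ∉ (h ^ (i + 1)) '' segment ℝ x y) := by
    have hd : 0 < dist ((h ^ i) y) y / 2 := half_pos (dist_pos.2 hiy)
    obtain ⟨ρ1, hρ1, hb1⟩ := Metric.continuousAt_iff.1
      ((h ^ i).continuous.continuousAt (x := y)) _ hd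
    obtain ⟨ρ2, hρ2, hb2⟩ : ∃ ρ > 0, i + 1 < j →
        ∀ q ∈ ball y ρ, q ∉ (h ^ (i + 1)) '' segment ℝ x y := by
      by_cases hij : i + 1 < j
      · obtain ⟨ρ, hρ, hb⟩ := Metric.isOpen_iff.1 hKc.isOpen_compl y (hKy hij)
        exact ⟨ρ, hρ, fun _ q hq => hb hq⟩
      · exact ⟨1, one_pos, fun h => absurd h hij⟩
    refine ⟨min (min ε (dist ((h ^ i) y) y / 2)) (min ρ1 ρ2), by positivity,
      (min_le_left _ _).trans (min_le_left _ _), ?_, ?_⟩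
    · intro q hq hq'
      have h1 := hb1 ((mem_ball.1 hq).trans_le ((min_le_right _ _).trans (min_le_left _ _)))
      have h3 := (mem_ball.1 hq').trans_le ((min_le_left _ _).trans (min_le_right _ _))
      have h4 := dist_triangle_left ((h ^ i) y) y ((h ^ i) q)
      linarith
    · intro hij q hq
      exact hb2 hij q (ball_subset_ball ((min_le_right _ _).trans (min_le_right _ _)) hq)
  obtain ⟨ρ, hρ, hρε, hW1, hW2⟩ := hW
  -- choose `p` close to `y` on the segment
  obtain ⟨p, hpB, hps, hpρ, hp'ρ⟩ : ∃ p, p ∈ ball z r ∧ p ∈ segment ℝ x y ∧ p ∈ ball y ρ ∧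
      (h ^ j) p ∈ ball y ρ := by
    have hc : Continuous (fun t : ℝ => AffineMap.lineMap y x t : ℝ → ℂ) :=
      AffineMap.lineMap_continuous
    have e1 : ∀ᶠ t in 𝓝 (0:ℝ), (AffineMap.lineMap y x t : ℂ) ∈ ball y ρ :=
      hc.continuousAt.eventually_mem (isOpen_ball.mem_nhds (by simp [hρ]))
    have e2 : ∀ᶠ t in 𝓝 (0:ℝ), (h ^ j) (AffineMap.lineMap y x t : ℂ) ∈ ball y ρ :=
      ((h ^ j).continuous.comp hc).continuousAt.eventually_mem
        (isOpen_ball.mem_nhds (by simp [hρ, hjy]))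
    obtain ⟨t, ⟨h3, h4⟩, ht0, ht1⟩ := (((e1.and e2).filter_mono nhdsWithin_le_nhds).and
      (Ioo_mem_nhdsGT (one_pos (α := ℝ)))).exists
    have hs : (AffineMap.lineMap y x t : ℂ) ∈ segment ℝ x y := by
      rw [segment_symm, segment_eq_image_lineMap]
      exact ⟨t, ⟨ht0.le, ht1.le⟩, rfl⟩
    refine ⟨_, ?_, hs, h3, h4⟩
    rcases hQs hs with h5 | h5 | h5
    · exact h5
    · exfalso
      rw [AffineMap.lineMap_eq_right_iff] at h5
      rcases h5 with h5 | h5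
      · exact R.ne h5.symm
      · linarith
    · exfalso
      have h5' : (AffineMap.lineMap y x t : ℂ) = y := h5
      rw [AffineMap.lineMap_eq_left_iff] at h5'
      rcases h5' with h5 | h5
      · exact R.ne h5.symm
      · linarith
  have sρ : segment ℝ ((h ^ j) p) p ⊆ ball y ρ := (convex_ball y ρ).segment_subset hp'ρ hpρ
  have sρ' : segment ℝ p y ⊆ ball y ρ := (convex_ball y ρ).segment_subset hpρ (mem_ball_self hρ)
  have sxp : segment ℝ x p ⊆ segment ℝ x y :=
    (convex_segment x y).segment_subset (left_mem_segment ℝ x y) hps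
  have hE : ∀ q ∈ segment ℝ x y, q ∈ thickening ε (segment ℝ x y) := fun q hq =>
    self_subset_thickening hε _ hq
  refine R.close hh hr (i := i) (by omega) (by omega) isOpen_thickening
    ((convex_segment x y).thickening ε) hE1 hfix (hE x (left_mem_segment ℝ x y))
    (hE y (right_mem_segment ℝ x y)) (hE p hps) ?_ rfl hpB ?_ ?_ ?_
  · rw [mem_thickening_iff]
    exact ⟨y, right_mem_segment ℝ x y, (mem_ball.1 hp'ρ).trans_le hρε⟩
  · intro q hq hq'
    exact hW1 q (sρ hq) (sρ hq')
  · intro q hq hq'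
    exact hW1 q (sρ' hq) (sρ hq')
  · intro hij q hq hq'
    exact hW2 hij _ (sρ hq') ⟨q, sxp hq, rfl⟩

end Ret

theorem main_id {h : ℂ ≃ₜ ℂ} (hh : IdOut h) (hr : Recu h) (z : ℂ) : h z = z := by
  by_contra hz
  obtain ⟨g, hg, hgr, hgz, hfar⟩ := reduce hh hr hz
  obtain ⟨r, hr0, x, dx, dy, free, nf⟩ := contact hg hgz hfar
  obtain ⟨j, R, hc⟩ := ret_exists hgr hr0 dx dy free nf
  rcases hc with ⟨p, hp, hp'⟩ | hc
  · exact R.caseI hg hgr hp hp'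
  · exact R.caseII hg hgr hc

theorem rec_sq {f : Disc2 ≃ₜ Disc2} (hrec : IsRecurrent (f : Disc2 → Disc2)) :
    ∀ ε > 0, ∀ N : ℕ, ∃ n ≥ N, ∀ x : Disc2, dist ((fun x => f (f x))^[n] x) x < ε := by
  intro ε hε N
  obtain ⟨n, hn, hd⟩ := hrec
  obtain ⟨k, h1, h2⟩ := ((hd (ε / 2) (half_pos hε)).and (hn.eventually_ge_atTop N)).exists
  refine ⟨n k, h2, fun x => ?_⟩
  have he : (fun x => f (f x))^[n k] x = f^[n k] (f^[n k] x) := by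
    have : (fun x => f (f x)) = f^[2] := rfl
    rw [this, ← Function.iterate_mul, two_mul, Function.iterate_add_apply]
  rw [he]
  have a := h1 x
  have b := h1 (f^[n k] x)
  calc _ ≤ _ := dist_triangle _ (f^[n k] x) x
    _ < ε / 2 + ε / 2 := add_lt_add b a
    _ = ε := by ring

theorem circlePt_mem (t : ℝ) : circlePt t ∈ Disc2 := by
  rw [mem_closedBall, dist_zero_right, EuclideanSpace.norm_eq, Real.sqrt_le_one]
  simp [circlePt, Fin.sum_univ_two]

theorem circlePt_cont : Continuous circlePt := by
  unfold circlePt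
  refine (EuclideanSpace.equiv (Fin 2) ℝ).symm.continuous.comp ?_
  refine continuous_pi fun i => ?_
  fin_cases i
  · simp only [Fin.zero_eta, Matrix.cons_val_zero]; fun_prop
  · simp only [Fin.mk_one, Matrix.cons_val_one]; fun_prop

theorem circlePt_inj {s t : ℝ} (h : circlePt s = circlePt t) : ∃ n : ℤ, s = t + n := by
  have h0 : Real.cos (2 * Real.pi * s) = Real.cos (2 * Real.pi * t) := by
    have := congrArg (fun v : EuclideanSpace ℝ (Fin 2) => v 0) h
    simpa [circlePt] using this
  have h1 : Real.sin (2 * Real.pi * s) = Real.sin (2 * Real.pi * t) := by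
    have := congrArg (fun v : EuclideanSpace ℝ (Fin 2) => v 1) h
    simpa [circlePt] using this
  have h2 : Real.cos (2 * Real.pi * s - 2 * Real.pi * t) = 1 := by
    rw [Real.cos_sub, h0, h1]
    nlinarith [Real.sin_sq_add_cos_sq (2 * Real.pi * t)]
  obtain ⟨n, hn⟩ := (Real.cos_eq_one_iff _).1 h2
  refine ⟨n, ?_⟩
  have := Real.pi_pos
  have h3 : (2 * Real.pi) * (s - t - n) = 0 := by linarith
  have h4 := (mul_eq_zero.1 h3).resolve_left (by positivity)
  linarith

theorem circlePt_add_int (t : ℝ) (n : ℤ) : circlePt (t + n) = circlePt t := by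
  unfold circlePt
  have : 2 * Real.pi * (t + n) = 2 * Real.pi * t + n * (2 * Real.pi) := by ring
  rw [this, Real.cos_add_int_mul_two_pi, Real.sin_add_int_mul_two_pi]

theorem circlePt_surj {v : EuclideanSpace ℝ (Fin 2)} (hv : ‖v‖ = 1) : ∃ t, v = circlePt t := by
  have h1 : v 0 ^ 2 + v 1 ^ 2 = 1 := by
    have := EuclideanSpace.norm_sq_eq v
    rw [hv] at this
    simpa [Fin.sum_univ_two] using this.symm
  let w : ℂ := ⟨v 0, v 1⟩
  have hw : ‖w‖ = 1 := by
    have : ‖w‖ ^ 2 = 1 := by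
      rw [← Complex.normSq_eq_norm_sq, Complex.normSq_apply]
      simp only [w]; linarith
    have h0 := norm_nonneg w
    nlinarith
  refine ⟨Complex.arg w / (2 * Real.pi), ?_⟩
  have hpi := Real.pi_pos.ne'
  have e1 : 2 * Real.pi * (Complex.arg w / (2 * Real.pi)) = Complex.arg w := by field_simp
  have hw0 : w ≠ 0 := by rintro h; rw [h] at hw; simp at hw
  ext i
  unfold circlePt
  rw [e1]
  fin_cases i
  · simp [Complex.cos_arg hw0, hw, w]
  · simp [Complex.sin_arg, hw, w]

theorem circle_fix {f : Disc2 ≃ₜ Disc2} (hrec : IsRecurrent (f : Disc2 → Disc2))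
    (hor : DiscOrientationReversing f) (t : ℝ) :
    f (f ⟨circlePt t, circlePt_mem t⟩) = ⟨circlePt t, circlePt_mem t⟩ := by
  obtain ⟨F, hF, hF1, hfF⟩ := hor
  -- the cut point
  have hne : {t | t ≤ F t}.Nonempty := by
    by_contra hc
    rw [Set.not_nonempty_iff_eq_empty] at hc
    have h1 : min 0 (F 0) ∈ {t | t ≤ F t} :=
      (min_le_right _ _).trans (hF.antitone (min_le_left _ _))
    rw [hc] at h1
    exact h1
  have hbd : BddAbove {t | t ≤ F t} := by
    refine ⟨max 0 (F 0), fun s hs => ?_⟩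
    by_contra hc
    have h1 : max 0 (F 0) < s := not_le.1 hc
    have h2 : F s < F 0 := hF ((le_max_left _ _).trans_lt h1)
    have h3 : s ≤ F s := hs
    have := le_max_right 0 (F 0)
    linarith
  obtain ⟨c, hc⟩ := Real.exists_isLUB hne hbd
  have hlt' : ∀ s, s < c → s ≤ F s := by
    intro s hs
    obtain ⟨b, hb, hsb, -⟩ := hc.exists_between hs
    have h1 : b ≤ F b := hb
    exact (hsb.le.trans h1).trans (hF.antitone hsb.le)
  have hgt' : ∀ s, c < s → F s < s := by
    intro s hs
    by_contra hcc
    exact absurd (hc.1 (show s ∈ {t | t ≤ F t} from not_lt.1 hcc)) (not_le.2 hs)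
  have hlt : ∀ s, s < c → c < F s := by
    intro s hs
    obtain ⟨s', h1, h2⟩ := exists_between hs
    refine lt_of_le_of_lt ?_ (hF h1)
    refine le_of_forall_lt_imp_le_of_dense fun a ha => ?_
    rcases le_or_gt a s' with h3 | h3
    · exact h3.trans (hlt' s' h2)
    · exact (hlt' a ha).trans (hF.antitone h3.le)
  have hgt : ∀ s, c < s → F s < c := by
    intro s hs
    obtain ⟨s', h1, h2⟩ := exists_between hs
    refine lt_of_lt_of_le (hF h2) ?_
    refine le_of_forall_gt_imp_ge_of_dense fun a ha => ?_
    rcases le_or_gt a s' with h3 | h3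
    · exact (hF.antitone h3).trans (hgt' a ha).le
    · exact (hgt' s' h1).le.trans h3.le
  let G : ℝ → ℝ := fun t => F (F t)
  have hG : StrictMono G := hF.comp hF
  have hG1 : ∀ t, G (t + 1) = G t + 1 := by
    intro t
    have := hF1 (F t - 1)
    simp only [G]
    rw [hF1]
    rw [sub_add_cancel] at this
    linarith
  have hGc : ∀ s, c < s → c < G s := fun s hs => hlt _ (hgt s hs)
  have hGc' : ∀ s, s < c → G s < c := fun s hs => hgt _ (hlt s hs)
  have hGI : ∀ s, s ∈ Set.Ioo c (c + 1) → G s ∈ Set.Ioo c (c + 1) := by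
    intro s hs
    refine ⟨hGc s hs.1, ?_⟩
    have h1 := hGc' (s - 1) (by linarith [hs.2])
    have h2 := hG1 (s - 1)
    rw [sub_add_cancel] at h2
    linarith
  have hGn : ∀ s, s ∈ Set.Ioo c (c + 1) → ∀ n, G^[n] s ∈ Set.Ioo c (c + 1) := by
    intro s hs n
    induction n with
    | zero => exact hs
    | succ n ih => rw [Function.iterate_succ_apply']; exact hGI _ ih
  have hgG : ∀ t, f (f ⟨circlePt t, circlePt_mem t⟩) = ⟨circlePt (G t), circlePt_mem _⟩ := by
    intro t
    have h1 : f ⟨circlePt t, circlePt_mem t⟩ = ⟨circlePt (F t), circlePt_mem _⟩ :=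
      Subtype.ext (hfF t _)
    rw [h1]
    exact Subtype.ext (hfF (F t) _)
  have hgGn : ∀ (n : ℕ) t, (fun x => f (f x))^[n] ⟨circlePt t, circlePt_mem t⟩ =
      ⟨circlePt (G^[n] t), circlePt_mem _⟩ := by
    intro n
    induction n with
    | zero => intro t; rfl
    | succ n ih =>
      intro t
      rw [Function.iterate_succ_apply, hgG, ih]
      rfl
  -- points of the open arc
  have hno : ∀ s ∈ Set.Ioo c (c + 1), ∀ J : Set ℝ, IsCompact J →
      (∀ a ∈ J, ∀ n : ℤ, a ≠ s + n) → (∀ n ≥ 1, G^[n] s ∈ J) → False := by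
    intro s hs J hJ hJn hJG
    have hnot : circlePt s ∉ circlePt '' J := by
      rintro ⟨a, ha, he⟩
      obtain ⟨n, hn⟩ := circlePt_inj he
      exact hJn a ha n hn
    obtain ⟨ε, hε, hb⟩ := Metric.isOpen_iff.1 (hJ.image circlePt_cont).isClosed.isOpen_compl _ hnot
    obtain ⟨n, hn, hd⟩ := rec_sq hrec ε hε 1
    have := hd ⟨circlePt s, circlePt_mem s⟩
    rw [hgGn] at this
    exact hb this ⟨_, hJG n hn, rfl⟩
  have harc : ∀ s ∈ Set.Ioo c (c + 1), G s = s := by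
    intro s hs
    rcases lt_trichotomy (G s) s with h | h | h
    · exfalso
      refine hno s hs (Set.Icc c (G s)) isCompact_Icc ?_ ?_
      · rintro a ⟨ha1, ha2⟩ n rfl
        have h1 : (n:ℝ) < 0 := by linarith
        have h2 : (-1:ℝ) < n := by linarith [hs.2]
        have h1' : n < 0 := by exact_mod_cast h1
        have h2' : -1 < n := by exact_mod_cast h2
        omega
      · intro n hn
        refine ⟨(hGn s hs n).1.le, ?_⟩
        obtain ⟨m, rfl⟩ : ∃ m, n = m + 1 := ⟨n - 1, by omega⟩
        clear hn
        induction m with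
        | zero => simp
        | succ m ih =>
          rw [Function.iterate_succ_apply']
          exact (hG.monotone (ih.trans h.le))
    · exact h
    · exfalso
      refine hno s hs (Set.Icc (G s) (c + 1)) isCompact_Icc ?_ ?_
      · rintro a ⟨ha1, ha2⟩ n rfl
        have h1 : (n:ℝ) < 1 := by linarith [hs.1]
        have h2 : (0:ℝ) < n := by linarith
        have h1' : n < 1 := by exact_mod_cast h1
        have h2' : 0 < n := by exact_mod_cast h2
        omega
      · intro n hn
        refine ⟨?_, (hGn s hs n).2.le⟩
        obtain ⟨m, rfl⟩ : ∃ m, n = m + 1 := ⟨n - 1, by omega⟩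
        clear hn
        induction m with
        | zero => simp
        | succ m ih =>
          rw [Function.iterate_succ_apply']
          exact (hG.monotone (h.le.trans ih))
  -- closure
  have hcl : IsClosed {s : ℝ | f (f ⟨circlePt s, circlePt_mem s⟩) = ⟨circlePt s, circlePt_mem s⟩} := by
    have hcc : Continuous (fun s : ℝ => (⟨circlePt s, circlePt_mem s⟩ : Disc2)) :=
      circlePt_cont.subtype_mk _
    exact isClosed_eq (f.continuous.comp (f.continuous.comp hcc)) hcc
  have hsub : Set.Icc c (c + 1) ⊆
      {s : ℝ | f (f ⟨circlePt s, circlePt_mem s⟩) = ⟨circlePt s, circlePt_mem s⟩} := by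
    rw [← closure_Ioo (by linarith : c ≠ c + 1)]
    refine closure_minimal (fun s hs => ?_) hcl
    change f (f _) = _
    rw [hgG]
    exact Subtype.ext (by rw [harc s hs])
  have h1 : c + Int.fract (t - c) ∈ Set.Icc c (c + 1) :=
    ⟨by linarith [Int.fract_nonneg (t - c)], by linarith [Int.fract_lt_one (t - c)]⟩
  have h2 := hsub h1
  have h3 : circlePt (c + Int.fract (t - c)) = circlePt t := by
    have : t = c + Int.fract (t - c) + ⌊t - c⌋ := by
      have := Int.floor_add_fract (t - c)
      linarith
    conv_rhs => rw [this]
    rw [circlePt_add_int]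
  have h4 : (⟨circlePt (c + Int.fract (t - c)), circlePt_mem _⟩ : Disc2) =
    ⟨circlePt t, circlePt_mem t⟩ := Subtype.ext h3
  have h5 : f (f ⟨circlePt (c + Int.fract (t - c)), circlePt_mem _⟩) =
    ⟨circlePt (c + Int.fract (t - c)), circlePt_mem _⟩ := h2
  rwa [h4] at h5

/-- radial retraction onto the closed unit disc -/
noncomputable def rho (u : ℂ) : ℂ := ((max 1 ‖u‖)⁻¹ : ℝ) • u

theorem rho_cont : Continuous rho := by
  unfold rho
  have h1 : Continuous (fun u : ℂ => (max 1 ‖u‖)⁻¹) := by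
    refine Continuous.inv₀ (by fun_prop) fun u => ?_
    have : 1 ≤ max 1 ‖u‖ := le_max_left _ _
    positivity
  exact h1.smul continuous_id

theorem rho_in {u : ℂ} (hu : ‖u‖ ≤ 1) : rho u = u := by
  rw [rho, max_eq_left hu, inv_one, one_smul]

theorem rho_out {u : ℂ} (hu : 1 ≤ ‖u‖) : ‖rho u‖ = 1 := by
  rw [rho, max_eq_right hu, norm_smul, norm_inv, norm_norm, inv_mul_cancel₀ (by linarith)]

theorem rho_le (u : ℂ) : ‖rho u‖ ≤ 1 := by
  rcases le_total ‖u‖ 1 with h | h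
  · rw [rho_in h]; exact h
  · rw [rho_out h]

/-- identification of the two models of the plane -/
noncomputable def eC : ℂ ≃ₗᵢ[ℝ] EuclideanSpace ℝ (Fin 2) := Complex.orthonormalBasisOneI.repr

theorem eC_mem {u : ℂ} (hu : ‖u‖ ≤ 1) : eC u ∈ Disc2 := by
  rw [mem_closedBall, dist_zero_right, eC.norm_map]; exact hu

/-- extension by the identity -/
noncomputable def extC (φ : Disc2 → Disc2) (u : ℂ) : ℂ :=
  eC.symm (φ ⟨eC (rho u), eC_mem (rho_le u)⟩ : EuclideanSpace ℝ (Fin 2)) + (u - rho u)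

theorem extC_cont {φ : Disc2 → Disc2} (hφ : Continuous φ) : Continuous (extC φ) := by
  unfold extC
  refine Continuous.add ?_ (continuous_id.sub rho_cont)
  refine eC.symm.continuous.comp (continuous_subtype_val.comp (hφ.comp ?_))
  exact (eC.continuous.comp rho_cont).subtype_mk _

theorem extC_in (φ : Disc2 → Disc2) {u : ℂ} (hu : ‖u‖ ≤ 1) :
    extC φ u = eC.symm (φ ⟨eC u, eC_mem hu⟩ : EuclideanSpace ℝ (Fin 2)) := by
  unfold extC
  have : (⟨eC (rho u), eC_mem (rho_le u)⟩ : Disc2) = ⟨eC u, eC_mem hu⟩ :=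
    Subtype.ext (congrArg eC (rho_in hu))
  rw [this, rho_in hu, sub_self, add_zero]

theorem extC_in_le (φ : Disc2 → Disc2) {u : ℂ} (hu : ‖u‖ ≤ 1) : ‖extC φ u‖ ≤ 1 := by
  rw [extC_in φ hu, eC.symm.norm_map]
  have := (φ ⟨eC u, eC_mem hu⟩).2
  rwa [mem_closedBall, dist_zero_right] at this

theorem extC_out {φ : Disc2 → Disc2} (hφ : ∀ v : Disc2, ‖(v : EuclideanSpace ℝ (Fin 2))‖ = 1 → φ v = v)
    {u : ℂ} (hu : 1 ≤ ‖u‖) : extC φ u = u := by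
  unfold extC
  rw [hφ]
  · simp
  · change ‖eC (rho u)‖ = 1
    rw [eC.norm_map, rho_out hu]

theorem extC_comp {φ ψ : Disc2 → Disc2}
    (hφ : ∀ v : Disc2, ‖(v : EuclideanSpace ℝ (Fin 2))‖ = 1 → φ v = v)
    (hψ : ∀ v : Disc2, ‖(v : EuclideanSpace ℝ (Fin 2))‖ = 1 → ψ v = v)
    (h : ∀ v, φ (ψ v) = v) (u : ℂ) : extC φ (extC ψ u) = u := by
  rcases le_total ‖u‖ 1 with hu | hu
  · rw [extC_in φ (extC_in_le ψ hu)]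
    have : (⟨eC (extC ψ u), eC_mem (extC_in_le ψ hu)⟩ : Disc2) = ψ ⟨eC u, eC_mem hu⟩ :=
      Subtype.ext (by simp only [extC_in ψ hu, LinearIsometryEquiv.apply_symm_apply])
    rw [this, h]
    simp
  · rw [extC_out hψ hu, extC_out hφ hu]

theorem disc_main (g : Disc2 ≃ₜ Disc2)
    (hg : ∀ v : Disc2, ‖(v : EuclideanSpace ℝ (Fin 2))‖ = 1 → g v = v)
    (hrec : ∀ ε > 0, ∀ N : ℕ, ∃ n ≥ N, ∀ x : Disc2, dist (g^[n] x) x < ε) (x : Disc2) : g x = x := by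
  have hg' : ∀ v : Disc2, ‖(v : EuclideanSpace ℝ (Fin 2))‖ = 1 → g.symm v = v := by
    intro v hv
    rw [Homeomorph.symm_apply_eq, hg v hv]
  let h : ℂ ≃ₜ ℂ :=
    { toFun := extC g
      invFun := extC g.symm
      left_inv := extC_comp hg' hg (fun v => g.symm_apply_apply v)
      right_inv := extC_comp hg hg' (fun v => g.apply_symm_apply v)
      continuous_toFun := extC_cont g.continuous
      continuous_invFun := extC_cont g.symm.continuous }
  have hap : ∀ u, h u = extC g u := fun u => rfl
  have hh : IdOut h := fun u hu => extC_out hg hu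
  have hpow : ∀ (n : ℕ) (v : Disc2), (h ^ n) (eC.symm v) = eC.symm (g^[n] v) := by
    intro n
    induction n with
    | zero => intro v; rfl
    | succ n ih =>
      intro v
      have hv : ‖eC.symm (v : EuclideanSpace ℝ (Fin 2))‖ ≤ 1 := by
        rw [eC.symm.norm_map]
        have := v.2
        rwa [mem_closedBall, dist_zero_right] at this
      have h1 : h (eC.symm v) = eC.symm (g v) := by
        rw [hap, extC_in _ hv]
        have : (⟨eC (eC.symm v), eC_mem hv⟩ : Disc2) = v :=
          Subtype.ext (LinearIsometryEquiv.apply_symm_apply _ _)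
        rw [this]
      rw [pow_succ_app', h1, ih, Function.iterate_succ_apply]
  have hr : Recu h := by
    intro ε hε N
    obtain ⟨n, hn, hd⟩ := hrec ε hε N
    refine ⟨n, hn, fun u => ?_⟩
    rcases le_total ‖u‖ 1 with hu | hu
    · have h1 := hpow n ⟨eC u, eC_mem hu⟩
      have h2 := hd ⟨eC u, eC_mem hu⟩
      simp only [LinearIsometryEquiv.symm_apply_apply] at h1
      rw [h1]
      rw [Subtype.dist_eq, dist_eq_norm] at h2
      have h4 := eC.symm.norm_map ((g^[n] ⟨eC u, eC_mem hu⟩ : EuclideanSpace ℝ (Fin 2)) - eC u)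
      rw [map_sub, LinearIsometryEquiv.symm_apply_apply] at h4
      rw [h4]
      exact h2
    · rw [hh.pow n u hu, sub_self, norm_zero]; exact hε
  have h1 := hpow 1 x
  rw [pow_one, main_id hh hr] at h1
  have := eC.symm.injective h1
  exact (Subtype.ext this).symm

/-- A recurrent, orientation-reversing homeomorphism of the closed disc is an
involution. -/
theorem disc_recurrent_reversing_involution (f : Disc2 ≃ₜ Disc2)
    (hrec : IsRecurrent (f : Disc2 → Disc2))
    (hor : DiscOrientationReversing f) :
    ∀ x, f (f x) = x := by
  intro x
  refine disc_main (f.trans f) ?_ (rec_sq hrec) x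
  rintro ⟨v, hv⟩ hv1
  obtain ⟨t, rfl⟩ := circlePt_surj hv1
  exact circle_fix hrec hor t
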